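/- Let p be an odd prime, let k ≥ 0, and let M be a connected topological r-manifold. Suppose the elementary abelian group G = (ℤ/p)^k acts faithfully on M by homeomorphisms and the fixed point set of G on M is nonempty. Then k ≤ r/2 (equivalently, 2k ≤ r). -/

import Mathlib

/-- The group of self-homeomorphisms of a topological space, with composition
as multiplication: `(f * g) x = f (g x)`. -/
instance homeoGroup (X : Type*) [TopologicalSpace X] : Group (X ≃ₜ X) where
  one := Homeomorph.refl X
  mul f g := g.trans f
  inv := Homeomorph.symm
  mul_assoc f g h := rfl
  one_mul f := Homeomorph.ext fun _ => rfl
  mul_one f := Homeomorph.ext fun _ => rfl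
  inv_mul_cancel f := Homeomorph.ext fun x => f.symm_apply_apply x

lemma homeo_one_apply {X : Type*} [TopologicalSpace X] (x : X) :
    (1 : X ≃ₜ X) x = x := rfl

namespace SmithBound

open Filter Topology

section

section Chains

variable {R : Type*} [CommRing R] {E E' : Type*}

/-- Prepending a vertex to every simplex of a chain. -/
noncomputable def cone (R : Type*) [CommRing R] {E : Type*} (x : E) :
    (List E →₀ R) →ₗ[R] (List E →₀ R) :=
  Finsupp.lmapDomain R R (List.cons x)

/-- The (augmented) boundary of an ordered simplex. -/
noncomputable def bdList (R : Type*) [CommRing R] {E : Type*} : List E → (List E →₀ R)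
  | [] => 0
  | x :: l => Finsupp.single l 1 - cone R x (bdList R l)

/-- The (augmented) boundary operator on ordered chains. -/
noncomputable def bd (R : Type*) [CommRing R] (E : Type*) :
    (List E →₀ R) →ₗ[R] (List E →₀ R) :=
  Finsupp.linearCombination R (bdList R)

/-- The chain map induced by a map of vertices. -/
noncomputable def vmap (R : Type*) [CommRing R] {E E' : Type*} (f : E → E') :
    (List E →₀ R) →ₗ[R] (List E' →₀ R) :=
  Finsupp.lmapDomain R R (List.map f)

/-- Lists with all entries in a given set. -/
def listsIn (A : Set E) : Set (List E) := {l | ∀ a ∈ l, a ∈ A}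

/-- Lists of a given length. -/
def listsLen (E : Type*) (n : ℕ) : Set (List E) := {l | l.length = n}

@[simp] lemma cone_single (x : E) (l : List E) (c : R) :
    cone R x (Finsupp.single l c) = Finsupp.single (x :: l) c := by
  simp [cone, Finsupp.lmapDomain_apply, Finsupp.mapDomain_single]

@[simp] lemma vmap_single (f : E → E') (l : List E) (c : R) :
    vmap R f (Finsupp.single l c) = Finsupp.single (l.map f) c := by
  simp [vmap, Finsupp.lmapDomain_apply, Finsupp.mapDomain_single]

lemma bd_single (l : List E) : bd R E (Finsupp.single l 1) = bdList R l := by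
  simp [bd]

@[simp] lemma bd_single_nil : bd R E (Finsupp.single [] 1) = 0 := by
  simp [bd_single, bdList]

lemma bd_single_cons (x : E) (l : List E) :
    bd R E (Finsupp.single (x :: l) 1) =
      Finsupp.single l 1 - cone R x (bd R E (Finsupp.single l 1)) := by
  simp [bd_single, bdList]

/-- Two linear maps agree on chains supported on `s` once they agree on the simplices in `s`. -/
lemma eq_on_supported {M : Type*} [AddCommGroup M] [Module R M] {s : Set (List E)}
    {f g : (List E →₀ R) →ₗ[R] M}
    (h : ∀ l ∈ s, f (Finsupp.single l 1) = g (Finsupp.single l 1))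
    {c : List E →₀ R} (hc : c ∈ Finsupp.supported R R s) : f c = g c := by
  rw [Finsupp.supported_eq_span_single] at hc
  induction hc using Submodule.span_induction with
  | mem x hx => obtain ⟨l, hl, rfl⟩ := hx; exact h l hl
  | zero => simp
  | add x y _ _ hx hy => simp [hx, hy]
  | smul a x _ hx => simp [hx]

lemma map_supported {M : Type*} [AddCommGroup M] [Module R M] {s : Set (List E)}
    {f : (List E →₀ R) →ₗ[R] M} {P : Submodule R M}
    (h : ∀ l ∈ s, f (Finsupp.single l 1) ∈ P)
    {c : List E →₀ R} (hc : c ∈ Finsupp.supported R R s) : f c ∈ P := by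
  rw [Finsupp.supported_eq_span_single] at hc
  induction hc using Submodule.span_induction with
  | mem x hx => obtain ⟨l, hl, rfl⟩ := hx; exact h l hl
  | zero => simp
  | add x y _ _ hx hy => rw [map_add]; exact P.add_mem hx hy
  | smul a x _ hx => rw [map_smul]; exact P.smul_mem _ hx

lemma chain_hom_ext {M : Type*} [AddCommGroup M] [Module R M]
    {f g : (List E →₀ R) →ₗ[R] M}
    (h : ∀ l, f (Finsupp.single l 1) = g (Finsupp.single l 1)) : f = g := by
  ext l; simpa using h l

lemma single_mem_supported {s : Set (List E)} {l : List E} (h : l ∈ s) :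
    Finsupp.single l (1 : R) ∈ Finsupp.supported R R s :=
  Finsupp.single_mem_supported R 1 h

lemma bd_cone (x : E) (w : List E →₀ R) :
    bd R E (cone R x w) = w - cone R x (bd R E w) := by
  have : (bd R E) ∘ₗ (cone R x) = LinearMap.id - (cone R x) ∘ₗ (bd R E) := by
    apply chain_hom_ext; intro l
    simp [bd_single_cons]
  exact congrArg (fun f => f w) this

lemma bd_bd (w : List E →₀ R) : bd R E (bd R E w) = 0 := by
  have : (bd R E) ∘ₗ (bd R E) = 0 := by
    apply chain_hom_ext; intro l
    induction l with
    | nil => simp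
    | cons x l ih =>
      simp only [LinearMap.comp_apply, LinearMap.zero_apply] at ih ⊢
      rw [bd_single_cons, map_sub, bd_cone, ih]; simp
  exact congrArg (fun f => f w) this

lemma vmap_cone (f : E → E') (x : E) (w : List E →₀ R) :
    vmap R f (cone R x w) = cone R (f x) (vmap R f w) := by
  have : (vmap R f) ∘ₗ (cone R x) = (cone R (f x)) ∘ₗ (vmap R f) := by
    apply chain_hom_ext; intro l; simp
  exact congrArg (fun f => f w) this

lemma bd_vmap (f : E → E') (w : List E →₀ R) :
    bd R E' (vmap R f w) = vmap R f (bd R E w) := by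
  have : (bd R E') ∘ₗ (vmap R f) = (vmap R f) ∘ₗ (bd R E) := by
    apply chain_hom_ext; intro l
    induction l with
    | nil => simp
    | cons x l ih =>
      simp only [LinearMap.comp_apply, vmap_single, List.map_cons] at ih ⊢
      rw [bd_single_cons, bd_single_cons, ih, map_sub, vmap_cone]; simp
  exact congrArg (fun f => f w) this

lemma vmap_vmap {E'' : Type*} (g : E' → E'') (f : E → E') (w : List E →₀ R) :
    vmap R g (vmap R f w) = vmap R (g ∘ f) w := by
  have : (vmap R g) ∘ₗ (vmap R f) = vmap R (g ∘ f) := by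
    apply chain_hom_ext; intro l; simp
  exact congrArg (fun f => f w) this

lemma vmap_id (w : List E →₀ R) : vmap R (fun x : E => x) w = w := by
  have : vmap R (fun x : E => x) = LinearMap.id := by
    apply chain_hom_ext; intro l; simp
  exact congrArg (fun f => f w) this

lemma cone_mem {A : Set E} {x : E} (hx : x ∈ A) {w : List E →₀ R}
    (hw : w ∈ Finsupp.supported R R (listsIn A)) :
    cone R x w ∈ Finsupp.supported R R (listsIn A) := by
  refine map_supported (fun l hl => ?_) hw
  rw [cone_single]
  refine single_mem_supported ?_
  intro a ha
  rcases List.mem_cons.1 ha with rfl | h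
  exacts [hx, hl a h]

lemma cone_len {x : E} {n : ℕ} {w : List E →₀ R}
    (hw : w ∈ Finsupp.supported R R (listsLen E n)) :
    cone R x w ∈ Finsupp.supported R R (listsLen E (n + 1)) := by
  refine map_supported (fun l hl => ?_) hw
  rw [cone_single]
  refine single_mem_supported ?_
  simpa [listsLen] using hl

lemma bd_single_mem {A : Set E} {l : List E} (hl : l ∈ listsIn A) :
    bd R E (Finsupp.single l 1) ∈ Finsupp.supported R R (listsIn A) := by
  induction l with
  | nil => simp
  | cons x l ih =>
    have hl' : l ∈ listsIn A := fun a ha => hl a (List.mem_cons_of_mem _ ha)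
    rw [bd_single_cons]
    exact Submodule.sub_mem _ (single_mem_supported hl')
      (cone_mem (hl x List.mem_cons_self) (ih hl'))

lemma bd_mem {A : Set E} {w : List E →₀ R} (hw : w ∈ Finsupp.supported R R (listsIn A)) :
    bd R E w ∈ Finsupp.supported R R (listsIn A) :=
  map_supported (fun _ hl => bd_single_mem hl) hw

lemma bd_single_len {n : ℕ} {l : List E} (hl : l.length = n) :
    bd R E (Finsupp.single l 1) ∈ Finsupp.supported R R (listsLen E (n - 1)) := by
  induction l generalizing n with
  | nil => simp
  | cons x l ih =>
    rw [bd_single_cons]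
    subst hl
    refine Submodule.sub_mem _ (single_mem_supported (by simp [listsLen])) ?_
    rcases l with _ | ⟨y, l⟩
    · simp
    · exact cone_len (ih rfl)

lemma bd_len {n : ℕ} {w : List E →₀ R} (hw : w ∈ Finsupp.supported R R (listsLen E n)) :
    bd R E w ∈ Finsupp.supported R R (listsLen E (n - 1)) :=
  map_supported (fun _ hl => bd_single_len hl) hw

lemma vmap_mem {A : Set E} {B : Set E'} {f : E → E'} (hf : ∀ a ∈ A, f a ∈ B)
    {w : List E →₀ R} (hw : w ∈ Finsupp.supported R R (listsIn A)) :
    vmap R f w ∈ Finsupp.supported R R (listsIn B) := by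
  refine map_supported (fun l hl => ?_) hw
  rw [vmap_single]
  refine single_mem_supported ?_
  intro b hb
  obtain ⟨a, ha, rfl⟩ := List.mem_map.1 hb
  exact hf a (hl a ha)

lemma vmap_len {n : ℕ} {f : E → E'} {w : List E →₀ R}
    (hw : w ∈ Finsupp.supported R R (listsLen E n)) :
    vmap R f w ∈ Finsupp.supported R R (listsLen E' n) := by
  refine map_supported (fun l hl => ?_) hw
  rw [vmap_single]
  exact single_mem_supported (by simpa [listsLen] using hl)

/-- The homotopy from a vertex map `f` to a chain map `g`, on simplices. -/
noncomputable def prismList (f : E → E') (g : (List E →₀ R) →ₗ[R] (List E' →₀ R)) :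
    List E → (List E' →₀ R)
  | [] => 0
  | x :: l => cone R (f x) (g (Finsupp.single (x :: l) 1)) - cone R (f x) (prismList f g l)

/-- The homotopy from a vertex map `f` to a chain map `g`. -/
noncomputable def prism (f : E → E') (g : (List E →₀ R) →ₗ[R] (List E' →₀ R)) :
    (List E →₀ R) →ₗ[R] (List E' →₀ R) :=
  Finsupp.linearCombination R (prismList f g)

lemma prism_single_nil (f : E → E') (g : (List E →₀ R) →ₗ[R] (List E' →₀ R)) :
    prism f g (Finsupp.single [] 1) = 0 := by simp [prism, prismList]

lemma prism_single_cons (f : E → E') (g : (List E →₀ R) →ₗ[R] (List E' →₀ R)) (x : E)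
    (l : List E) :
    prism f g (Finsupp.single (x :: l) 1) = cone R (f x) (g (Finsupp.single (x :: l) 1)) -
      cone R (f x) (prism f g (Finsupp.single l 1)) := by simp [prism, prismList]

lemma prism_cone (f : E → E') (g : (List E →₀ R) →ₗ[R] (List E' →₀ R)) (x : E)
    (w : List E →₀ R) :
    prism f g (cone R x w) = cone R (f x) (g (cone R x w)) - cone R (f x) (prism f g w) := by
  have : (prism f g) ∘ₗ (cone R x) =
      (cone R (f x)) ∘ₗ g ∘ₗ (cone R x) - (cone R (f x)) ∘ₗ (prism f g) := by
    apply chain_hom_ext; intro l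
    simp [prism_single_cons]
  exact congrArg (fun f => f w) this

lemma prism_homotopy_single (f : E → E') (g : (List E →₀ R) →ₗ[R] (List E' →₀ R)) {A : Set E}
    (h0 : g (Finsupp.single [] 1) = Finsupp.single [] 1)
    (hg : ∀ l ∈ listsIn A, bd R E' (g (Finsupp.single l 1)) = g (bd R E (Finsupp.single l 1)))
    {l : List E} (hl : l ∈ listsIn A) :
    bd R E' (prism f g (Finsupp.single l 1)) + prism f g (bd R E (Finsupp.single l 1)) =
      g (Finsupp.single l 1) - vmap R f (Finsupp.single l 1) := by
  induction l with
  | nil => simp [prism_single_nil, h0]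
  | cons x l ih =>
    have hl' : l ∈ listsIn A := fun a ha => hl a (List.mem_cons_of_mem _ ha)
    have ih := ih hl'
    have h1 := hg (x :: l) hl
    have h2 : bd R E' (prism f g (Finsupp.single l 1)) =
      g (Finsupp.single l 1) - vmap R f (Finsupp.single l 1)
        - prism f g (bd R E (Finsupp.single l 1)) := by rw [← ih]; abel
    have h3 : vmap R f (Finsupp.single (x :: l) (1 : R)) =
      cone R (f x) (vmap R f (Finsupp.single l 1)) := by simp
    rw [prism_single_cons, h3]
    simp only [map_sub, bd_cone, h1, bd_single_cons, prism_cone, h2]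
    abel

lemma prism_homotopy (f : E → E') (g : (List E →₀ R) →ₗ[R] (List E' →₀ R)) {A : Set E}
    (h0 : g (Finsupp.single [] 1) = Finsupp.single [] 1)
    (hg : ∀ l ∈ listsIn A, bd R E' (g (Finsupp.single l 1)) = g (bd R E (Finsupp.single l 1)))
    {w : List E →₀ R} (hw : w ∈ Finsupp.supported R R (listsIn A)) :
    bd R E' (prism f g w) + prism f g (bd R E w) = g w - vmap R f w := by
  have := eq_on_supported (f := (bd R E') ∘ₗ (prism f g) + (prism f g) ∘ₗ (bd R E))
    (g := g - vmap R f) (fun l hl => prism_homotopy_single f g h0 hg hl) hw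
  exact this

lemma prism_vmap_homotopy (f g : E → E') (w : List E →₀ R) :
    bd R E' (prism f (vmap R g) w) + prism f (vmap R g) (bd R E w) =
      vmap R g w - vmap R f w := by
  refine prism_homotopy (A := Set.univ) f (vmap R g) (by simp) (fun l _ => bd_vmap g _) ?_
  rw [Finsupp.mem_supported]; intro l _ a _; trivial

lemma prism_mem {f : E → E'} {g : (List E →₀ R) →ₗ[R] (List E' →₀ R)} {A : Set E} {B : Set E'}
    (hf : ∀ a ∈ A, f a ∈ B)
    (hg : ∀ l ∈ listsIn A, g (Finsupp.single l 1) ∈ Finsupp.supported R R (listsIn B))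
    {w : List E →₀ R} (hw : w ∈ Finsupp.supported R R (listsIn A)) :
    prism f g w ∈ Finsupp.supported R R (listsIn B) := by
  refine map_supported (fun l hl => ?_) hw
  induction l with
  | nil => simp [prism_single_nil]
  | cons x l ih =>
    rw [prism_single_cons]
    have hx := hf x (hl x List.mem_cons_self)
    exact Submodule.sub_mem _ (cone_mem hx (hg _ hl))
      (cone_mem hx (ih fun a ha => hl a (List.mem_cons_of_mem _ ha)))

lemma prism_single_len {f : E → E'} {g : (List E →₀ R) →ₗ[R] (List E' →₀ R)}
    (hg : ∀ l : List E,
      g (Finsupp.single l 1) ∈ Finsupp.supported R R (listsLen E' l.length)) (l : List E) :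
    prism f g (Finsupp.single l 1) ∈ Finsupp.supported R R (listsLen E' (l.length + 1)) := by
  induction l with
  | nil => simp [prism_single_nil]
  | cons x l ih =>
    rw [prism_single_cons]
    exact Submodule.sub_mem _ (cone_len (hg _)) (cone_len ih)

lemma prism_len {f : E → E'} {g : (List E →₀ R) →ₗ[R] (List E' →₀ R)}
    (hg : ∀ l : List E,
      g (Finsupp.single l 1) ∈ Finsupp.supported R R (listsLen E' l.length)) {n : ℕ}
    {w : List E →₀ R} (hw : w ∈ Finsupp.supported R R (listsLen E n)) :
    prism f g w ∈ Finsupp.supported R R (listsLen E' (n + 1)) := by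
  refine map_supported (fun l hl => ?_) hw
  obtain rfl : l.length = n := hl
  exact prism_single_len hg l

lemma prism_comm {h : E → E} {h' : E' → E'} {f : E → E'}
    {g : (List E →₀ R) →ₗ[R] (List E' →₀ R)} (hf : ∀ x, f (h x) = h' (f x))
    (hg : ∀ w, g (vmap R h w) = vmap R h' (g w)) (w : List E →₀ R) :
    prism f g (vmap R h w) = vmap R h' (prism f g w) := by
  have : (prism f g) ∘ₗ (vmap R h) = (vmap R h') ∘ₗ (prism f g) := by
    apply chain_hom_ext; intro l
    induction l with
    | nil => simp [prism_single_nil]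
    | cons x l ih =>
      simp only [LinearMap.comp_apply, vmap_single, List.map_cons] at ih ⊢
      rw [prism_single_cons, prism_single_cons, ih, map_sub, vmap_cone, vmap_cone, ← hg, hf]
      simp
  exact congrArg (fun f => f w) this

end Chains

end

section

section RelLength

variable {k : Type*} [Field k] {Ω : Type*} [AddCommGroup Ω] [Module k Ω]

/-- The length of `A` modulo `A ⊓ B`. -/
noncomputable def rl (A B : Submodule k Ω) : ℕ∞ := Module.length k (A ⧸ B.submoduleOf A)

lemma rl_congr {A B P Q : Submodule k Ω} (g : Ω →ₗ[k] Ω) (h1 : ∀ p ∈ P, g p ∈ A)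
    (h2 : ∀ a ∈ A, ∃ p ∈ P, a - g p ∈ B) (h3 : ∀ p ∈ P, g p ∈ B ↔ p ∈ Q) :
    rl A B = rl P Q := by
  let φ : P →ₗ[k] (A ⧸ B.submoduleOf A) :=
    (B.submoduleOf A).mkQ ∘ₗ (g.restrict h1)
  have hsurj : Function.Surjective φ := by
    intro y
    obtain ⟨a, rfl⟩ := Submodule.Quotient.mk_surjective _ y
    obtain ⟨p, hp, hB⟩ := h2 a a.2
    refine ⟨⟨p, hp⟩, ?_⟩
    refine ((Submodule.Quotient.eq _).2 ?_).symm
    exact hB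
  have hker : LinearMap.ker φ = Q.submoduleOf P := by
    ext ⟨p, hp⟩
    simp only [φ, LinearMap.mem_ker, LinearMap.comp_apply, Submodule.mkQ_apply,
      Submodule.Quotient.mk_eq_zero]
    exact h3 p hp
  have e := (Submodule.quotEquivOfEq _ _ hker).symm.trans (φ.quotKerEquivOfSurjective hsurj)
  exact e.length_eq.symm

lemma rl_add {A B C : Submodule k Ω} (hBA : B ≤ A) (hC : A ⊓ C ≤ B) :
    rl A C = rl A B + rl B C := by
  have h1 : C.submoduleOf B ≤ (C.submoduleOf A).comap (Submodule.inclusion hBA) := by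
    intro x hx; exact hx
  have h2 : C.submoduleOf A ≤ (B.submoduleOf A).comap (LinearMap.id) := by
    intro x hx
    exact hC ⟨x.2, hx⟩
  have := Module.length_eq_add_of_exact
    (Submodule.mapQ (C.submoduleOf B) (C.submoduleOf A) (Submodule.inclusion hBA) h1)
    (Submodule.mapQ (C.submoduleOf A) (B.submoduleOf A) LinearMap.id h2) ?_ ?_ ?_
  · rw [add_comm]; exact this
  · rw [injective_iff_map_eq_zero]
    intro x hx
    obtain ⟨x, rfl⟩ := Submodule.Quotient.mk_surjective _ x
    rw [Submodule.mapQ_apply, Submodule.Quotient.mk_eq_zero] at hx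
    rw [Submodule.Quotient.mk_eq_zero]
    exact hx
  · intro y
    obtain ⟨y, rfl⟩ := Submodule.Quotient.mk_surjective _ y
    exact ⟨Submodule.Quotient.mk y, by simp⟩
  · intro y
    obtain ⟨y, rfl⟩ := Submodule.Quotient.mk_surjective _ y
    rw [Submodule.mapQ_apply, Submodule.Quotient.mk_eq_zero]
    constructor
    · intro h
      exact ⟨Submodule.Quotient.mk ⟨y.1, h⟩, by rw [Submodule.mapQ_apply]; rfl⟩
    · rintro ⟨x, hx⟩
      obtain ⟨x, rfl⟩ := Submodule.Quotient.mk_surjective _ x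
      rw [Submodule.mapQ_apply, Submodule.Quotient.eq] at hx
      have h4 : (x : Ω) - y ∈ C := hx
      have h5 : (x : Ω) - y ∈ B := hC ⟨A.sub_mem (hBA x.2) y.2, h4⟩
      have h6 : (y : Ω) ∈ B := by simpa using B.sub_mem x.2 h5
      exact h6

lemma rl_eq_zero {A B : Submodule k Ω} : rl A B = 0 ↔ A ≤ B := by
  rw [rl, Module.length_eq_zero_iff, Submodule.Quotient.subsingleton_iff,
    Submodule.submoduleOf_eq_top]

lemma rl_eq_one {A B : Submodule k Ω} :
    rl A B = 1 ↔ ∃ z ∈ A, z ∉ B ∧ ∀ c ∈ A, ∃ t : k, c - t • z ∈ B := by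
  rw [rl, Module.length_eq_one_iff]
  constructor
  · intro h
    have := (isSimpleModule_iff_toSpanSingleton_surjective.1 h).1
    obtain ⟨y, hy⟩ := exists_ne (0 : A ⧸ B.submoduleOf A)
    obtain ⟨z, rfl⟩ := Submodule.Quotient.mk_surjective _ y
    refine ⟨z, z.2, fun h' => hy ((Submodule.Quotient.mk_eq_zero _).2 h'), fun c hc => ?_⟩
    obtain ⟨t, ht⟩ := (isSimpleModule_iff_toSpanSingleton_surjective.1 h).2 _ hy
      (Submodule.Quotient.mk ⟨c, hc⟩)
    rw [LinearMap.toSpanSingleton_apply, ← Submodule.Quotient.mk_smul,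
      eq_comm, Submodule.Quotient.eq] at ht
    exact ⟨t, ht⟩
  · rintro ⟨z, hz, hzB, h⟩
    have key : ∀ y : A ⧸ B.submoduleOf A, ∃ t : k, y = t • Submodule.Quotient.mk ⟨z, hz⟩ := by
      intro y
      obtain ⟨c, rfl⟩ := Submodule.Quotient.mk_surjective _ y
      obtain ⟨t, ht⟩ := h c c.2
      refine ⟨t, ?_⟩
      rw [← Submodule.Quotient.mk_smul, Submodule.Quotient.eq]
      exact ht
    have hz0 : (Submodule.Quotient.mk ⟨z, hz⟩ : A ⧸ B.submoduleOf A) ≠ 0 := by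
      rw [Ne, Submodule.Quotient.mk_eq_zero]; exact hzB
    rw [isSimpleModule_iff_toSpanSingleton_surjective]
    refine ⟨⟨_, _, hz0⟩, fun y hy w => ?_⟩
    obtain ⟨t, rfl⟩ := key y
    obtain ⟨u, rfl⟩ := key w
    have ht : t ≠ 0 := by rintro rfl; simp at hy
    exact ⟨u * t⁻¹, by simp [smul_smul, ht]⟩

end RelLength

section Homology

variable {k : Type*} [Field k] {Ω : Type*} [AddCommGroup Ω] [Module k Ω]

/-- A graded family of submodules stable under a differential. -/
structure Gr (d : Ω →ₗ[k] Ω) (W : ℕ → Submodule k Ω) : Prop where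
  succ : ∀ n, ∀ w ∈ W (n + 1), d w ∈ W n
  zero : ∀ w ∈ W 0, d w = 0

/-- Relative cycles. -/
def cyc (d : Ω →ₗ[k] Ω) (V : Submodule k Ω) (W : ℕ → Submodule k Ω) (n : ℕ) : Submodule k Ω :=
  W n ⊓ V.comap d

/-- Relative boundaries. -/
def bdr (d : Ω →ₗ[k] Ω) (V : Submodule k Ω) (W : ℕ → Submodule k Ω) (n : ℕ) : Submodule k Ω :=
  (W (n + 1)).map d ⊔ V

/-- Dimension of the homology of `W` relative to `V`. -/
noncomputable def hl (d : Ω →ₗ[k] Ω) (V : Submodule k Ω) (W : ℕ → Submodule k Ω) (n : ℕ) : ℕ∞ :=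
  rl (cyc d V W n) (bdr d V W n)

/-- Vanishing of homology. -/
def Acy (d : Ω →ₗ[k] Ω) (V : Submodule k Ω) (W : ℕ → Submodule k Ω) (n : ℕ) : Prop :=
  ∀ c ∈ W n, d c ∈ V → ∃ w ∈ W (n + 1), c - d w ∈ V

variable {d : Ω →ₗ[k] Ω} {V : Submodule k Ω} {W W' W'' : ℕ → Submodule k Ω}

lemma mem_bdr {n : ℕ} {c : Ω} : c ∈ bdr d V W n ↔ ∃ w ∈ W (n + 1), c - d w ∈ V := by
  rw [bdr, Submodule.mem_sup]
  constructor
  · rintro ⟨_, ⟨w, hw, rfl⟩, v, hv, rfl⟩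
    exact ⟨w, hw, by simpa using hv⟩
  · rintro ⟨w, hw, hv⟩
    exact ⟨d w, ⟨w, hw, rfl⟩, _, hv, by simp⟩

lemma le_bdr {n : ℕ} : V ≤ bdr d V W n := le_sup_right

lemma d_mem_bdr {n : ℕ} {w : Ω} (hw : w ∈ W (n + 1)) : d w ∈ bdr d V W n :=
  le_sup_left (α := Submodule k Ω) ⟨w, hw, rfl⟩

lemma hl_eq_zero {n : ℕ} : hl d V W n = 0 ↔ Acy d V W n := by
  rw [hl, rl_eq_zero]
  constructor
  · intro h c hc hdc
    exact mem_bdr.1 (h ⟨hc, hdc⟩)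
  · rintro h c ⟨hc, hdc⟩
    exact mem_bdr.2 (h c hc hdc)

lemma hl_eq_one {n : ℕ} : hl d V W n = 1 ↔ ∃ z ∈ cyc d V W n, z ∉ bdr d V W n ∧
    ∀ c ∈ cyc d V W n, ∃ t : k, c - t • z ∈ bdr d V W n := rl_eq_one

/-- The numerical content of the long exact sequence. -/
lemma long_exact (hdd : ∀ x, d (d x) = 0) (hW : Gr d W)
    {f : Ω →ₗ[k] Ω} (hf : ∀ x, f (d x) = d (f x)) (hfV : ∀ v ∈ V, f v ∈ V)
    (hW' : ∀ n x, x ∈ W' n ↔ x ∈ W n ∧ f x ∈ V) (hW'' : ∀ n, W'' n = (W n).map f) :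
    ∃ ρ i j : ℕ → ℕ∞, ρ 0 = 0 ∧ ∀ n, hl d V W n = i n + j n ∧
      hl d V W' n = i n + ρ (n + 1) ∧ hl d V W'' n = ρ n + j n := by
  let Z := cyc d V W
  let B := bdr d V W
  let Z' := cyc d V W'
  let B' := bdr d V W'
  let Z'' := cyc d V W''
  let B'' := bdr d V W''
  let I : ℕ → Submodule k Ω := fun n => Z'' n ⊓ ((Z n).map f ⊔ B'' n)
  have mW'' : ∀ n x, x ∈ W'' n ↔ ∃ w ∈ W n, f w = x := by
    intro n x; rw [hW'']; exact Iff.rfl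
  have mZ : ∀ n x, x ∈ Z n ↔ x ∈ W n ∧ d x ∈ V := fun n x => Iff.rfl
  have mZ' : ∀ n x, x ∈ Z' n ↔ (x ∈ W n ∧ f x ∈ V) ∧ d x ∈ V := by
    intro n x; rw [← hW']; rfl
  have mZ'' : ∀ n x, x ∈ Z'' n ↔ (∃ w ∈ W n, f w = x) ∧ d x ∈ V := by
    intro n x; rw [← mW'']; rfl
  have mB : ∀ n x, x ∈ B n ↔ ∃ w ∈ W (n + 1), x - d w ∈ V := fun n x => mem_bdr
  have mB' : ∀ n x, x ∈ B' n ↔ ∃ w, (w ∈ W (n + 1) ∧ f w ∈ V) ∧ x - d w ∈ V := by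
    intro n x
    rw [mem_bdr]
    simp only [hW']
  have mB'' : ∀ n x, x ∈ B'' n ↔ ∃ w ∈ W (n + 1), x - d (f w) ∈ V := by
    intro n x
    rw [mem_bdr]
    simp only [mW'']
    constructor
    · rintro ⟨_, ⟨w, hw, rfl⟩, h⟩; exact ⟨w, hw, h⟩
    · rintro ⟨w, hw, h⟩; exact ⟨_, ⟨w, hw, rfl⟩, h⟩
  have mI : ∀ n x, x ∈ I n ↔ ((∃ w ∈ W n, f w = x) ∧ d x ∈ V) ∧
      ∃ z, (z ∈ W n ∧ d z ∈ V) ∧ ∃ w ∈ W (n + 1), x - f z - d (f w) ∈ V := by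
    intro n x
    rw [← mZ'']
    refine and_congr Iff.rfl ?_
    rw [SetLike.mem_coe, Submodule.mem_sup]
    constructor
    · rintro ⟨_, ⟨z, hz, rfl⟩, b, hb, rfl⟩
      exact ⟨z, hz, (mB'' n _).1 (by simpa using hb)⟩
    · rintro ⟨z, hz, h⟩
      exact ⟨f z, ⟨z, hz, rfl⟩, x - f z, (mB'' n _).2 h, by simp⟩
  let Y : ℕ → Submodule k Ω := fun n => Z n ⊓ (B'' n).comap f
  let K : ℕ → Submodule k Ω := fun n => Z' n ⊓ B n
  have mY : ∀ n x, x ∈ Y n ↔ x ∈ Z n ∧ f x ∈ B'' n := fun n x => Iff.rfl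
  have mK : ∀ n x, x ∈ K n ↔ x ∈ Z' n ∧ x ∈ B n := fun n x => Iff.rfl
  have hZ'Z : ∀ n, Z' n ≤ Z n := fun n x hx => ⟨((mZ' n x).1 hx).1.1, ((mZ' n x).1 hx).2⟩
  refine ⟨fun n => rl (Z'' n) (I n), fun n => rl (Y n) (B n), fun n => rl (Z n) (Y n), ?_,
    fun n => ⟨?_, ?_, ?_⟩⟩
  · refine rl_eq_zero.2 fun x hx => ?_
    obtain ⟨⟨w, hw, rfl⟩, h⟩ := (mZ'' 0 x).1 hx
    refine (mI 0 _).2 ⟨⟨⟨w, hw, rfl⟩, h⟩, w, ⟨hw, by simp [hW.zero w hw]⟩, 0, zero_mem _, by simp⟩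
  · rw [add_comm]
    refine rl_add (fun x hx => hx.1) ?_
    rintro x ⟨hx, hxB⟩
    obtain ⟨w, hw, h⟩ := (mB n x).1 hxB
    refine ⟨hx, (mB'' n _).2 ⟨w, hw, ?_⟩⟩
    have := hfV _ h
    rwa [map_sub, hf] at this
  · have e1 : rl (Y n) (B n) = rl (Z' n) (B n) := by
      refine rl_congr LinearMap.id (fun x hx => ?_) (fun y hy => ?_) (fun _ _ => Iff.rfl)
      · refine ⟨hZ'Z n hx, le_bdr ((mZ' n x).1 hx).1.2⟩
      · obtain ⟨hyZ, hyB⟩ := (mY n y).1 hy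
        obtain ⟨w, hw, h⟩ := (mB'' n _).1 hyB
        refine ⟨y - d w, (mZ' n _).2 ⟨⟨sub_mem hyZ.1 (hW.succ n w hw), ?_⟩, ?_⟩, ?_⟩
        · rwa [map_sub, hf]
        · rw [map_sub, hdd, sub_zero]; exact hyZ.2
        · simpa using d_mem_bdr hw
    have e2 : rl (Z' n) (K n) = rl (Z' n) (B n) :=
      rl_congr LinearMap.id (fun x hx => hx) (fun a ha => ⟨a, ha, by simp⟩)
        (fun x hx => ⟨fun h => h.2, fun h => ⟨hx, h⟩⟩)
    have e3 : rl (Z' n) (B' n) = rl (Z' n) (K n) + rl (K n) (B' n) := by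
      refine rl_add (fun x hx => hx.1) ?_
      rintro x ⟨hx, hxB⟩
      obtain ⟨w, hw, h⟩ := (mB' n x).1 hxB
      exact ⟨hx, (mB n x).2 ⟨w, hw.1, h⟩⟩
    let P : Submodule k Ω := W (n + 1) ⊓ (V.comap f).comap d
    have mP : ∀ x, x ∈ P ↔ x ∈ W (n + 1) ∧ f (d x) ∈ V := fun x => Iff.rfl
    let Q : Submodule k Ω := (I (n + 1)).comap f
    have e4 : rl (Z'' (n + 1)) (I (n + 1)) = rl P Q := by
      refine rl_congr f (fun x hx => ?_) (fun a ha => ?_) (fun x hx => Iff.rfl)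
      · exact (mZ'' _ _).2 ⟨⟨x, hx.1, rfl⟩, by rw [← hf]; exact hx.2⟩
      · obtain ⟨⟨w, hw, rfl⟩, h⟩ := (mZ'' _ a).1 ha
        exact ⟨w, (mP w).2 ⟨hw, by rwa [hf]⟩, by simp⟩
    have e5 : rl (K n) (B' n) = rl P Q := by
      refine rl_congr d (fun x hx => ?_) (fun a ha => ?_) (fun x hx => ?_)
      · refine (mK n _).2 ⟨(mZ' n _).2 ⟨⟨hW.succ n x hx.1, hx.2⟩, by simp [hdd]⟩, d_mem_bdr hx.1⟩
      · obtain ⟨h1, h2⟩ := (mK n a).1 ha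
        obtain ⟨w, hw, h⟩ := (mB n a).1 h2
        refine ⟨w, (mP w).2 ⟨hw, ?_⟩, le_bdr h⟩
        have h3 := sub_mem ((mZ' n a).1 h1).1.2 (hfV _ h)
        rwa [← map_sub, sub_sub_cancel] at h3
      · have hx' := (mP x).1 hx
        constructor
        · intro h
          obtain ⟨w, hw, h⟩ := (mB' n _).1 h
          refine (mI (n + 1) (f x)).2 ⟨⟨⟨x, hx.1, rfl⟩, by rw [← hf]; exact hx.2⟩, x - w,
            ⟨sub_mem hx.1 hw.1, by rwa [map_sub]⟩, 0, zero_mem _, ?_⟩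
          simpa using hw.2
        · intro h
          obtain ⟨-, z, hz, w, hw, h⟩ := (mI (n + 1) (f x)).1 h
          refine (mB' n _).2 ⟨x - z - d w, ⟨sub_mem (sub_mem hx.1 hz.1) (hW.succ _ w hw), ?_⟩, ?_⟩
          · rwa [map_sub, map_sub, hf]
          · simpa [hdd] using hz.2
    change rl (Z' n) (B' n) = _
    rw [e3, e5, ← e4, e2, ← e1]
  · have e1 : rl (I n) (B'' n) = rl (Z n) (Y n) := by
      refine rl_congr f (fun x hx => ?_) (fun a ha => ?_) (fun x hx => ?_)
      · refine (mI n _).2 ⟨⟨⟨x, hx.1, rfl⟩, ?_⟩, x, hx, 0, zero_mem _, by simp⟩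
        rw [← hf]; exact hfV _ hx.2
      · obtain ⟨-, z, hz, h⟩ := (mI n a).1 ha
        exact ⟨z, hz, (mB'' n _).2 h⟩
      · exact ⟨fun h => ⟨hx, h⟩, fun h => h.2⟩
    have e2 : rl (Z'' n) (B'' n) = rl (Z'' n) (I n) + rl (I n) (B'' n) := by
      refine rl_add (fun x hx => hx.1) ?_
      rintro x ⟨hx, hxB⟩
      exact ⟨hx, le_sup_right (α := Submodule k Ω) hxB⟩
    change rl (Z'' n) (B'' n) = _
    rw [e2, e1]

/-- Homology is additive on direct sums modulo `V`. -/
lemma hl_direct_sum {W₁ W₂ : ℕ → Submodule k Ω} (hdd : ∀ x, d (d x) = 0)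
    (hdV : ∀ v ∈ V, d v ∈ V) (h₁ : Gr d W₁) (h₂ : Gr d W₂) (hle₁ : ∀ n, W₁ n ≤ W' n)
    (hle₂ : ∀ n, W₂ n ≤ W' n)
    (hsup : ∀ n, ∀ w ∈ W' n, ∃ w₁ ∈ W₁ n, ∃ w₂ ∈ W₂ n, w - (w₁ + w₂) ∈ V)
    (hdir : ∀ n, ∀ w₁ ∈ W₁ n, ∀ w₂ ∈ W₂ n, w₁ + w₂ ∈ V → w₂ ∈ V) (n : ℕ) :
    hl d V W' n = hl d V W₁ n + hl d V W₂ n := by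
  let K : Submodule k Ω := cyc d V W' n ⊓ (W₁ n ⊔ bdr d V W' n)
  have mK : ∀ x, x ∈ K ↔ (x ∈ W' n ∧ d x ∈ V) ∧
      ∃ w₁ ∈ W₁ n, ∃ w ∈ W' (n + 1), x - w₁ - d w ∈ V := by
    intro x
    refine and_congr Iff.rfl ?_
    rw [SetLike.mem_coe, Submodule.mem_sup]
    constructor
    · rintro ⟨a, ha, b, hb, rfl⟩
      exact ⟨a, ha, mem_bdr.1 (by simpa using hb)⟩
    · rintro ⟨a, ha, h⟩
      exact ⟨a, ha, x - a, mem_bdr.2 h, by simp⟩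
  have hdir' : ∀ n, ∀ w₁ ∈ W₁ n, ∀ w₂ ∈ W₂ n, w₁ + w₂ ∈ V → w₁ ∈ V := by
    intro n w₁ h1 w₂ h2 h
    have := sub_mem h (hdir n w₁ h1 w₂ h2 h)
    simpa using this
  have hd2 : ∀ w₁ ∈ W₁ n, ∀ w₂ ∈ W₂ n, d w₁ + d w₂ ∈ V → d w₂ ∈ V := by
    intro w₁ hw₁ w₂ hw₂ h
    rcases n with _ | n
    · simp [h₂.zero w₂ hw₂]
    · exact hdir n _ (h₁.succ n _ hw₁) _ (h₂.succ n _ hw₂) h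
  have split : ∀ w ∈ W' (n + 1), ∃ w₁ ∈ W₁ (n + 1), ∃ w₂ ∈ W₂ (n + 1),
      d w - d w₁ - d w₂ ∈ V := by
    intro w hw
    obtain ⟨w₁, hw₁, w₂, hw₂, h⟩ := hsup _ w hw
    refine ⟨w₁, hw₁, w₂, hw₂, ?_⟩
    have := hdV _ h
    rwa [map_sub, map_add, ← sub_sub] at this
  have e0 : rl (cyc d V W' n) (bdr d V W' n) = rl (cyc d V W' n) K + rl K (bdr d V W' n) :=
    rl_add (fun x hx => hx.1) (fun x hx => ⟨hx.1, le_sup_right (α := Submodule k Ω) hx.2⟩)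
  have e1 : rl K (bdr d V W' n) = rl (cyc d V W₁ n) (bdr d V W₁ n) := by
    refine rl_congr LinearMap.id (fun x hx => ?_) (fun a ha => ?_) (fun x hx => ?_)
    · exact (mK x).2 ⟨⟨hle₁ n hx.1, hx.2⟩, x, hx.1, 0, zero_mem _, by simp⟩
    · obtain ⟨h1, w₁, hw₁, w, hw, h⟩ := (mK a).1 ha
      refine ⟨w₁, ⟨hw₁, ?_⟩, mem_bdr.2 ⟨w, hw, h⟩⟩
      have := sub_mem h1.2 (hdV _ h)
      rw [← map_sub] at this
      change d w₁ ∈ V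
      have e : d (a - (a - w₁ - d w)) = d w₁ := by
        simp only [map_sub, hdd]; abel
      rwa [e] at this
    · constructor
      · intro h
        obtain ⟨w, hw, h⟩ := mem_bdr.1 h
        obtain ⟨w₁, hw₁, w₂, hw₂, h'⟩ := split w hw
        refine mem_bdr.2 ⟨w₁, hw₁, hdir' n _ (sub_mem hx.1 (h₁.succ _ _ hw₁)) (- d w₂)
          (neg_mem (h₂.succ _ _ hw₂)) ?_⟩
        have := add_mem h h'
        convert this using 1
        simp only [LinearMap.id_apply]; abel
      · intro h
        obtain ⟨w, hw, h⟩ := mem_bdr.1 h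
        exact mem_bdr.2 ⟨w, hle₁ _ hw, h⟩
  have e2 : rl (cyc d V W' n) K = rl (cyc d V W₂ n) (bdr d V W₂ n) := by
    refine rl_congr LinearMap.id (fun x hx => ⟨hle₂ n hx.1, hx.2⟩) (fun a ha => ?_)
      (fun x hx => ?_)
    · obtain ⟨w₁, hw₁, w₂, hw₂, h⟩ := hsup n a ha.1
      have hd := hdV _ h
      rw [map_sub, map_add] at hd
      have hd' : d w₁ + d w₂ ∈ V := by
        have := sub_mem (show d a ∈ V from ha.2) hd
        simpa using this
      have hd3 := hd2 w₁ hw₁ w₂ hw₂ hd'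
      refine ⟨w₂, ⟨hw₂, hd3⟩, (mK _).2 ⟨⟨sub_mem ha.1 (hle₂ _ hw₂), ?_⟩, w₁, hw₁, 0,
        zero_mem _, ?_⟩⟩
      · rw [map_sub]; exact sub_mem ha.2 hd3
      · convert h using 1
        simp only [LinearMap.id_apply, map_zero]; abel
    · constructor
      · intro h
        obtain ⟨h1, w₁, hw₁, w, hw, h⟩ := (mK _).1 h
        obtain ⟨u₁, hu₁, u₂, hu₂, h'⟩ := split w hw
        refine mem_bdr.2 ⟨u₂, hu₂, hdir n (- w₁ - d u₁)
          (sub_mem (neg_mem hw₁) (h₁.succ _ _ hu₁)) _ (sub_mem hx.1 (h₂.succ _ _ hu₂)) ?_⟩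
        have := add_mem h h'
        convert this using 1
        simp only [LinearMap.id_apply]; abel
      · intro h
        obtain ⟨w, hw, h⟩ := mem_bdr.1 h
        exact (mK _).2 ⟨⟨hle₂ _ hx.1, hx.2⟩, 0, zero_mem _, w, hle₂ _ hw, by simpa using h⟩
  rw [hl, e0, e1, e2, add_comm]; rfl

end Homology

end

section

section Numerics

/-- The numerical shape of a long exact sequence. -/
def LES (h h' h'' : ℕ → ℕ∞) : Prop :=
  ∃ ρ i j : ℕ → ℕ∞, ρ 0 = 0 ∧ ∀ n, h n = i n + j n ∧ h' n = i n + ρ (n + 1) ∧ h'' n = ρ n + j n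

lemma LES.le {h h' h'' : ℕ → ℕ∞} (H : LES h h' h'') (n : ℕ) : h' n ≤ h n + h'' (n + 1) := by
  obtain ⟨ρ, i, j, -, H⟩ := H
  rw [(H n).1, (H n).2.1, (H (n + 1)).2.2]
  exact add_le_add le_self_add le_self_add

lemma LES.le_add {h h' h'' : ℕ → ℕ∞} (H : LES h h' h'') (n : ℕ) : h n ≤ h' n + h'' n := by
  obtain ⟨ρ, i, j, -, H⟩ := H
  rw [(H n).1, (H n).2.1, (H n).2.2]
  exact add_le_add le_self_add le_add_self

/-- Truncated Euler characteristic. -/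
noncomputable def euler (M : ℕ) (h : ℕ → ℕ∞) : ℤ :=
  ∑ n ∈ Finset.range (M + 1), (-1) ^ n * ((h n).toNat : ℤ)

lemma LES.euler {h h' h'' : ℕ → ℕ∞} (H : LES h h' h'') {M : ℕ} (hf : ∀ n, h n ≠ ⊤)
    (hf'' : ∀ n, h'' n ≠ ⊤) (hM : ∀ n > M, h'' n = 0) :
    euler M h' + euler M h'' = euler M h := by
  obtain ⟨ρ, i, j, h0, H⟩ := H
  have fi : ∀ n, i n ≠ ⊤ := fun n e => hf n (by rw [(H n).1, e]; simp)
  have fj : ∀ n, j n ≠ ⊤ := fun n e => hf n (by rw [(H n).1, e]; simp)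
  have fρ : ∀ n, ρ n ≠ ⊤ := fun n e => hf'' n (by rw [(H n).2.2, e]; simp)
  lift i to ℕ → ℕ using fi
  lift j to ℕ → ℕ using fj
  lift ρ to ℕ → ℕ using fρ
  have e1 : ∀ n, (h n).toNat = i n + j n := by
    intro n; rw [(H n).1, ← Nat.cast_add, ENat.toNat_natCast]
  have e2 : ∀ n, (h' n).toNat = i n + ρ (n + 1) := by
    intro n; rw [(H n).2.1, ← Nat.cast_add, ENat.toNat_natCast]
  have e3 : ∀ n, (h'' n).toNat = ρ n + j n := by
    intro n; rw [(H n).2.2, ← Nat.cast_add, ENat.toNat_natCast]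
  have h0' : ρ 0 = 0 := by simpa using h0
  have hM' : ρ (M + 1) = 0 := by
    have := e3 (M + 1)
    rw [hM _ (Nat.lt_succ_self M)] at this
    simp at this; omega
  have key : ∀ m : ℕ, SmithBound.euler m h' + SmithBound.euler m h'' =
      SmithBound.euler m h + (-1) ^ m * (ρ (m + 1) : ℤ) := by
    intro m
    induction m with
    | zero => simp [SmithBound.euler, e1, e2, e3, h0']; ring
    | succ m ih =>
      have s : ∀ g : ℕ → ℕ∞, SmithBound.euler (m + 1) g =
          SmithBound.euler m g + (-1) ^ (m + 1) * ((g (m + 1)).toNat : ℤ) := fun g =>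
        Finset.sum_range_succ _ _
      rw [s, s, s, e1, e2, e3]
      push_cast
      rw [pow_succ]
      linear_combination ih
  rw [key M, hM']; simp

lemma euler_add {M : ℕ} {f g : ℕ → ℕ∞} (hf : ∀ n, f n ≠ ⊤) (hg : ∀ n, g n ≠ ⊤) :
    euler M (fun n => f n + g n) = euler M f + euler M g := by
  simp only [euler, ← Finset.sum_add_distrib]
  refine Finset.sum_congr rfl fun n _ => ?_
  rw [ENat.toNat_add (hf n) (hg n)]; push_cast; ring

lemma euler_single {M n : ℕ} {f : ℕ → ℕ∞} (hn : n ≤ M) (h1 : f n = 1)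
    (h0 : ∀ m, m ≠ n → f m = 0) : euler M f = (-1) ^ n := by
  rw [euler, Finset.sum_eq_single n]
  · simp [h1]
  · intro m _ hm; simp [h0 m hm]
  · intro h; simp at h; omega

lemma smith_numeric {p : ℕ} (hodd : Odd p) (h1 : 1 < p) {r M : ℕ} {c f : ℕ → ℕ∞}
    {s : ℕ → ℕ → ℕ∞}
    (hc1 : c r = 1) (hc0 : ∀ m, m ≠ r → c m = 0)
    (L1 : LES c (fun n => s (p - 1) n + f n) (s 1))
    (L2 : LES c (fun n => s 1 n + f n) (s (p - 1)))
    (L3 : ∀ j, 1 ≤ j → j + 1 < p → LES (s j) (s (p - 1)) (s (j + 1)))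
    (hM : ∀ n > M, f n = 0 ∧ ∀ j, s j n = 0) :
    (∀ n > r, f n = 0 ∧ s 1 n = 0 ∧ s (p - 1) n = 0) ∧
      ∃ n ≤ r, n % 2 = r % 2 ∧ f n = 1 ∧ ∀ m, m ≠ n → f m = 0 := by
  have hab : ∀ n > r, f n = 0 ∧ s 1 n = 0 ∧ s (p - 1) n = 0 := by
    have key : ∀ t n, M < n + t → r < n → f n = 0 ∧ s 1 n = 0 ∧ s (p - 1) n = 0 := by
      intro t
      induction t with
      | zero => intro n h _; exact ⟨(hM n h).1, (hM n h).2 1, (hM n h).2 _⟩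
      | succ t ih =>
        intro n h hr
        obtain ⟨-, h2, h3⟩ := ih (n + 1) (by omega) (by omega)
        have l1 := L1.le n
        have l2 := L2.le n
        rw [hc0 n (by omega), h2] at l1
        rw [hc0 n (by omega), h3] at l2
        simp only [add_zero, nonpos_iff_eq_zero, add_eq_zero] at l1 l2
        exact ⟨l1.2, l2.1, l1.1⟩
    intro n hn
    exact key (M + 1) n (by omega) hn
  refine ⟨hab, ?_⟩
  have hsum : ∀ t, t ≤ r → s 1 (r - t) + ∑ m ∈ Finset.Icc (r - t) r, f m ≤ 1 ∧
      s (p - 1) (r - t) + ∑ m ∈ Finset.Icc (r - t) r, f m ≤ 1 := by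
    intro t
    induction t with
    | zero =>
      intro _
      have l1 := L1.le r
      have l2 := L2.le r
      rw [hc1, (hab (r + 1) (by omega)).2.1] at l1
      rw [hc1, (hab (r + 1) (by omega)).2.2] at l2
      simpa using ⟨l2, l1⟩
    | succ t ih =>
      intro ht
      obtain ⟨i1, i2⟩ := ih (by omega)
      have l1 := L1.le (r - (t + 1))
      have l2 := L2.le (r - (t + 1))
      rw [hc0 _ (by omega), zero_add, show r - (t + 1) + 1 = r - t by omega] at l1 l2
      have e : ∑ m ∈ Finset.Icc (r - (t + 1)) r, f m =
          f (r - (t + 1)) + ∑ m ∈ Finset.Icc (r - t) r, f m := by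
        rw [← Finset.insert_Icc_add_one_left_eq_Icc (by omega : r - (t + 1) ≤ r),
          Finset.sum_insert (by simp), show r - (t + 1) + 1 = r - t by omega]
      rw [e, ← add_assoc, ← add_assoc]
      exact ⟨(add_le_add_left l2 _).trans i2, (add_le_add_left l1 _).trans i1⟩
  have hle : ∀ n ≤ r, s 1 n ≤ 1 ∧ s (p - 1) n ≤ 1 := by
    intro n hn
    have := hsum (r - n) (by omega)
    rw [show r - (r - n) = n by omega] at this
    exact ⟨le_self_add.trans this.1, le_self_add.trans this.2⟩
  have hS : ∑ m ∈ Finset.Icc 0 r, f m ≤ 1 := by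
    have := (hsum r le_rfl).1
    rw [Nat.sub_self] at this
    exact le_add_self.trans this
  have hfle : ∀ n, f n ≤ 1 := by
    intro n
    by_cases hn : n ≤ r
    · exact (Finset.single_le_sum (f := f) (fun _ _ => zero_le) (by simp [hn])).trans hS
    · rw [(hab n (by omega)).1]; exact zero_le
  have ne_top : ∀ {x : ℕ∞}, x ≤ 1 → x ≠ ⊤ := fun h => ne_top_of_le_ne_top (by simp) h
  have ffin : ∀ n, f n ≠ ⊤ := fun n => ne_top (hfle n)
  have fin1 : ∀ n, s 1 n ≠ ⊤ := by
    intro n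
    by_cases hn : n ≤ r
    · exact ne_top (hle n hn).1
    · rw [(hab n (by omega)).2.1]; simp
  have finp : ∀ n, s (p - 1) n ≠ ⊤ := by
    intro n
    by_cases hn : n ≤ r
    · exact ne_top (hle n hn).2
    · rw [(hab n (by omega)).2.2]; simp
  have cfin : ∀ n, c n ≠ ⊤ := by
    intro n
    by_cases hn : n = r
    · rw [hn, hc1]; simp
    · rw [hc0 n hn]; simp
  set N := max M r with hN
  have hMN : ∀ j, ∀ n > N, s j n = 0 := fun j n hn => (hM n (by omega)).2 j
  have echain : ∀ t, t + 1 < p → (∀ n, s (p - 1 - t) n ≠ ⊤) ∧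
      euler N (s (p - 1 - t)) = (t + 1) * euler N (s (p - 1)) := by
    intro t
    induction t with
    | zero => intro _; exact ⟨finp, by simp⟩
    | succ t ih =>
      intro ht
      obtain ⟨i1, i2⟩ := ih (by omega)
      have L := L3 (p - 1 - (t + 1)) (by omega) (by omega)
      rw [show p - 1 - (t + 1) + 1 = p - 1 - t by omega] at L
      have fin : ∀ n, s (p - 1 - (t + 1)) n ≠ ⊤ := fun n =>
        ne_top_of_le_ne_top (by simpa using ⟨finp n, i1 n⟩) (L.le_add n)
      refine ⟨fin, ?_⟩
      rw [← L.euler fin i1 (hMN _), i2]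
      push_cast; ring
  have e1 := (echain (p - 2) (by omega)).2
  rw [show p - 1 - (p - 2) = 1 by omega] at e1
  have e2 := L1.euler cfin fin1 (hMN 1)
  rw [euler_add finp ffin, e1, euler_single (by omega) hc1 hc0] at e2
  have e3 : (p : ℤ) * euler N (s (p - 1)) + euler N f = (-1) ^ r := by
    rw [← e2]
    have : ((p - 2 : ℕ) : ℤ) = p - 2 := by omega
    rw [this]; ring
  have hp3 : (3 : ℤ) ≤ p := by obtain ⟨m, rfl⟩ := hodd; push_cast; omega
  have nodvd : ∀ x : ℤ, x ≠ 0 → |x| ≤ 2 → ¬ (p : ℤ) ∣ x := by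
    intro x hx hx2 hd
    have := Int.le_of_dvd (abs_pos.2 hx) ((dvd_abs _ _).2 hd)
    omega
  have hex : ∃ n ≤ r, f n ≠ 0 := by
    by_contra hcon
    push Not at hcon
    have : euler N f = 0 := by
      refine Finset.sum_eq_zero fun n _ => ?_
      by_cases hn : n ≤ r
      · simp [hcon n hn]
      · simp [(hab n (by omega)).1]
    rw [this, add_zero] at e3
    refine nodvd ((-1) ^ r) (by simp) (by simp) ⟨_, e3.symm⟩
  obtain ⟨n, hn, hfn⟩ := hex
  have hf1 : f n = 1 := le_antisymm (hfle n) (Order.one_le_iff_ne_zero.2 hfn)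
  have hf0 : ∀ m, m ≠ n → f m = 0 := by
    intro m hm
    by_cases hmr : m ≤ r
    · have : f n + f m ≤ 1 := by
        refine le_trans ?_ hS
        rw [← Finset.sum_pair (Ne.symm hm)]
        refine Finset.sum_le_sum_of_subset ?_
        intro x hx
        simp only [Finset.mem_insert, Finset.mem_singleton] at hx
        simp only [Finset.mem_Icc, zero_le, true_and]
        rcases hx with rfl | rfl <;> assumption
      rw [hf1] at this
      have h3 := ne_top (hfle m)
      lift f m to ℕ using h3 with a
      norm_cast at this ⊢
      omega
    · exact (hab m (by omega)).1
  refine ⟨n, hn, ?_, hf1, hf0⟩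
  rw [euler_single (by omega) hf1 hf0] at e3
  by_contra hpar
  have hd : (p : ℤ) ∣ (-1) ^ r - (-1) ^ n := ⟨euler N (s (p - 1)), by rw [← e3]; ring⟩
  rcases Nat.even_or_odd r with hr | hr <;> rcases Nat.even_or_odd n with hn' | hn'
  · rw [Nat.even_iff] at hr hn'; omega
  · rw [hr.neg_one_pow, hn'.neg_one_pow] at hd
    exact nodvd _ (by norm_num) (by norm_num) hd
  · rw [hr.neg_one_pow, hn'.neg_one_pow] at hd
    exact nodvd _ (by norm_num) (by norm_num) hd
  · rw [Nat.odd_iff] at hr hn'; omega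

end Numerics

end

section

section Smith

variable {k : Type*} [Field k] {Ω : Type*} [AddCommGroup Ω] [Module k Ω]

/-- Relative homology concentrated in degree `n`, where it is one-dimensional. -/
def Sph (d : Ω →ₗ[k] Ω) (V : Submodule k Ω) (W : ℕ → Submodule k Ω) (n : ℕ) : Prop :=
  hl d V W n = 1 ∧ ∀ m, m ≠ n → hl d V W m = 0

lemma Sph.acy {d : Ω →ₗ[k] Ω} {V : Submodule k Ω} {W : ℕ → Submodule k Ω} {n : ℕ}
    (h : Sph d V W n) {m : ℕ} (hm : m ≠ n) : Acy d V W m := hl_eq_zero.1 (h.2 m hm)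

lemma Sph.unique {d : Ω →ₗ[k] Ω} {V : Submodule k Ω} {W : ℕ → Submodule k Ω} {n m : ℕ}
    (h : Sph d V W n) (h' : Sph d V W m) : n = m := by
  by_contra hne
  have := h'.2 n hne
  rw [h.1] at this
  exact one_ne_zero this

lemma Gr.map {d : Ω →ₗ[k] Ω} {W : ℕ → Submodule k Ω} (hW : Gr d W) {f : Ω →ₗ[k] Ω}
    (hf : ∀ x, f (d x) = d (f x)) : Gr d (fun n => (W n).map f) where
  succ := by
    rintro n _ ⟨w, hw, rfl⟩
    exact ⟨d w, hW.succ n w hw, hf w⟩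
  zero := by
    rintro _ ⟨w, hw, rfl⟩
    rw [← hf, hW.zero w hw, map_zero]

/-- A nilpotent operator commuting with the differential acts trivially on one-dimensional
homology. -/
lemma nilpotent_mem_bdr {d : Ω →ₗ[k] Ω} {V : Submodule k Ω} {W : ℕ → Submodule k Ω} {n : ℕ}
    (h : hl d V W n = 1) {f : Ω →ₗ[k] Ω} (hf : ∀ x, f (d x) = d (f x))
    (hfV : ∀ v ∈ V, f v ∈ V) (hfW : ∀ n, ∀ w ∈ W n, f w ∈ W n) {q : ℕ}
    (hq : ∀ x, (f ^ q) x = 0) {z : Ω} (hz : z ∈ W n) (hdz : d z ∈ V) : f z ∈ bdr d V W n := by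
  obtain ⟨y, hy, hyB, hgen⟩ := hl_eq_one.1 h
  have hfB : ∀ b ∈ bdr d V W n, f b ∈ bdr d V W n := by
    intro b hb
    obtain ⟨w, hw, hv⟩ := mem_bdr.1 hb
    refine mem_bdr.2 ⟨f w, hfW _ w hw, ?_⟩
    have := hfV _ hv
    rwa [map_sub, hf] at this
  have hcyc : ∀ c ∈ cyc d V W n, f c ∈ cyc d V W n := by
    rintro c ⟨hc, hdc⟩
    exact ⟨hfW n c hc, by change d (f c) ∈ V; rw [← hf]; exact hfV _ hdc⟩
  obtain ⟨t, ht⟩ := hgen _ (hcyc y hy)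
  have ht0 : t = 0 := by
    by_contra hne
    have : ∀ q : ℕ, (f ^ q) y - t ^ q • y ∈ bdr d V W n := by
      intro q
      induction q with
      | zero => simp
      | succ q ih =>
        have := add_mem (hfB _ ih) (Submodule.smul_mem _ (t ^ q) ht)
        rw [map_sub, map_smul, smul_sub, smul_smul, ← pow_succ, sub_add_sub_cancel] at this
        rwa [pow_succ', Module.End.mul_apply]
    have h2 := this q
    rw [hq, zero_sub, neg_mem_iff] at h2
    exact hyB ((Submodule.smul_mem_iff _ (pow_ne_zero _ hne)).1 h2)
  rw [ht0, zero_smul, sub_zero] at ht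
  obtain ⟨u, hu⟩ := hgen z ⟨hz, hdz⟩
  have := add_mem (hfB _ hu) (Submodule.smul_mem _ u ht)
  rwa [map_sub, map_smul, sub_add_cancel] at this

/-- The algebraic input of Smith theory for an operator `σ = 1 - g` with `g ^ p = 1`. -/
structure SmithData (p : ℕ) (d : Ω →ₗ[k] Ω) (V : Submodule k Ω) (σ : Ω →ₗ[k] Ω)
    (W F : ℕ → Submodule k Ω) : Prop where
  dd : ∀ x, d (d x) = 0
  dV : ∀ v ∈ V, d v ∈ V
  grW : Gr d W
  grF : Gr d F
  F_le : ∀ n, F n ≤ W n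
  comm : ∀ x, σ (d x) = d (σ x)
  σV : ∀ v ∈ V, σ v ∈ V
  σW : ∀ n, ∀ w ∈ W n, σ w ∈ W n
  σF : ∀ n, ∀ f ∈ F n, σ f = 0
  pow : ∀ x, (σ ^ p) x = 0
  kerσ : ∀ n, ∀ c ∈ W n, σ c ∈ V → ∃ w ∈ W n, ∃ f ∈ F n, c - ((σ ^ (p - 1)) w + f) ∈ V
  kerτ : ∀ n, ∀ c ∈ W n, (σ ^ (p - 1)) c ∈ V → ∃ w ∈ W n, ∃ f ∈ F n, c - (σ w + f) ∈ V
  indep : ∀ n, ∀ w ∈ W n, ∀ f ∈ F n, σ w + f ∈ V → f ∈ V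
  vanish : ∃ M, ∀ n > M, Acy d V F n ∧ ∀ j, Acy d V (fun m => (W m).map (σ ^ j)) n

variable {p : ℕ} {d : Ω →ₗ[k] Ω} {V : Submodule k Ω} {σ : Ω →ₗ[k] Ω} {W F : ℕ → Submodule k Ω}

lemma SmithData.pow_comm (S : SmithData p d V σ W F) (j : ℕ) (x : Ω) :
    (σ ^ j) (d x) = d ((σ ^ j) x) := by
  induction j with
  | zero => simp
  | succ j ih => rw [pow_succ', Module.End.mul_apply, Module.End.mul_apply, ih, S.comm]

lemma SmithData.pow_V (S : SmithData p d V σ W F) (j : ℕ) {v : Ω} (hv : v ∈ V) :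
    (σ ^ j) v ∈ V := by
  induction j with
  | zero => simpa
  | succ j ih => rw [pow_succ', Module.End.mul_apply]; exact S.σV _ ih

lemma SmithData.pow_W (S : SmithData p d V σ W F) (j : ℕ) {n : ℕ} {w : Ω} (hw : w ∈ W n) :
    (σ ^ j) w ∈ W n := by
  induction j with
  | zero => simpa
  | succ j ih => rw [pow_succ', Module.End.mul_apply]; exact S.σW _ _ ih

lemma SmithData.pow_F (S : SmithData p d V σ W F) {j : ℕ} (hj : 1 ≤ j) {n : ℕ} {f : Ω}
    (hf : f ∈ F n) : (σ ^ j) f = 0 := by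
  obtain ⟨j, rfl⟩ := Nat.exists_eq_add_of_le' hj
  rw [pow_succ, Module.End.mul_apply, S.σF n f hf, map_zero]

lemma SmithData.indep_pow (S : SmithData p d V σ W F) {j : ℕ} (hj : 1 ≤ j) {n : ℕ} {w f : Ω}
    (hw : w ∈ W n) (hf : f ∈ F n) (h : (σ ^ j) w + f ∈ V) : f ∈ V := by
  obtain ⟨j, rfl⟩ := Nat.exists_eq_add_of_le' hj
  rw [pow_succ', Module.End.mul_apply] at h
  exact S.indep n _ (S.pow_W j hw) f hf h

lemma SmithData.σ_pow_pred (S : SmithData p d V σ W F) (hp : 1 < p) (x : Ω) :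
    σ ((σ ^ (p - 1)) x) = 0 := by
  rw [← Module.End.mul_apply, ← pow_succ', show p - 1 + 1 = p by omega, S.pow]

lemma SmithData.les₁ (S : SmithData p d V σ W F) {i j : ℕ} (hi : 1 ≤ i) (hj : 1 ≤ j)
    (hij : ∀ x, (σ ^ i) ((σ ^ j) x) = 0)
    (hker : ∀ n, ∀ c ∈ W n, (σ ^ i) c ∈ V → ∃ w ∈ W n, ∃ f ∈ F n, c - ((σ ^ j) w + f) ∈ V) :
    LES (hl d V W) (fun n => hl d V (fun m => (W m).map (σ ^ j)) n + hl d V F n)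
      (hl d V (fun m => (W m).map (σ ^ i))) := by
  let W' : ℕ → Submodule k Ω := fun n => W n ⊓ V.comap (σ ^ i)
  have e : (fun n => hl d V (fun m => (W m).map (σ ^ j)) n + hl d V F n) = hl d V W' := by
    funext n
    refine (hl_direct_sum S.dd S.dV (S.grW.map (S.pow_comm j)) S.grF ?_ ?_ ?_ ?_ n).symm
    · rintro n _ ⟨w, hw, rfl⟩
      refine ⟨S.pow_W j hw, ?_⟩
      change (σ ^ i) ((σ ^ j) w) ∈ V
      rw [hij]; exact zero_mem _
    · intro n f hf
      refine ⟨S.F_le n hf, ?_⟩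
      change (σ ^ i) f ∈ V
      rw [S.pow_F hi hf]; exact zero_mem _
    · intro n c hc
      obtain ⟨w, hw, f, hf, h⟩ := hker n c hc.1 hc.2
      exact ⟨_, ⟨w, hw, rfl⟩, f, hf, h⟩
    · rintro n _ ⟨w, hw, rfl⟩ f hf h
      exact S.indep_pow hj hw hf h
  rw [e]
  exact long_exact S.dd S.grW (S.pow_comm i) (fun v hv => S.pow_V i hv) (fun n x => Iff.rfl)
    (fun n => rfl)

lemma SmithData.les₃ (S : SmithData p d V σ W F) (hp : 1 < p) {j : ℕ} (h1 : 1 ≤ j)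
    (hj : j + 1 < p) : LES (hl d V (fun m => (W m).map (σ ^ j)))
      (hl d V (fun m => (W m).map (σ ^ (p - 1)))) (hl d V (fun m => (W m).map (σ ^ (j + 1)))) := by
  let W' : ℕ → Submodule k Ω := fun n => (W n).map (σ ^ j) ⊓ V.comap σ
  have e : hl d V (fun m => (W m).map (σ ^ (p - 1))) = hl d V W' := by
    funext n
    have := hl_direct_sum (W' := W') (W₂ := fun _ => ⊥) S.dd S.dV
      (S.grW.map (S.pow_comm (p - 1))) ⟨by simp, by simp⟩ ?_ ?_ ?_ ?_ n
    · rw [this]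
      have : hl d V (fun _ => (⊥ : Submodule k Ω)) n = 0 := by
        rw [hl_eq_zero]
        intro c hc _
        exact ⟨0, zero_mem _, by simp [(Submodule.mem_bot k).1 hc]⟩
      rw [this, add_zero]
    · rintro n _ ⟨w, hw, rfl⟩
      refine ⟨⟨(σ ^ (p - 1 - j)) w, S.pow_W _ hw, ?_⟩, ?_⟩
      · rw [← Module.End.mul_apply, ← pow_add, show j + (p - 1 - j) = p - 1 by omega]
      · change σ ((σ ^ (p - 1)) w) ∈ V
        rw [S.σ_pow_pred hp]; exact zero_mem _
    · intro n; exact bot_le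
    · rintro n _ ⟨⟨s, hs, rfl⟩, h⟩
      obtain ⟨w, hw, f, hf, h2⟩ := S.kerσ n _ (S.pow_W j hs) h
      have hfV : f ∈ V := by
        refine S.indep_pow (j := j) h1 (w := (σ ^ (p - 1 - j)) w - s)
          (sub_mem (S.pow_W _ hw) hs) hf ?_
        have e : (σ ^ j) ((σ ^ (p - 1 - j)) w - s) + f = -((σ ^ j) s - ((σ ^ (p - 1)) w + f)) := by
          rw [map_sub, ← Module.End.mul_apply, ← pow_add, show j + (p - 1 - j) = p - 1 by omega]
          abel
        rw [e]; exact neg_mem h2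
      refine ⟨_, ⟨w, hw, rfl⟩, 0, zero_mem _, ?_⟩
      have := add_mem h2 hfV
      convert this using 1; abel
    · rintro n _ - w hw -
      rw [(Submodule.mem_bot k).1 hw]; exact zero_mem _
  rw [e]
  refine long_exact S.dd (S.grW.map (S.pow_comm j)) S.comm S.σV (fun n x => Iff.rfl)
    (fun n => ?_)
  rw [pow_succ', Module.End.mul_eq_comp, Submodule.map_comp]

lemma SmithData.smith (S : SmithData p d V σ W F) (hodd : Odd p) (hp : 1 < p) {r : ℕ}
    (hW : Sph d V W r) :
    (∀ n > r, Acy d V F n ∧ Acy d V (fun m => (W m).map σ) n) ∧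
      ∃ n ≤ r, n % 2 = r % 2 ∧ Sph d V F n := by
  obtain ⟨M, hM⟩ := S.vanish
  have := smith_numeric hodd hp (s := fun j => hl d V (fun m => (W m).map (σ ^ j)))
    (f := hl d V F) hW.1 hW.2
    (S.les₁ (i := 1) (j := p - 1) le_rfl (by omega)
      (fun x => by rw [pow_one]; exact S.σ_pow_pred hp x) (by simpa using S.kerσ))
    (S.les₁ (i := p - 1) (j := 1) (by omega) le_rfl
      (fun x => by
        rw [← Module.End.mul_apply, ← pow_add, show p - 1 + 1 = p by omega]; exact S.pow x)
      (by simpa using S.kerτ))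
    (fun j h1 hj => S.les₃ hp h1 hj)
    (M := M) (fun n hn => ⟨hl_eq_zero.2 (hM n hn).1, fun j => hl_eq_zero.2 ((hM n hn).2 j)⟩)
  refine ⟨fun n hn => ?_, ?_⟩
  · obtain ⟨h1, h2, -⟩ := this.1 n hn
    rw [pow_one] at h2
    exact ⟨hl_eq_zero.1 h1, hl_eq_zero.1 h2⟩
  · obtain ⟨n, hn, hpar, h1, h0⟩ := this.2
    exact ⟨n, hn, hpar, h1, h0⟩

/-- If `w` bounds a chain on which `σ` vanishes, one may correct `w` by a boundary so that it
becomes the sum of a trace and a fixed chain. -/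
lemma SmithData.correct (S : SmithData p d V σ W F) (hodd : Odd p) (hp : 1 < p) {r : ℕ}
    (hW : Sph d V W r) {w : Ω} (hw : w ∈ W (r + 1)) (h : d (σ w) ∈ V) :
    ∃ x ∈ W (r + 1), ∃ f ∈ F (r + 1), d w - (d ((σ ^ (p - 1)) x) + d f) ∈ V := by
  have hA := ((S.smith hodd hp hW).1 (r + 1) (by omega)).2
  obtain ⟨_, ⟨u, hu, rfl⟩, h1⟩ := hA (σ w) ⟨w, hw, rfl⟩ h
  rw [← S.comm, ← map_sub] at h1
  obtain ⟨x, hx, f, hf, h2⟩ := S.kerσ _ _ (sub_mem hw (S.grW.succ _ u hu)) h1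
  refine ⟨x, hx, f, hf, ?_⟩
  have := S.dV _ h2
  rwa [map_sub, map_sub, S.dd, sub_zero, map_add] at this

lemma SmithData.fixed_boundary (S : SmithData p d V σ W F) (hodd : Odd p) (hp : 1 < p) {r : ℕ}
    (hW : Sph d V W r) {f : Ω} (hf : f ∈ F r) (hb : f ∈ bdr d V W r) : f ∈ bdr d V F r := by
  obtain ⟨w, hw, h⟩ := mem_bdr.1 hb
  have h0 : d (σ w) ∈ V := by
    have := S.σV _ h
    rwa [map_sub, S.σF _ f hf, zero_sub, neg_mem_iff, S.comm] at this
  obtain ⟨x, hx, f', hf', h1⟩ := S.correct hodd hp hW hw h0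
  refine mem_bdr.2 ⟨f', hf', ?_⟩
  refine S.indep_pow (j := p - 1) (by omega) (w := - d x) (neg_mem (S.grW.succ _ x hx))
    (sub_mem hf (S.grF.succ _ f' hf')) ?_
  have := add_mem h h1
  convert this using 1
  rw [map_neg, S.pow_comm]; abel

lemma SmithData.cycle_decomp (S : SmithData p d V σ W F) (hodd : Odd p) (hp : 1 < p) {r : ℕ}
    (hW : Sph d V W r) (hF : Acy d V F r) {z : Ω} (hz : z ∈ W r) (hdz : d z ∈ V) :
    ∃ w ∈ W (r + 1), ∃ s ∈ W r, z - (d w + σ s) ∈ V := by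
  have hτ : (σ ^ (p - 1)) z ∈ bdr d V W r := by
    refine nilpotent_mem_bdr hW.1 (S.pow_comm _) (fun v hv => S.pow_V _ hv)
      (fun n w hw => S.pow_W _ hw) (q := p) (fun x => ?_) hz hdz
    rw [← pow_mul, show (p - 1) * p = (p * (p - 2)) + p by
      obtain ⟨m, rfl⟩ := Nat.exists_eq_add_of_le hp
      simp; ring, pow_add, Module.End.mul_apply, S.pow, map_zero]
  obtain ⟨w, hw, h⟩ := mem_bdr.1 hτ
  have h0 : d (σ w) ∈ V := by
    have := S.σV _ h
    rwa [map_sub, S.σ_pow_pred hp, zero_sub, neg_mem_iff, S.comm] at this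
  obtain ⟨x, hx, f, hf, h1⟩ := S.correct hodd hp hW hw h0
  have h2 : (σ ^ (p - 1)) (z - d x) + (- d f) ∈ V := by
    convert add_mem h h1 using 1
    rw [map_sub, S.pow_comm]; abel
  have hzx := sub_mem hz (S.grW.succ _ x hx)
  have h3 := S.indep_pow (by omega) hzx (neg_mem (S.grF.succ _ f hf)) h2
  have h4 : (σ ^ (p - 1)) (z - d x) ∈ V := by simpa using sub_mem h2 h3
  obtain ⟨y, hy, f', hf', h5⟩ := S.kerτ _ _ hzx h4
  have h6 : d f' ∈ V := by
    have h7 := sub_mem hdz (S.dV _ h5)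
    rw [map_sub, map_sub, S.dd, sub_zero, sub_sub_cancel, map_add, ← S.comm] at h7
    rcases r with _ | r
    · rw [S.grF.zero _ hf']; exact zero_mem _
    · exact S.indep _ _ (S.grW.succ _ y hy) _ (S.grF.succ _ _ hf') h7
  obtain ⟨g, hg, h7⟩ := hF f' hf' h6
  refine ⟨x + g, add_mem hx (S.F_le _ hg), y, hy, ?_⟩
  convert add_mem h5 h7 using 1
  rw [map_add]; abel

end Smith

end

section

section RankTwo

variable {k : Type*} [Field k] {Ω : Type*} [AddCommGroup Ω] [Module k Ω]

/-- The image of a graded family. -/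
def im (f : Ω →ₗ[k] Ω) (W : ℕ → Submodule k Ω) (n : ℕ) : Submodule k Ω := (W n).map f

lemma im_mem {f : Ω →ₗ[k] Ω} {W : ℕ → Submodule k Ω} {n : ℕ} {w : Ω} (hw : w ∈ W n) :
    f w ∈ im f W n := ⟨w, hw, rfl⟩

/-- A graded family together with two operators forming an exact pair modulo `V`. -/
structure ExPair (d : Ω →ₗ[k] Ω) (V : Submodule k Ω) (W : ℕ → Submodule k Ω)
    (μ ν : Ω →ₗ[k] Ω) : Prop where
  dd : ∀ x, d (d x) = 0
  dV : ∀ v ∈ V, d v ∈ V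
  gr : Gr d W
  commμ : ∀ x, μ (d x) = d (μ x)
  commν : ∀ x, ν (d x) = d (ν x)
  Vμ : ∀ v ∈ V, μ v ∈ V
  Vν : ∀ v ∈ V, ν v ∈ V
  Wμ : ∀ n, ∀ w ∈ W n, μ w ∈ W n
  Wν : ∀ n, ∀ w ∈ W n, ν w ∈ W n
  μν : ∀ x, μ (ν x) = 0
  νμ : ∀ x, ν (μ x) = 0
  kerμ : ∀ n, ∀ c ∈ W n, μ c ∈ V → ∃ w ∈ W n, c - ν w ∈ V
  kerν : ∀ n, ∀ c ∈ W n, ν c ∈ V → ∃ w ∈ W n, c - μ w ∈ V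

variable {d : Ω →ₗ[k] Ω} {V : Submodule k Ω} {W : ℕ → Submodule k Ω} {μ ν : Ω →ₗ[k] Ω}

lemma ExPair.symm (E : ExPair d V W μ ν) : ExPair d V W ν μ :=
  ⟨E.dd, E.dV, E.gr, E.commν, E.commμ, E.Vν, E.Vμ, E.Wν, E.Wμ, E.νμ, E.μν, E.kerν, E.kerμ⟩

lemma ExPair.top (E : ExPair d V W μ ν) {n : ℕ}
    (hA : Acy d V (im μ W) (n + 1)) {c : Ω} (hc : c ∈ im ν W n) (hb : c ∈ bdr d V W n) :
    c ∈ bdr d V (im ν W) n := by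
  obtain ⟨w, hw, rfl⟩ := hc
  obtain ⟨y, hy, h⟩ := mem_bdr.1 hb
  have h1 : d (μ y) ∈ V := by
    have := E.Vμ _ h
    rwa [map_sub, E.μν, zero_sub, neg_mem_iff, E.commμ] at this
  obtain ⟨_, ⟨u, hu, rfl⟩, h2⟩ := hA _ (im_mem hy) h1
  rw [← E.commμ, ← map_sub] at h2
  obtain ⟨q, hq, h3⟩ := E.kerμ _ _ (sub_mem hy (E.gr.succ _ _ hu)) h2
  refine mem_bdr.2 ⟨ν q, im_mem hq, ?_⟩
  have h4 := E.dV _ h3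
  rw [map_sub, map_sub, E.dd, sub_zero] at h4
  simpa using add_mem h h4

lemma ExPair.high (E : ExPair d V W μ ν) {r M : ℕ} (hW : ∀ n > r, Acy d V W n)
    (hM : ∀ n > M, Acy d V (im μ W) n ∧ Acy d V (im ν W) n) :
    ∀ n > r, Acy d V (im μ W) n ∧ Acy d V (im ν W) n := by
  have aux : ∀ {μ ν : Ω →ₗ[k] Ω}, ExPair d V W μ ν → ∀ n > r, Acy d V (im μ W) (n + 1) →
      Acy d V (im ν W) n := by
    intro μ ν E n hn hA c hc hdc
    have hcW : c ∈ W n := by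
      obtain ⟨w, hw, rfl⟩ := hc
      exact E.Wν _ _ hw
    exact mem_bdr.1 (E.top hA hc (mem_bdr.2 (hW n hn c hcW hdc)))
  have key : ∀ t n, M < n + t → r < n → Acy d V (im μ W) n ∧ Acy d V (im ν W) n := by
    intro t
    induction t with
    | zero => intro n h _; exact hM n h
    | succ t ih =>
      intro n h hr
      obtain ⟨h1, h2⟩ := ih (n + 1) (by omega) (by omega)
      exact ⟨aux E.symm n hr h2, aux E n hr h1⟩
  intro n hn
  exact key (M + 1) n (by omega) hn

lemma ExPair.bot (E : ExPair d V W μ ν) {n : ℕ} (hA : ∀ m < n, Acy d V (im ν W) m) {w : Ω}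
    (hw : w ∈ W n) (h : d (μ w) ∈ V) : ∃ w' ∈ W n, d w' ∈ V ∧ μ w' = μ w := by
  rcases n with _ | n
  · exact ⟨w, hw, by rw [E.gr.zero w hw]; exact zero_mem _, rfl⟩
  · rw [← E.commμ] at h
    obtain ⟨u, hu, h1⟩ := E.kerμ _ _ (E.gr.succ _ _ hw) h
    have h2 : d (ν u) ∈ V := by
      have := E.dV _ h1
      rwa [map_sub, E.dd, zero_sub, neg_mem_iff] at this
    obtain ⟨_, ⟨q, hq, rfl⟩, h3⟩ := hA n (by omega) _ (im_mem hu) h2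
    refine ⟨w - ν q, sub_mem hw (E.Wν _ _ hq), ?_, by rw [map_sub, E.μν, sub_zero]⟩
    rw [map_sub]
    simpa using add_mem h1 h3

lemma ExPair.low (E : ExPair d V W μ ν) {s : ℕ} (hW : ∀ n < s, Acy d V W n) :
    ∀ n < s, Acy d V (im μ W) n ∧ Acy d V (im ν W) n := by
  have aux : ∀ {μ ν : Ω →ₗ[k] Ω}, ExPair d V W μ ν → ∀ n < s,
      (∀ m < n, Acy d V (im ν W) m) → Acy d V (im μ W) n := by
    rintro μ ν E n hn hA _ ⟨w, hw, rfl⟩ hdc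
    obtain ⟨w', hw', h, he⟩ := E.bot hA hw hdc
    obtain ⟨y, hy, h1⟩ := hW n hn w' hw' h
    refine ⟨μ y, im_mem hy, ?_⟩
    have := E.Vμ _ h1
    rwa [map_sub, he, E.commμ] at this
  intro n
  induction n using Nat.strong_induction_on with
  | _ n ih =>
    intro hn
    exact ⟨aux E n hn fun m hm => (ih m hm (by omega)).2,
      aux E.symm n hn fun m hm => (ih m hm (by omega)).1⟩

/-- The transfer `τ` annihilates cycles of `A` up to boundaries of `τ A`. -/
def Kills (d : Ω →ₗ[k] Ω) (V : Submodule k Ω) (A : ℕ → Submodule k Ω) (τ : Ω →ₗ[k] Ω)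
    (i : ℕ) : Prop := ∀ w ∈ A i, d w ∈ V → τ w ∈ bdr d V (im τ A) i

lemma Kills.step {σ τ : Ω →ₗ[k] Ω} (E : ExPair d V W μ ν) (E' : ExPair d V (im ν W) σ τ)
    (hcomm : ∀ x, τ (μ x) = μ (τ x)) {i : ℕ}
    (hb : ∀ w ∈ im ν W i, d w ∈ V → w ∈ bdr d V W i) (hτW : ∀ n, ∀ w ∈ W n, τ w ∈ W n)
    (H : Kills d V (im μ W) τ (i + 1)) : Kills d V (im ν W) τ i := by
  intro w hw hdw
  obtain ⟨u, hu, h1⟩ := mem_bdr.1 (hb w hw hdw)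
  obtain ⟨y, hy, rfl⟩ := hw
  have h2 : d (μ u) ∈ V := by
    have := E.Vμ _ h1
    rwa [map_sub, E.μν, zero_sub, neg_mem_iff, E.commμ] at this
  obtain ⟨_, ⟨_, ⟨q, hq, rfl⟩, rfl⟩, h3⟩ := mem_bdr.1 (H _ (im_mem hu) h2)
  rw [hcomm, hcomm, ← E.commμ, ← map_sub] at h3
  obtain ⟨e, he, h4⟩ := E.kerμ _ _ (sub_mem (hτW _ _ hu) (E.gr.succ _ _ (hτW _ _ hq))) h3
  have h5 : σ (ν e) ∈ V := by
    have := E'.Vμ _ h4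
    rwa [map_sub, map_sub, E'.commμ, E'.μν, E'.μν, map_zero, sub_zero, zero_sub,
      neg_mem_iff] at this
  obtain ⟨x, hx, h6⟩ := E'.kerμ _ _ (im_mem he) h5
  refine mem_bdr.2 ⟨τ x, im_mem hx, ?_⟩
  have h7 := E.dV _ (add_mem h4 h6)
  have h8 := E'.Vν _ h1
  rw [map_sub, E'.commν] at h8
  rw [sub_add_sub_cancel, map_sub, map_sub, E.dd, sub_zero] at h7
  simpa using add_mem h8 h7

/-- The algebraic contradiction behind the rank two case of the dimension bound. -/
theorem rank_two_core {σ₁ τ₁ σ₂ τ₂ : Ω →ₗ[k] Ω} (E : ExPair d V W σ₁ τ₁)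
    (Eσ : ExPair d V (im σ₁ W) σ₂ τ₂) (Eτ : ExPair d V (im τ₁ W) σ₂ τ₂)
    (hστ : ∀ x, σ₂ (τ₁ x) = τ₁ (σ₂ x))
    (hτσ : ∀ x, τ₂ (σ₁ x) = σ₁ (τ₂ x)) (hττ : ∀ x, τ₂ (τ₁ x) = τ₁ (τ₂ x))
    (hτ₂W : ∀ n, ∀ w ∈ W n, τ₂ w ∈ W n)
    {s r M : ℕ} (hsr : s < r) (hacy : ∀ i, i ≠ s → i ≠ r → Acy d V W i)
    (hz : ∀ i, i = s ∨ i = r → ∀ z ∈ W i, d z ∈ V → σ₁ z ∈ bdr d V W i ∧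
      τ₁ z ∈ bdr d V W i ∧ σ₂ z ∈ bdr d V W i ∧ τ₂ z ∈ bdr d V W i)
    (hne : ¬ Acy d V W s)
    (hM : ∀ n > M, Acy d V (im σ₁ W) n ∧ Acy d V (im τ₁ W) n)
    (hMσ : ∀ n > M, Acy d V (im σ₂ (im σ₁ W)) n ∧ Acy d V (im τ₂ (im σ₁ W)) n)
    (hMτ : ∀ n > M, Acy d V (im σ₂ (im τ₁ W)) n ∧ Acy d V (im τ₂ (im τ₁ W)) n) : False := by
  have hi := E.high (r := r) (fun n hn => hacy n (by omega) (by omega)) hM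
  have lo := E.low (s := s) (fun n hn => hacy n (by omega) (by omega))
  have hiσ := Eσ.high (r := r) (fun n hn => (hi n hn).1) hMσ
  have hiτ := Eτ.high (r := r) (fun n hn => (hi n hn).2) hMτ
  have loτ := Eτ.low (s := s) (fun n hn => (lo n hn).2)
  -- start of the descent
  have start : ∀ {μ ν : Ω →ₗ[k] Ω}, ExPair d V W μ ν → ExPair d V (im ν W) σ₂ τ₂ →
      (∀ x, τ₂ (ν x) = ν (τ₂ x)) → Acy d V (im μ W) (r + 1) →
      Acy d V (im σ₂ (im ν W)) (r + 1) → Kills d V (im ν W) τ₂ r := by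
    intro μ ν E E' hc h1 h2 w hw hdw
    have hwW : w ∈ W r := by
      obtain ⟨y, hy, rfl⟩ := hw
      exact E.Wν _ _ hy
    have hb := (hz r (Or.inr rfl) w hwW hdw).2.2.2
    have hin : τ₂ w ∈ im ν W r := E'.Wν _ _ hw
    exact E'.top h2 (im_mem hw) (E.top h1 hin hb)
  have main : ∀ t, s + t ≤ r → Kills d V (im σ₁ W) τ₂ (r - t) ∧ Kills d V (im τ₁ W) τ₂ (r - t) := by
    intro t
    induction t with
    | zero =>
      intro _
      exact ⟨start E.symm Eσ hτσ (hi _ (by omega)).2 (hiσ _ (by omega)).1,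
        start E Eτ hττ (hi _ (by omega)).1 (hiτ _ (by omega)).1⟩
    | succ t ih =>
      intro ht
      obtain ⟨i1, i2⟩ := ih (by omega)
      have e : r - t = r - (t + 1) + 1 := by omega
      rw [e] at i1 i2
      have hbd : ∀ {μ ν : Ω →ₗ[k] Ω}, ExPair d V W μ ν →
          (∀ m < s, Acy d V (im μ W) m) →
          (∀ z ∈ W s, d z ∈ V → ν z ∈ bdr d V W s) →
          ∀ w ∈ im ν W (r - (t + 1)), d w ∈ V → w ∈ bdr d V W (r - (t + 1)) := by
        intro μ ν E hl hzero w hw hdw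
        by_cases hs : r - (t + 1) = s
        · rw [hs] at hw ⊢
          obtain ⟨y, hy, rfl⟩ := hw
          obtain ⟨y', hy', h1, h2⟩ := E.symm.bot hl hy hdw
          rw [← h2]
          exact hzero y' hy' h1
        · have hwW : w ∈ W (r - (t + 1)) := by
            obtain ⟨y, hy, rfl⟩ := hw
            exact E.Wν _ _ hy
          exact mem_bdr.2 (hacy _ hs (by omega) w hwW hdw)
      exact ⟨Kills.step E.symm Eσ hττ (hbd E.symm (fun m hm => (lo m hm).2)
          (fun z h h' => (hz s (Or.inl rfl) z h h').1)) hτ₂W i2,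
        Kills.step E Eτ hτσ (hbd E (fun m hm => (lo m hm).1)
          (fun z h h' => (hz s (Or.inl rfl) z h h').2.1)) hτ₂W i1⟩
  have fin := (main (r - s) (by omega)).2
  rw [show r - (r - s) = s by omega] at fin
  apply hne
  intro z hzW hdz
  have hz1 : d (τ₁ z) ∈ V := by rw [← E.commν]; exact E.Vν _ hdz
  obtain ⟨_, ⟨_, ⟨y, hy, rfl⟩, rfl⟩, h1⟩ := mem_bdr.1 (fin _ (im_mem hzW) hz1)
  rw [← Eτ.commν, ← map_sub, ← E.commν, ← map_sub] at h1
  have hzy := sub_mem hzW (E.gr.succ _ _ hy)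
  obtain ⟨_, ⟨e, he, rfl⟩, h2⟩ := Eτ.kerν _ _ (im_mem hzy) h1
  have h3 : d (σ₂ (τ₁ e)) ∈ V := by
    have h4 := E.dV _ h2
    rw [map_sub, ← E.commν, map_sub, E.dd, sub_zero, E.commν] at h4
    simpa using sub_mem hz1 h4
  obtain ⟨_, ⟨e', he', rfl⟩, h5, h6⟩ := Eτ.bot (fun m hm => (loτ m hm).2) (im_mem he) h3
  obtain ⟨e'', he'', h7, h8⟩ := E.symm.bot (fun m hm => (lo m hm).1) he' h5
  obtain ⟨y', hy', h9⟩ := mem_bdr.1 (hz s (Or.inl rfl) e'' he'' h7).2.2.1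
  rw [← h6, ← h8, hστ, ← map_sub] at h2
  have h10 : τ₁ (z - d y - d y') ∈ V := by
    have := add_mem h2 (E.Vν _ h9)
    rw [← map_add] at this
    convert this using 2
    abel
  obtain ⟨e3, he3, h11⟩ := E.kerν _ _ (sub_mem hzy (E.gr.succ _ _ hy')) h10
  have h12 : d (σ₁ e3) ∈ V := by
    have h4 := E.dV _ h11
    simp only [map_sub, E.dd, sub_zero] at h4
    simpa using sub_mem hdz h4
  obtain ⟨e4, he4, h13, h14⟩ := E.bot (fun m hm => (lo m hm).2) he3 h12
  obtain ⟨y3, hy3, h15⟩ := mem_bdr.1 (hz s (Or.inl rfl) e4 he4 h13).1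
  refine ⟨y + y' + y3, add_mem (add_mem hy hy') hy3, ?_⟩
  rw [← h14] at h11
  have := add_mem h11 h15
  convert this using 1
  simp only [map_add]
  abel

end RankTwo

end

section

section Singular

variable {k : Type*} [Field k] {Ω : Type*} [AddCommGroup Ω] [Module k Ω]
  {d : Ω →ₗ[k] Ω} {V : Submodule k Ω} {W F G : ℕ → Submodule k Ω}

/-- Vanishing of the homology of the pair `(W, F)`. -/
def PairAcy (d : Ω →ₗ[k] Ω) (V : Submodule k Ω) (W F : ℕ → Submodule k Ω) (i : ℕ) : Prop :=
  ∀ x ∈ W i, (∀ j, i = j + 1 → ∃ f ∈ F j, d x - f ∈ V) →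
    ∃ y ∈ W (i + 1), ∃ f ∈ F i, x - d y - f ∈ V

lemma pairAcy_of_sph (dd : ∀ x, d (d x) = 0) (dV : ∀ v ∈ V, d v ∈ V) (grW : Gr d W)
    (hle : ∀ n, F n ≤ W n) {n : ℕ} (hW : Sph d V W n) (hF : Sph d V F n)
    (hinj : ∀ f ∈ F n, f ∈ bdr d V W n → f ∈ bdr d V F n) (i : ℕ) : PairAcy d V W F i := by
  intro x hx h
  have step : ∃ f' ∈ F i, d (x - f') ∈ V := by
    rcases i with _ | j
    · exact ⟨0, zero_mem _, by rw [sub_zero, grW.zero x hx]; exact zero_mem _⟩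
    · obtain ⟨f, hf, h1⟩ := h j rfl
      have hb : f ∈ bdr d V W j := mem_bdr.2 ⟨x, hx, by rw [← neg_sub]; exact neg_mem h1⟩
      have hb' : f ∈ bdr d V F j := by
        by_cases hj : j = n
        · subst hj; exact hinj f hf hb
        · refine mem_bdr.2 (hF.acy hj f hf ?_)
          have := dV _ h1
          rwa [map_sub, dd, zero_sub, neg_mem_iff] at this
      obtain ⟨f', hf', h2⟩ := mem_bdr.1 hb'
      refine ⟨f', hf', ?_⟩
      rw [map_sub]
      simpa using add_mem h1 h2
  obtain ⟨f', hf', h1⟩ := step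
  have hxf := sub_mem hx (hle i hf')
  by_cases hi : i = n
  · subst hi
    obtain ⟨z, hz, hzB, hzg⟩ := hl_eq_one.1 hW.1
    obtain ⟨z', hz', hzB', -⟩ := hl_eq_one.1 hF.1
    obtain ⟨t, ht⟩ := hzg z' ⟨hle i hz'.1, hz'.2⟩
    have ht0 : t ≠ 0 := by
      rintro rfl
      rw [zero_smul, sub_zero] at ht
      exact hzB' (hinj z' hz'.1 ht)
    obtain ⟨u, hu⟩ := hzg _ ⟨hxf, h1⟩
    have h3 : x - f' - (u * t⁻¹) • z' ∈ bdr d V W i := by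
      have := sub_mem hu (Submodule.smul_mem _ (u * t⁻¹) ht)
      rw [smul_sub, smul_smul, mul_assoc, inv_mul_cancel₀ ht0, mul_one] at this
      convert this using 1
      abel
    obtain ⟨y, hy, h4⟩ := mem_bdr.1 h3
    refine ⟨y, hy, f' + (u * t⁻¹) • z', add_mem hf' (Submodule.smul_mem _ _ hz'.1), ?_⟩
    convert h4 using 1
    abel
  · obtain ⟨y, hy, h2⟩ := hW.acy hi _ hxf h1
    refine ⟨y, hy, f', hf', ?_⟩
    convert h2 using 1
    abel

/-- The homology of a union of pieces which pairwise meet in `F`. -/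
lemma hl_union {ι : Type*} [Fintype ι] {WC : ι → ℕ → Submodule k Ω} {e : ι → Ω →ₗ[k] Ω}
    (dd : ∀ x, d (d x) = 0) (dV : ∀ v ∈ V, d v ∈ V) (grF : Gr d F)
    (grC : ∀ c, Gr d (WC c))
    (eV : ∀ c, ∀ v ∈ V, e c v ∈ V) (hFG : ∀ n, F n ≤ G n) (hCG : ∀ c n, WC c n ≤ G n)
    (hres : ∀ n, ∀ g ∈ G n, g - ∑ c, e c g ∈ F n) (heC : ∀ c n, ∀ g ∈ G n, e c g ∈ WC c n)
    (heF : ∀ c n, ∀ f ∈ F n, e c f = 0) (hCF : ∀ c n, ∀ y ∈ WC c n, y - e c y ∈ F n)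
    (hne : ∀ c c', c ≠ c' → ∀ n, ∀ y ∈ WC c n, e c' y = 0)
    (hpair : ∀ c i, PairAcy d V (WC c) F i) (i : ℕ) : hl d V G i = hl d V F i := by
  have key : ∀ c n, ∀ g ∈ G (n + 1), e c (d g) = e c (d (e c g)) := by
    intro c n g hg
    have h1 : g = (g - ∑ c, e c g) + ∑ c, e c g := by abel
    conv_lhs => rw [h1]
    rw [map_add, map_add, heF c n _ (grF.succ _ _ (hres _ g hg)), zero_add, map_sum, map_sum]
    rw [Finset.sum_eq_single c]
    · intro c' _ hc'
      exact hne c' c hc' n _ ((grC c').succ _ _ (heC c' _ g hg))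
    · intro h; exact absurd (Finset.mem_univ c) h
  have split : ∀ n, ∀ g ∈ G n, (∀ j, n = j + 1 → ∀ c, e c (d g) ∈ V) →
      ∃ y ∈ G (n + 1), ∃ f ∈ F n, g - d y - f ∈ V := by
    intro n g hg h
    have : ∀ c, ∃ y ∈ WC c (n + 1), ∃ f ∈ F n, e c g - d y - f ∈ V := by
      intro c
      refine hpair c n (e c g) (heC c n g hg) ?_
      rintro j rfl
      refine ⟨d (e c g) - e c (d (e c g)),
        hCF c j _ ((grC c).succ _ _ (heC c _ g hg)), ?_⟩
      rw [sub_sub_cancel, ← key c j g hg]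
      exact h j rfl c
    choose y hy f hf hyf using this
    refine ⟨∑ c, y c, sum_mem fun c _ => hCG c _ (hy c), (g - ∑ c, e c g) + ∑ c, f c,
      add_mem (hres n g hg) (sum_mem fun c _ => hf c), ?_⟩
    have : ∑ c, (e c g - d (y c) - f c) ∈ V := sum_mem fun c _ => hyf c
    rw [Finset.sum_sub_distrib, Finset.sum_sub_distrib] at this
    convert this using 1
    rw [map_sum]
    abel
  refine rl_congr LinearMap.id (fun x hx => ⟨hFG i hx.1, hx.2⟩) (fun a ha => ?_) (fun p hp => ?_)
  · obtain ⟨y, hy, f, hf, h⟩ := split i a ha.1 (fun j _ c => eV c _ ha.2)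
    refine ⟨f, ⟨hf, ?_⟩, mem_bdr.2 ⟨y, hy, ?_⟩⟩
    · have h1 := dV _ h
      rw [map_sub, map_sub, dd, sub_zero] at h1
      have := sub_mem (show d a ∈ V from ha.2) h1
      rwa [sub_sub_cancel] at this
    · convert h using 1
      simp only [LinearMap.id_apply]; abel
  · constructor
    · intro h
      obtain ⟨g, hg, h1⟩ := mem_bdr.1 h
      obtain ⟨y, hy, f, hf, h2⟩ := split (i + 1) g hg (by
        intro j hj c
        have := eV c _ h1
        rw [map_sub, LinearMap.id_apply, heF c i p hp.1, zero_sub, neg_mem_iff] at this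
        exact this)
      refine mem_bdr.2 ⟨f, hf, ?_⟩
      have h3 := dV _ h2
      rw [map_sub, map_sub, dd, sub_zero] at h3
      have := add_mem h1 h3
      rwa [sub_add_sub_cancel] at this
    · intro h
      obtain ⟨w, hw, h1⟩ := mem_bdr.1 h
      exact mem_bdr.2 ⟨w, hFG _ hw, h1⟩

/-- The homology of `W` relative to a subfamily `G`. -/
lemma relative_homology (dd : ∀ x, d (d x) = 0) (dV : ∀ v ∈ V, d v ∈ V) (grW : Gr d W)
    (hGW : ∀ n, G n ≤ W n) {r n : ℕ} (hW : Sph d V W r) (hG : Sph d V G n)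
    (hnr : n + 2 ≤ r) {V' : Submodule k Ω} (hV : V ≤ V') (hGV : ∀ n, G n ≤ V')
    (hV' : ∀ i, ∀ c ∈ W i, c ∈ V' → ∃ g ∈ G i, c - g ∈ V) :
    hl d V' W (n + 1) = 1 ∧ hl d V' W r = 1 ∧ ∀ i, i ≠ n + 1 → i ≠ r → Acy d V' W i := by
  -- a relative cycle can be corrected to an absolute one away from degree `n + 1`
  have corr : ∀ i, i ≠ n + 1 → ∀ c ∈ W i, d c ∈ V' → ∃ g ∈ G i, d (c - g) ∈ V := by
    intro i hi c hc hdc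
    rcases i with _ | i
    · exact ⟨0, zero_mem _, by rw [sub_zero, grW.zero c hc]; exact zero_mem _⟩
    · obtain ⟨g, hg, h1⟩ := hV' i _ (grW.succ _ _ hc) hdc
      have h2 : d g ∈ V := by
        have := dV _ h1
        rwa [map_sub, dd, zero_sub, neg_mem_iff] at this
      obtain ⟨g', hg', h3⟩ := hG.acy (by omega) g hg h2
      refine ⟨g', hg', ?_⟩
      rw [map_sub]
      simpa using add_mem h1 h3
  refine ⟨?_, ?_, fun i h1 h2 c hc hdc => ?_⟩
  · obtain ⟨z, hz, hzB, hzg⟩ := hl_eq_one.1 hG.1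
    obtain ⟨w, hw, h1⟩ := hW.acy (by omega : n ≠ r) z (hGW _ hz.1) hz.2
    have hdw : d w ∈ V' := by
      have := sub_mem (hGV _ hz.1) (hV h1)
      simpa using this
    refine hl_eq_one.2 ⟨w, ⟨hw, hdw⟩, fun hwB => hzB ?_, fun c hc => ?_⟩
    · obtain ⟨y, hy, h2⟩ := mem_bdr.1 hwB
      obtain ⟨g, hg, h3⟩ := hV' _ _ (sub_mem hw (grW.succ _ _ hy)) h2
      refine mem_bdr.2 ⟨g, hg, ?_⟩
      have := dV _ h3
      rw [map_sub, map_sub, dd, sub_zero] at this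
      simpa using add_mem h1 this
    · obtain ⟨g, hg, h2⟩ := hV' n _ (grW.succ _ _ hc.1) hc.2
      have hdg : d g ∈ V := by
        have := dV _ h2
        rwa [map_sub, dd, zero_sub, neg_mem_iff] at this
      obtain ⟨t, ht⟩ := hzg g ⟨hg, hdg⟩
      obtain ⟨g', hg', h3⟩ := mem_bdr.1 ht
      refine ⟨t, ?_⟩
      have h4 : d (c - t • w - g') ∈ V := by
        have := add_mem (add_mem h2 h3) (V.smul_mem t h1)
        convert this using 1
        rw [map_sub, map_sub, map_smul, smul_sub]; abel
      obtain ⟨y, hy, h5⟩ := hW.acy (by omega : n + 1 ≠ r) _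
        (sub_mem (sub_mem hc.1 (Submodule.smul_mem _ t hw)) (hGW _ hg')) h4
      refine mem_bdr.2 ⟨y, hy, ?_⟩
      have := add_mem (hV h5) (hGV _ hg')
      convert this using 1
      abel
  · rw [← hW.1]
    refine rl_congr LinearMap.id (fun x hx => ⟨hx.1, hV hx.2⟩) (fun a ha => ?_) (fun x hx => ?_)
    · obtain ⟨g, hg, h⟩ := corr r (by omega) a ha.1 ha.2
      refine ⟨a - g, ⟨sub_mem ha.1 (hGW _ hg), h⟩, le_bdr ?_⟩
      simpa using hGV _ hg
    · constructor
      · intro h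
        obtain ⟨y, hy, h1⟩ := mem_bdr.1 h
        obtain ⟨g, hg, h2⟩ := hV' r _ (sub_mem hx.1 (grW.succ _ _ hy)) h1
        have hdg : d g ∈ V := by
          have h3 := dV _ h2
          simp only [map_sub, dd, sub_zero] at h3
          have := sub_mem (show d x ∈ V from hx.2) h3
          simpa using this
        obtain ⟨g', hg', h3⟩ := hG.acy (by omega : r ≠ n) g hg hdg
        refine mem_bdr.2 ⟨y + g', add_mem hy (hGW _ hg'), ?_⟩
        convert add_mem h2 h3 using 1
        simp only [map_add]; abel
      · intro h
        obtain ⟨y, hy, h1⟩ := mem_bdr.1 h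
        exact mem_bdr.2 ⟨y, hy, hV h1⟩
  · obtain ⟨g, hg, h⟩ := corr i h1 c hc hdc
    obtain ⟨y, hy, h3⟩ := hW.acy h2 _ (sub_mem hc (hGW _ hg)) h
    refine ⟨y, hy, ?_⟩
    convert add_mem (hV h3) (hGV _ hg) using 1
    abel

end Singular

end

section

section Restriction

variable {k : Type*} [Field k] {E : Type*}

open Classical in
/-- The part of a chain supported on a given set of simplices. -/
noncomputable def rs (k : Type*) [Field k] {E : Type*} (s : Set (List E)) :
    (List E →₀ k) →ₗ[k] (List E →₀ k) :=
  Finsupp.linearCombination k fun l => if l ∈ s then Finsupp.single l 1 else 0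

open Classical in
lemma rs_single (s : Set (List E)) (l : List E) :
    rs k s (Finsupp.single l 1) = if l ∈ s then Finsupp.single l 1 else 0 := by
  simp [rs]

lemma rs_single_of_mem {s : Set (List E)} {l : List E} (h : l ∈ s) :
    rs k s (Finsupp.single l 1) = Finsupp.single l 1 := by rw [rs_single, if_pos h]

lemma rs_single_of_notMem {s : Set (List E)} {l : List E} (h : l ∉ s) :
    rs k s (Finsupp.single l 1) = 0 := by rw [rs_single, if_neg h]

lemma rs_of_mem {s : Set (List E)} {c : List E →₀ k} (hc : c ∈ Finsupp.supported k k s) :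
    rs k s c = c :=
  eq_on_supported (g := LinearMap.id) (fun _ hl => rs_single_of_mem hl) hc

lemma rs_eq_zero {s t : Set (List E)} (h : Disjoint t s) {c : List E →₀ k}
    (hc : c ∈ Finsupp.supported k k t) : rs k s c = 0 :=
  eq_on_supported (g := 0)
    (fun _ hl => rs_single_of_notMem (Set.disjoint_left.1 h hl)) hc

lemma rs_mem_inter (s t : Set (List E)) {c : List E →₀ k} (hc : c ∈ Finsupp.supported k k t) :
    rs k s c ∈ Finsupp.supported k k (t ∩ s) := by
  refine map_supported (fun l hl => ?_) hc
  by_cases h : l ∈ s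
  · rw [rs_single_of_mem h]; exact single_mem_supported ⟨hl, h⟩
  · rw [rs_single_of_notMem h]; exact zero_mem _

lemma sub_rs_mem (s t : Set (List E)) {c : List E →₀ k} (hc : c ∈ Finsupp.supported k k t) :
    c - rs k s c ∈ Finsupp.supported k k (t \ s) := by
  refine map_supported (f := LinearMap.id - rs k s) (fun l hl => ?_) hc
  rw [LinearMap.sub_apply, LinearMap.id_apply]
  by_cases h : l ∈ s
  · rw [rs_single_of_mem h, sub_self]; exact zero_mem _
  · rw [rs_single_of_notMem h, sub_zero]; exact single_mem_supported ⟨hl, h⟩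

lemma mem_supported_univ (c : List E →₀ k) :
    c ∈ Finsupp.supported k k (Set.univ : Set (List E)) := by
  rw [Finsupp.mem_supported]; exact Set.subset_univ _

lemma supported_mono {s t : Set (List E)} (h : s ⊆ t) {c : List E →₀ k}
    (hc : c ∈ Finsupp.supported k k s) : c ∈ Finsupp.supported k k t :=
  Finsupp.supported_mono h hc

lemma mem_supported_inter {s t : Set (List E)} {c : List E →₀ k}
    (hs : c ∈ Finsupp.supported k k s) (ht : c ∈ Finsupp.supported k k t) :
    c ∈ Finsupp.supported k k (s ∩ t) := by
  rw [Finsupp.mem_supported] at *; exact Set.subset_inter hs ht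

lemma listsIn_mono {A B : Set E} (h : A ⊆ B) : listsIn A ⊆ listsIn B :=
  fun _ hl a ha => h (hl a ha)

end Restriction

section Sequences

/-- The ultrafilter along which sequences of chains are compared. -/
noncomputable abbrev scale : Filter ℕ := (hyperfilter ℕ : Filter ℕ)

lemma scale_ge (n : ℕ) : ∀ᶠ j in scale, n ≤ j :=
  (Nat.hyperfilter_le_atTop) (eventually_ge_atTop n)

/-- A diagonal argument along the ultrafilter `scale`. -/
lemma exists_diagonal (Q : ℕ → ℕ → Prop) (h : ∀ n, ∀ᶠ j in scale, Q n j) :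
    ∃ ν : ℕ → ℕ, (∀ᶠ j in scale, Q (ν j) j) ∧ ∀ n, ∀ᶠ j in scale, n ≤ ν j := by
  classical
  refine ⟨fun j => Nat.findGreatest (fun n => Q n j) j, ?_, fun n => ?_⟩
  · filter_upwards [h 0] with j hj
    exact Nat.findGreatest_spec (P := fun n => Q n j) (Nat.zero_le j) hj
  · filter_upwards [h n, scale_ge n] with j hj hn
    exact Nat.le_findGreatest hn hj

lemma inv_lt_of_large {ν : ℕ → ℕ} (hν : ∀ n, ∀ᶠ j in scale, n ≤ ν j) {ε : ℝ} (hε : 0 < ε) :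
    ∀ᶠ j in scale, 1 / ((ν j : ℝ) + 1) < ε := by
  obtain ⟨n, hn⟩ := exists_nat_one_div_lt hε
  filter_upwards [hν n] with j hj
  refine lt_of_le_of_lt ?_ hn
  have : (n : ℝ) ≤ ν j := by exact_mod_cast hj
  exact one_div_le_one_div_of_le (by positivity) (by linarith)

/-- Sequences of ordered chains. -/
abbrev Seq (k E : Type*) [Field k] := ℕ → (List E →₀ k)

variable {k : Type*} [Field k] {E E' : Type*}

/-- The map of sequences given by a sequence of maps. -/
noncomputable def seqMap (T : ℕ → ((List E →₀ k) →ₗ[k] (List E' →₀ k))) :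
    Seq k E →ₗ[k] Seq k E' :=
  LinearMap.pi fun j => T j ∘ₗ LinearMap.proj j

@[simp] lemma seqMap_apply (T : ℕ → ((List E →₀ k) →ₗ[k] (List E' →₀ k))) (c : Seq k E) (j : ℕ) :
    seqMap T c j = T j (c j) := rfl

/-- The boundary of a sequence of chains. -/
noncomputable def sbd (k E : Type*) [Field k] : Seq k E →ₗ[k] Seq k E := seqMap fun _ => bd k E

@[simp] lemma sbd_apply (c : Seq k E) (j : ℕ) : sbd k E c j = bd k E (c j) := rfl

lemma sbd_sbd (c : Seq k E) : sbd k E (sbd k E c) = 0 := by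
  funext j; simp [bd_bd]

/-- Sequences of chains of a given degree. -/
def deg (k E : Type*) [Field k] (n : ℕ) : Submodule k (Seq k E) where
  carrier := {c | ∀ j, c j ∈ Finsupp.supported k k (listsLen E n)}
  add_mem' ha hb j := add_mem (ha j) (hb j)
  zero_mem' _ := zero_mem _
  smul_mem' t _ ha j := Submodule.smul_mem _ t (ha j)

lemma seqMap_deg {T : ℕ → ((List E →₀ k) →ₗ[k] (List E' →₀ k))} {n m : ℕ}
    (h : ∀ j, ∀ l : List E, l.length = n →
      T j (Finsupp.single l 1) ∈ Finsupp.supported k k (listsLen E' m))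
    {c : Seq k E} (hc : c ∈ deg k E n) : seqMap T c ∈ deg k E' m :=
  fun j => map_supported (h j) (hc j)

variable [PseudoMetricSpace E'] [PseudoMetricSpace E]

/-- Simplices of diameter less than `ε`. -/
def smallLists (E : Type*) [PseudoMetricSpace E] (ε : ℝ) : Set (List E) :=
  {l | ∀ a ∈ l, ∀ b ∈ l, dist a b < ε}

/-- Points at distance at least `ε` from `D`. -/
def farFrom (D : Set E) (ε : ℝ) : Set E := {a | ∀ y ∈ D, ε ≤ dist a y}

lemma farFrom_anti {D : Set E} {ε δ : ℝ} (h : δ ≤ ε) : farFrom D ε ⊆ farFrom D δ :=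
  fun _ ha y hy => h.trans (ha y hy)

/-- Sequences of chains staying away from `D`. -/
def null (k : Type*) [Field k] (D : Set E) : Submodule k (Seq k E) where
  carrier := {c | ∃ ε > 0, ∀ᶠ j in scale, c j ∈ Finsupp.supported k k (listsIn (farFrom D ε))}
  add_mem' := by
    rintro a b ⟨ε, hε, ha⟩ ⟨δ, hδ, hb⟩
    refine ⟨min ε δ, lt_min hε hδ, ?_⟩
    filter_upwards [ha, hb] with j h1 h2
    exact add_mem (supported_mono (listsIn_mono (farFrom_anti (min_le_left _ _))) h1)
      (supported_mono (listsIn_mono (farFrom_anti (min_le_right _ _))) h2)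
  zero_mem' := ⟨1, one_pos, Eventually.of_forall fun _ => zero_mem _⟩
  smul_mem' := by
    rintro t a ⟨ε, hε, ha⟩
    exact ⟨ε, hε, ha.mono fun j h => Submodule.smul_mem _ t h⟩

/-- Sequences of chains in `Y` whose simplices become arbitrarily small. -/
def small (k : Type*) [Field k] (Y : Set E) : Submodule k (Seq k E) where
  carrier := {c | (∀ j, c j ∈ Finsupp.supported k k (listsIn Y)) ∧
    ∀ ε > 0, ∀ᶠ j in scale, c j ∈ Finsupp.supported k k (smallLists E ε)}
  add_mem' := by
    rintro a b ⟨ha, ha'⟩ ⟨hb, hb'⟩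
    refine ⟨fun j => add_mem (ha j) (hb j), fun ε hε => ?_⟩
    filter_upwards [ha' ε hε, hb' ε hε] with j h1 h2 using add_mem h1 h2
  zero_mem' := ⟨fun _ => zero_mem _, fun ε _ => Eventually.of_forall fun _ => zero_mem _⟩
  smul_mem' := by
    rintro t a ⟨ha, ha'⟩
    exact ⟨fun j => Submodule.smul_mem _ t (ha j),
      fun ε hε => (ha' ε hε).mono fun j h => Submodule.smul_mem _ t h⟩

/-- Sequences of chains of degree `n` in `Y` whose simplices become arbitrarily small. -/
noncomputable def smallDeg (k : Type*) [Field k] (Y : Set E) (n : ℕ) : Submodule k (Seq k E) :=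
  small k Y ⊓ deg k E n

lemma mem_null_of_eventually_zero {D : Set E} {c : Seq k E} (h : ∀ᶠ j in scale, c j = 0) :
    c ∈ null k D :=
  ⟨1, one_pos, h.mono fun j hj => by rw [hj]; exact zero_mem _⟩

lemma null_anti {D D' : Set E} (h : D ⊆ D') : null k D' ≤ null k D := by
  rintro c ⟨ε, hε, hc⟩
  exact ⟨ε, hε, hc.mono fun j hj =>
    supported_mono (listsIn_mono (A := farFrom D' ε) (B := farFrom D ε)
      fun a ha y hy => ha y (h hy)) hj⟩

lemma small_mono {A B : Set E} (h : A ⊆ B) : small k A ≤ small k B :=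
  fun _ hc => ⟨fun j => supported_mono (listsIn_mono h) (hc.1 j), hc.2⟩

lemma smallDeg_mono {A B : Set E} (h : A ⊆ B) (n : ℕ) : smallDeg k A n ≤ smallDeg k B n :=
  inf_le_inf_right _ (small_mono h)

lemma smallDeg_zero_le (Y : Set E) (D : Set E) : smallDeg k Y 0 ≤ null k D := by
  intro c hc
  refine ⟨1, one_pos, Eventually.of_forall fun j => supported_mono ?_ (hc.2 j)⟩
  intro l hl
  obtain rfl : l = [] := List.eq_nil_of_length_eq_zero hl
  intro a ha; simp at ha

lemma seqMap_null {T : ℕ → ((List E →₀ k) →ₗ[k] (List E' →₀ k))} {A D : Set E} {D' : Set E'}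
    (h : ∀ ε > 0, ∃ δ > 0, ∀ᶠ j in scale, ∀ l ∈ listsIn (A ∩ farFrom D ε),
      T j (Finsupp.single l 1) ∈ Finsupp.supported k k (listsIn (farFrom D' δ)))
    {c : Seq k E} (hA : ∀ j, c j ∈ Finsupp.supported k k (listsIn A)) (hc : c ∈ null k D) :
    seqMap T c ∈ null k D' := by
  obtain ⟨ε, hε, hc⟩ := hc
  obtain ⟨δ, hδ, hT⟩ := h ε hε
  refine ⟨δ, hδ, ?_⟩
  filter_upwards [hc, hT] with j h1 h2
  exact map_supported h2 (supported_mono (fun l hl a ha => ⟨hl.1 a ha, hl.2 a ha⟩)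
    (mem_supported_inter (hA j) h1))

lemma seqMap_small {T : ℕ → ((List E →₀ k) →ₗ[k] (List E' →₀ k))} {A : Set E} {B : Set E'}
    (hAB : ∀ j, ∀ l ∈ listsIn A, T j (Finsupp.single l 1) ∈ Finsupp.supported k k (listsIn B))
    (h : ∀ ε > 0, ∃ δ > 0, ∀ᶠ j in scale, ∀ l ∈ listsIn A, l ∈ smallLists E δ →
      T j (Finsupp.single l 1) ∈ Finsupp.supported k k (smallLists E' ε))
    {c : Seq k E} (hc : c ∈ small k A) : seqMap T c ∈ small k B := by
  refine ⟨fun j => map_supported (hAB j) (hc.1 j), fun ε hε => ?_⟩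
  obtain ⟨δ, hδ, hT⟩ := h ε hε
  filter_upwards [hc.2 δ hδ, hT] with j h1 h2
  exact map_supported (fun l hl => h2 l hl.1 hl.2) (mem_supported_inter (hc.1 j) h1)

lemma sbd_null {D : Set E} {c : Seq k E} (hc : c ∈ null k D) : sbd k E c ∈ null k D := by
  obtain ⟨ε, hε, hc⟩ := hc
  exact ⟨ε, hε, hc.mono fun j hj => bd_mem hj⟩

lemma bd_single_small {l : List E} {ε : ℝ} (hl : l ∈ smallLists E ε) :
    bd k E (Finsupp.single l 1) ∈ Finsupp.supported k k (smallLists E ε) :=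
  supported_mono (s := listsIn {a | a ∈ l})
    (fun _ hm a ha b hb => hl a (hm a ha) b (hm b hb))
      (bd_single_mem (A := {a | a ∈ l}) fun _ h => h)

lemma sbd_small {Y : Set E} {c : Seq k E} (hc : c ∈ small k Y) : sbd k E c ∈ small k Y :=
  seqMap_small (fun _ _ hl => bd_single_mem hl)
    (fun ε hε => ⟨ε, hε, Eventually.of_forall fun _ _ _ hl => bd_single_small hl⟩) hc

lemma gr_smallDeg (Y : Set E) : Gr (sbd k E) (smallDeg k Y) where
  succ n w hw := ⟨sbd_small hw.1, fun j => bd_len (hw.2 j)⟩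
  zero w hw := by
    funext j
    exact eq_on_supported (f := bd k E) (g := 0) (fun l hl => by
      obtain rfl : l = [] := List.eq_nil_of_length_eq_zero hl
      simp) (hw.2 j)

/-- The part of a sequence of chains supported on a given set of simplices. -/
noncomputable def srs (k : Type*) [Field k] {E : Type*} (s : Set (List E)) :
    Seq k E →ₗ[k] Seq k E := seqMap fun _ => rs k s

lemma srs_null {D : Set E} (s : Set (List E)) {c : Seq k E} (hc : c ∈ null k D) :
    srs k s c ∈ null k D := by
  obtain ⟨ε, hε, hc⟩ := hc
  exact ⟨ε, hε, hc.mono fun j hj => supported_mono Set.inter_subset_left (rs_mem_inter s _ hj)⟩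

lemma srs_smallDeg {Y : Set E} (s : Set (List E)) {n : ℕ} {c : Seq k E}
    (hc : c ∈ smallDeg k Y n) : srs k s c ∈ smallDeg k Y n :=
  ⟨⟨fun j => supported_mono Set.inter_subset_left (rs_mem_inter s _ (hc.1.1 j)),
    fun ε hε => (hc.1.2 ε hε).mono fun _ hj =>
      supported_mono Set.inter_subset_left (rs_mem_inter s _ hj)⟩,
    fun j => supported_mono Set.inter_subset_left (rs_mem_inter s _ (hc.2 j))⟩

lemma srs_listsIn {Y A : Set E} {n : ℕ} {c : Seq k E} (hc : c ∈ smallDeg k Y n) :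
    srs k (listsIn A) c ∈ smallDeg k (Y ∩ A) n := by
  refine ⟨⟨fun j => ?_, (srs_smallDeg _ hc).1.2⟩, (srs_smallDeg _ hc).2⟩
  exact supported_mono (fun l hl a ha => ⟨hl.1 a ha, hl.2 a ha⟩) (rs_mem_inter _ _ (hc.1.1 j))

/-- A sequence of chains avoiding a neighbourhood of `0` may be restricted to it. -/
lemma sub_srs_null {x : E} {Y : Set E} {X : Set E} (hX : X ∈ 𝓝 x) {c : Seq k E}
    (hc : c ∈ small k Y) : c - srs k (listsIn X) c ∈ null k {x} := by
  obtain ⟨ε, hε, hb⟩ := Metric.mem_nhds_iff.1 hX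
  refine ⟨ε / 2, by positivity, ?_⟩
  filter_upwards [hc.2 (ε / 2) (by positivity)] with j hj
  refine supported_mono ?_ (sub_rs_mem (listsIn X) _ hj)
  rintro l ⟨h1, h2⟩ a ha y rfl
  by_contra! h
  refine h2 fun b hb' => hb ?_
  have := h1 b hb' a ha
  rw [Metric.mem_ball]
  linarith [dist_triangle b a y]

end Sequences

section Push

variable {k : Type*} [Field k] {E : Type*}

lemma srs_of_forall {s : Set (List E)} {c : Seq k E}
    (h : ∀ j, c j ∈ Finsupp.supported k k s) : srs k s c = c :=
  funext fun j => rs_of_mem (h j)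

/-- The homotopy obtained by concatenating `n` prisms between consecutive vertex maps. -/
noncomputable def push (k : Type*) [Field k] {E : Type*} (f : ℕ → E → E) (n : ℕ) :
    (List E →₀ k) →ₗ[k] (List E →₀ k) :=
  ∑ i ∈ Finset.range n, prism (f i) (vmap k (f (i + 1)))

lemma push_homotopy (f : ℕ → E → E) (n : ℕ) (w : List E →₀ k) :
    bd k E (push k f n w) + push k f n (bd k E w) = vmap k (f n) w - vmap k (f 0) w := by
  induction n with
  | zero => simp [push]
  | succ n ih =>
    have h : push k f (n + 1) = push k f n + prism (f n) (vmap k (f (n + 1))) := by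
      rw [push, Finset.sum_range_succ]; rfl
    rw [h, LinearMap.add_apply, LinearMap.add_apply, map_add, add_add_add_comm, ih,
      prism_vmap_homotopy]
    abel

lemma push_single_mem {f : ℕ → E → E} {n : ℕ} {P : Submodule k (List E →₀ k)} {l : List E}
    (h : ∀ i < n, ∀ B : Set E, (∀ a ∈ l, f i a ∈ B) → (∀ a ∈ l, f (i + 1) a ∈ B) →
      (∀ b ∈ B, ∃ a ∈ l, b = f i a ∨ b = f (i + 1) a) →
      Finsupp.supported k k (listsIn B) ≤ P) :
    push k f n (Finsupp.single l 1) ∈ P := by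
  rw [push, LinearMap.sum_apply]
  refine sum_mem fun i hi => ?_
  refine h i (Finset.mem_range.1 hi) {b | ∃ a ∈ l, b = f i a ∨ b = f (i + 1) a}
    (fun a ha => ⟨a, ha, Or.inl rfl⟩) (fun a ha => ⟨a, ha, Or.inr rfl⟩) (fun b hb => hb) ?_
  refine prism_mem (A := {a | a ∈ l}) (B := {b | ∃ a ∈ l, b = f i a ∨ b = f (i + 1) a})
    (fun a ha => ⟨a, ha, Or.inl rfl⟩) (fun m hm => ?_) (single_mem_supported fun a ha => ha)
  exact vmap_mem (A := {a | a ∈ l}) (B := {b | ∃ a ∈ l, b = f i a ∨ b = f (i + 1) a})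
    (fun a ha => ⟨a, ha, Or.inr rfl⟩) (single_mem_supported hm)

lemma push_len (f : ℕ → E → E) (n m : ℕ) {l : List E} (hl : l.length = m) :
    push k f n (Finsupp.single l 1) ∈ Finsupp.supported k k (listsLen E (m + 1)) := by
  rw [push, LinearMap.sum_apply]
  refine sum_mem fun i _ => prism_len (fun l' => ?_) (single_mem_supported hl)
  exact vmap_len (single_mem_supported (rfl : l'.length = l'.length))

/-- The sequence of homotopies given by sequences of vertex maps. -/
noncomputable def spush (k : Type*) [Field k] {E : Type*} (f : ℕ → ℕ → E → E) (ν : ℕ → ℕ) :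
    Seq k E →ₗ[k] Seq k E := seqMap fun j => push k (f j) (ν j)

lemma spush_homotopy (f : ℕ → ℕ → E → E) (ν : ℕ → ℕ) (c : Seq k E) :
    sbd k E (spush k f ν c) + spush k f ν (sbd k E c) =
      seqMap (fun j => vmap k (f j (ν j))) c - seqMap (fun j => vmap k (f j 0)) c :=
  funext fun j => push_homotopy (f j) (ν j) (c j)

variable [PseudoMetricSpace E]

lemma spush_null {f : ℕ → ℕ → E → E} {ν : ℕ → ℕ} {A D D' : Set E}
    (h : ∀ ε > 0, ∃ δ > 0, ∀ᶠ j in scale, ∀ i ≤ ν j, ∀ a ∈ A, a ∈ farFrom D ε →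
      f j i a ∈ farFrom D' δ)
    {c : Seq k E} (hA : ∀ j, c j ∈ Finsupp.supported k k (listsIn A)) (hc : c ∈ null k D) :
    spush k f ν c ∈ null k D' := by
  refine seqMap_null (A := A) (D := D) (fun ε hε => ?_) hA hc
  obtain ⟨δ, hδ, h⟩ := h ε hε
  refine ⟨δ, hδ, h.mono fun j hj l hl => push_single_mem fun i hi B _ _ hB => ?_⟩
  refine Finsupp.supported_mono fun m hm b hb => ?_
  obtain ⟨a, ha, rfl | rfl⟩ := hB b (hm b hb)
  · exact hj i hi.le a (hl a ha).1 (hl a ha).2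
  · exact hj (i + 1) hi a (hl a ha).1 (hl a ha).2

lemma spush_smallDeg {f : ℕ → ℕ → E → E} {ν : ℕ → ℕ} {A B : Set E}
    (hAB : ∀ j, ∀ i ≤ ν j, ∀ a ∈ A, f j i a ∈ B)
    (h : ∀ ε > 0, ∃ δ > 0, ∀ᶠ j in scale, ∀ i i', i ≤ i' → i' ≤ i + 1 → i' ≤ ν j →
      ∀ a ∈ A, ∀ b ∈ A, dist a b < δ → dist (f j i a) (f j i' b) < ε)
    {n : ℕ} {c : Seq k E} (hc : c ∈ smallDeg k A n) : spush k f ν c ∈ smallDeg k B (n + 1) := by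
  refine ⟨seqMap_small (A := A) (fun j l hl => push_single_mem fun i hi B' _ _ hB' =>
    Finsupp.supported_mono fun m hm b hb => ?_) (fun ε hε => ?_) hc.1,
    seqMap_deg (fun j l hl => push_len _ _ _ hl) hc.2⟩
  · obtain ⟨a, ha, rfl | rfl⟩ := hB' b (hm b hb)
    · exact hAB j i hi.le a (hl a ha)
    · exact hAB j (i + 1) hi a (hl a ha)
  · obtain ⟨δ, hδ, h⟩ := h ε hε
    refine ⟨δ, hδ, h.mono fun j hj l hl hls => push_single_mem fun i hi B' _ _ hB' => ?_⟩
    refine Finsupp.supported_mono fun m hm b hb b' hb' => ?_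
    obtain ⟨a, ha, h1⟩ := hB' b (hm b hb)
    obtain ⟨a', ha', h2⟩ := hB' b' (hm b' hb')
    rcases h1 with rfl | rfl <;> rcases h2 with rfl | rfl
    · exact hj i i le_rfl (by omega) hi.le a (hl a ha) a' (hl a' ha') (hls a ha a' ha')
    · exact hj i (i + 1) (by omega) le_rfl hi a (hl a ha) a' (hl a' ha') (hls a ha a' ha')
    · rw [dist_comm]
      exact hj i (i + 1) (by omega) le_rfl hi a' (hl a' ha') a (hl a ha) (hls a' ha' a ha)
    · exact hj (i + 1) (i + 1) le_rfl (by omega) hi a (hl a ha) a' (hl a' ha')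
        (hls a ha a' ha')

end Push

end

section

section Suspension

variable {k : Type*} [Field k] {Ω : Type*} [AddCommGroup Ω] [Module k Ω]
  {d : Ω →ₗ[k] Ω} {V : Submodule k Ω}

/-- A complex that can be deformed into a subcomplex has the same homology. -/
lemma hl_deform {W G : ℕ → Submodule k Ω} (dd : ∀ x, d (d x) = 0) (dV : ∀ v ∈ V, d v ∈ V)
    (grW : Gr d W) (hGW : ∀ n, G n ≤ W n)
    (h : ∀ n, ∀ c ∈ W n, ∃ P : Ω →ₗ[k] Ω, (∀ m, ∀ v ∈ W m, v ∈ V → P v ∈ V) ∧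
      (∀ m, ∀ g ∈ G m, P g ∈ G (m + 1)) ∧ (∀ m, ∀ w ∈ W m, P w ∈ W (m + 1)) ∧
      ∃ g ∈ G n, c + d (P c) + P (d c) - g ∈ V) (n : ℕ) : hl d V W n = hl d V G n := by
  refine rl_congr LinearMap.id (fun x hx => ⟨hGW n hx.1, hx.2⟩) (fun c hc => ?_) (fun g hg => ?_)
  · obtain ⟨P, hPV, -, hPW, g, hg, h1⟩ := h n c hc.1
    have hdc : d c ∈ V := hc.2
    have h2 : P (d c) ∈ V := by
      rcases n with _ | n
      · rw [grW.zero c hc.1, map_zero]; exact zero_mem _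
      · exact hPV n _ (grW.succ _ _ hc.1) hdc
    have h3 : c + d (P c) - g ∈ V := by
      have := sub_mem h1 h2
      convert this using 1; abel
    refine ⟨g, ⟨hg, ?_⟩, mem_bdr.2 ⟨-P c, neg_mem (hPW n c hc.1), ?_⟩⟩
    · have := dV _ h3
      rw [map_sub, map_add, dd, add_zero] at this
      have := sub_mem hdc this
      rwa [sub_sub_cancel] at this
    · convert h3 using 1
      rw [map_neg, LinearMap.id_apply]; abel
  · constructor
    · intro h'
      obtain ⟨w, hw, h1⟩ := mem_bdr.1 h'
      rw [LinearMap.id_apply] at h1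
      obtain ⟨P, hPV, hPG, hPW, g', hg', h2⟩ := h (n + 1) w hw
      refine mem_bdr.2 ⟨g' - P g, sub_mem hg' (hPG n g hg.1), ?_⟩
      have h3 := dV _ h2
      have h4 := hPV n _ (sub_mem (hGW n hg.1) (grW.succ _ _ hw)) h1
      have h5 := dV _ h4
      simp only [map_sub, map_add, dd, add_zero] at h3 h5
      have := add_mem (add_mem h1 h3) h5
      convert this using 1
      rw [map_sub]; abel
    · intro h'
      obtain ⟨w, hw, h1⟩ := mem_bdr.1 h'
      exact mem_bdr.2 ⟨w, hGW _ hw, h1⟩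

/-- The homology of a union of two acyclic complexes is the shifted homology of their
intersection. -/
lemma hl_suspension {A B W₀ : ℕ → Submodule k Ω} {e : Ω →ₗ[k] Ω} (dd : ∀ x, d (d x) = 0)
    (dV : ∀ v ∈ V, d v ∈ V) (grA : Gr d A) (grB : Gr d B) (gr₀ : Gr d W₀)
    (eV : ∀ v ∈ V, e v ∈ V) (acyA : ∀ n, Acy d V A n) (acyB : ∀ n, Acy d V B n)
    (heA : ∀ n, ∀ a ∈ A n, e a ∈ W₀ n) (heB : ∀ n, ∀ b ∈ B n, e b = b)
    (h0A : ∀ n, W₀ n ≤ A n) (h0B : ∀ n, W₀ n ≤ B n) (n : ℕ) :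
    hl d V (fun n => A n ⊔ B n) (n + 1) = hl d V W₀ n := by
  have hp : ∀ n, ∀ p ∈ A n ⊔ B n, p - e p ∈ A n ∧ e p ∈ B n := by
    intro n p hp
    obtain ⟨a, ha, b, hb, rfl⟩ := Submodule.mem_sup.1 hp
    rw [map_add, heB n b hb]
    refine ⟨?_, add_mem (h0B n (heA n a ha)) hb⟩
    convert sub_mem ha (h0A n (heA n a ha)) using 1
    abel
  -- the connecting cycle is a boundary on each side
  have conn : ∀ p ∈ A (n + 1) ⊔ B (n + 1), d p ∈ V →
      e (d (p - e p)) + d (e p) ∈ V := by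
    intro p h hd
    have h1 := eV _ hd
    have h2 : d p = d (p - e p) + d (e p) := by rw [map_sub]; abel
    rw [h2, map_add, heB n _ (grB.succ _ _ (hp _ p h).2)] at h1
    exact h1
  symm
  refine rl_congr (e ∘ₗ d ∘ₗ (LinearMap.id - e)) (fun p h => ?_) (fun a ha => ?_) (fun p h => ?_)
  · have h1 := conn p h.1 h.2
    refine ⟨heA n _ (grA.succ _ _ (hp _ p h.1).1), ?_⟩
    have := dV _ h1
    rw [map_add, dd, add_zero] at this
    exact this
  · obtain ⟨α, hα, h1⟩ := acyA n a (h0A n ha.1) ha.2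
    obtain ⟨β, hβ, h2⟩ := acyB n a (h0B n ha.1) ha.2
    refine ⟨α - β, ⟨sub_mem (Submodule.mem_sup_left hα) (Submodule.mem_sup_right hβ), ?_⟩, ?_⟩
    · have := sub_mem h2 h1
      show d (α - β) ∈ V
      rw [map_sub]; convert this using 1; abel
    · refine mem_bdr.2 ⟨e α, heA _ _ hα, ?_⟩
      have := eV _ h1
      rw [map_sub, heB n a (h0B n ha.1)] at this
      convert this using 1
      simp only [LinearMap.comp_apply, LinearMap.sub_apply, LinearMap.id_apply, map_sub,
        heB _ β hβ]
      rw [heB n (d (e α)) (h0B n (gr₀.succ _ _ (heA _ _ hα)))]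
      have h3 : d β = e (d β) := (heB n _ (grB.succ _ _ hβ)).symm
      rw [← h3]
      abel
  · have hpA := (hp _ p h.1).1
    have hpB := (hp _ p h.1).2
    have h1 := conn p h.1 h.2
    have h1' : e (d (p - e p)) - d (p - e p) ∈ V := by
      have := sub_mem h1 (show d p ∈ V from h.2)
      convert this using 1
      rw [map_sub]; abel
    constructor
    · intro h'
      obtain ⟨w, hw, h2⟩ := mem_bdr.1 h'
      simp only [LinearMap.comp_apply, LinearMap.sub_apply, LinearMap.id_apply] at h2
      obtain ⟨α, hα, h3⟩ := acyA (n + 1) (p - e p - w) (sub_mem hpA (h0A _ hw)) (by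
        have := sub_mem h2 h1'
        rw [map_sub d _ w]; convert this using 1; abel)
      obtain ⟨β, hβ, h4⟩ := acyB (n + 1) (e p + w) (add_mem hpB (h0B _ hw)) (by
        have := sub_mem h1 h2
        rw [map_add d _ w]; convert this using 1; abel)
      refine mem_bdr.2 ⟨α + β, add_mem (Submodule.mem_sup_left hα) (Submodule.mem_sup_right hβ), ?_⟩
      have := add_mem h3 h4
      convert this using 1
      rw [map_add]; abel
    · intro h'
      obtain ⟨q, hq, h2⟩ := mem_bdr.1 h'
      obtain ⟨hqA, hqB⟩ := hp _ q hq
      have hmem : e (d (q - e q)) ∈ W₀ (n + 1) := heA _ _ (grA.succ _ _ hqA)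
      refine mem_bdr.2 ⟨-e (d (q - e q)), neg_mem hmem, ?_⟩
      have h3 : p - e p - (d (q - e q) - e (d (q - e q))) ∈ V := by
        have := sub_mem h2 (eV _ h2)
        convert this using 1
        have h4 : e (d (e q)) = d (e q) := heB _ _ (grB.succ _ _ hqB)
        simp only [map_sub, h4]
        abel
      have h5 := eV _ (dV _ h3)
      have h6 := heB n _ (h0B n (gr₀.succ _ _ hmem))
      rw [map_sub d (p - e p), map_sub d (d (q - e q)), dd, zero_sub, map_sub e, map_neg e, h6,
        ← map_neg d] at h5
      exact h5

end Suspension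

section Base

variable {k : Type*} [Field k]

/-- Every sequence in a finite type is constant along `scale`. -/
lemma exists_eventually_eq {α : Type*} [Finite α] (f : ℕ → α) : ∃ a, ∀ᶠ j in scale, f j = a := by
  have : ∀ᶠ j in scale, ∃ a ∈ (Set.univ : Set α), f j = a :=
    Eventually.of_forall fun j => ⟨f j, trivial, rfl⟩
  obtain ⟨a, -, ha⟩ := (Ultrafilter.eventually_exists_mem_iff Set.finite_univ).1 this
  exact ⟨a, ha⟩

lemma eventually_zero_of_mem_null {E : Type*} [PseudoMetricSpace E] {x : E} {n : ℕ}
    {c : Seq k E} (hc : c ∈ smallDeg k {x} (n + 1)) (h : c ∈ null k {x}) :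
    ∀ᶠ j in scale, c j = 0 := by
  obtain ⟨ε, hε, h⟩ := h
  filter_upwards [h] with j hj
  have := mem_supported_inter (mem_supported_inter (hc.1.1 j) (hc.2 j)) hj
  have hempty : listsIn {x} ∩ listsLen E (n + 1) ∩ listsIn (farFrom {x} ε) = ∅ := by
    ext l
    simp only [Set.mem_inter_iff, Set.mem_empty_iff_false, iff_false]
    rintro ⟨⟨h1, h2⟩, h3⟩
    have h2 : l.length = n + 1 := h2
    obtain ⟨a, ha⟩ := List.exists_mem_of_length_pos (by omega : 0 < l.length)
    have h4 := h3 a ha x rfl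
    have h5 : a = x := h1 a ha
    rw [h5, dist_self] at h4
    linarith
  rw [hempty] at this
  simpa using this

/-- The local homology of a point. -/
lemma sph_point [Finite k] {E : Type*} [PseudoMetricSpace E] (x : E) :
    Sph (sbd k E) (null k {x}) (smallDeg k {x}) 1 := by
  -- the structure of chains of degree `n`
  have hform : ∀ n, ∀ c ∈ smallDeg k {x} n, ∀ j, ∃ t : k,
      c j = Finsupp.single (List.replicate n x) t := by
    intro n c hc j
    have h := mem_supported_inter (hc.1.1 j) (hc.2 j)
    have hs : listsIn {x} ∩ listsLen E n ⊆ {List.replicate n x} := by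
      rintro l ⟨h1, h2⟩
      exact List.eq_replicate_iff.2 ⟨h2, h1⟩
    have := supported_mono hs h
    rw [Finsupp.mem_supported] at this
    have h' : (c j).support ⊆ {List.replicate n x} := by exact_mod_cast this
    exact Finsupp.support_subset_singleton'.1 h'
  have hmem : ∀ n (t : ℕ → k),
      (fun j => Finsupp.single (List.replicate n x) (t j)) ∈ smallDeg k ({x} : Set E) n := by
    intro n t
    refine ⟨⟨fun j => Finsupp.single_mem_supported k _ ?_, fun ε hε =>
      Eventually.of_forall fun j => Finsupp.single_mem_supported k _ ?_⟩,
      fun j => Finsupp.single_mem_supported k _ ?_⟩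
    · intro a ha; exact List.eq_of_mem_replicate ha
    · intro a ha b hb
      rw [List.eq_of_mem_replicate ha, List.eq_of_mem_replicate hb, dist_self]; exact hε
    · exact List.length_replicate
  refine ⟨hl_eq_one.2 ⟨fun _ => Finsupp.single (List.replicate 1 x) 1, ⟨hmem 1 _, ?_⟩, ?_, ?_⟩, ?_⟩
  · exact smallDeg_zero_le _ _ ((gr_smallDeg _).succ _ _ (hmem 1 fun _ => 1))
  · intro h
    obtain ⟨w, hw, h1⟩ := mem_bdr.1 h
    have h2 := eventually_zero_of_mem_null (n := 0)
      (sub_mem (hmem 1 fun _ => 1) ((gr_smallDeg _).succ _ _ hw)) h1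
    obtain ⟨j, hj⟩ := h2.exists
    obtain ⟨t, ht⟩ := hform 2 w hw j
    have h3 : bd k E (w j) = 0 := by
      have : Finsupp.single (List.replicate 2 x) t =
        t • Finsupp.single (List.replicate 2 x) (1 : k) := by
        simp
      rw [ht, this, map_smul, List.replicate_succ, List.replicate_succ, bd_single_cons,
        bd_single_cons]
      simp
    simp [h3] at hj
  · intro c hc
    choose t ht using hform 1 c hc.1
    obtain ⟨a, ha⟩ := exists_eventually_eq t
    refine ⟨a, le_bdr (mem_null_of_eventually_zero ?_)⟩
    filter_upwards [ha] with j hj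
    simp [ht, hj]
  · intro n hn
    rw [hl_eq_zero]
    intro c hc hdc
    rcases n with _ | _ | n
    · exact ⟨0, zero_mem _, by rw [map_zero, sub_zero]; exact smallDeg_zero_le _ _ hc⟩
    · exact absurd rfl hn
    · have h1 := eventually_zero_of_mem_null ((gr_smallDeg _).succ _ _ hc) hdc
      choose t ht using hform _ c hc
      refine ⟨fun j => Finsupp.single (List.replicate (n + 1 + 1 + 1) x) (t j), hmem _ _, ?_⟩
      refine mem_null_of_eventually_zero ?_
      filter_upwards [h1] with j hj
      have h2 : Finsupp.single (List.replicate (n + 1 + 1 + 1) x) (t j) = cone k x (c j) := by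
        rw [ht, cone_single]; rfl
      show c j - bd k E (Finsupp.single (List.replicate (n + 1 + 1 + 1) x) (t j)) = 0
      rw [h2, bd_cone]
      rw [sbd_apply] at hj
      simp [hj]

end Base

end

section

section VertexMaps

variable {k : Type*} [Field k] {E : Type*} [PseudoMetricSpace E]

/-- The map of sequences of chains induced by a sequence of vertex maps. -/
noncomputable def svmap (k : Type*) [Field k] {E : Type*} (f : ℕ → E → E) :
    Seq k E →ₗ[k] Seq k E := seqMap fun j => vmap k (f j)

lemma sbd_svmap {E : Type*} (f : ℕ → E → E) (c : Seq k E) :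
    sbd k E (svmap k f c) = svmap k f (sbd k E c) :=
  funext fun j => bd_vmap (f j) (c j)

lemma svmap_id {E : Type*} {f : ℕ → E → E} (h : ∀ j x, f j x = x) (c : Seq k E) :
    svmap k f c = c := by
  funext j
  have : f j = fun x => x := funext (h j)
  show vmap k (f j) (c j) = c j
  rw [this, vmap_id]

lemma vmap_single_mem {E : Type*} {f : E → E} {l : List E} {s : Set (List E)}
    (h : l.map f ∈ s) : vmap k f (Finsupp.single l 1) ∈ Finsupp.supported k k s := by
  rw [vmap_single]; exact single_mem_supported h

lemma svmap_null {f : ℕ → E → E} {A D D' : Set E}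
    (h : ∀ ε > 0, ∃ δ > 0, ∀ᶠ j in scale, ∀ a ∈ A, a ∈ farFrom D ε → f j a ∈ farFrom D' δ)
    {c : Seq k E} (hA : ∀ j, c j ∈ Finsupp.supported k k (listsIn A)) (hc : c ∈ null k D) :
    svmap k f c ∈ null k D' := by
  refine seqMap_null (A := A) (D := D) (fun ε hε => ?_) hA hc
  obtain ⟨δ, hδ, h⟩ := h ε hε
  refine ⟨δ, hδ, h.mono fun j hj l hl => vmap_single_mem fun b hb => ?_⟩
  obtain ⟨a, ha, rfl⟩ := List.mem_map.1 hb
  exact hj a (hl a ha).1 (hl a ha).2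

lemma svmap_smallDeg {f : ℕ → E → E} {A B : Set E} (hAB : ∀ j, ∀ a ∈ A, f j a ∈ B)
    (h : ∀ ε > 0, ∃ δ > 0, ∀ᶠ j in scale, ∀ a ∈ A, ∀ b ∈ A, dist a b < δ →
      dist (f j a) (f j b) < ε)
    {n : ℕ} {c : Seq k E} (hc : c ∈ smallDeg k A n) : svmap k f c ∈ smallDeg k B n := by
  refine ⟨seqMap_small (A := A) (fun j l hl => vmap_single_mem fun b hb => ?_) (fun ε hε => ?_)
    hc.1, seqMap_deg (fun j l hl => vmap_single_mem ?_) hc.2⟩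
  · obtain ⟨a, ha, rfl⟩ := List.mem_map.1 hb
    exact hAB j a (hl a ha)
  · obtain ⟨δ, hδ, h⟩ := h ε hε
    refine ⟨δ, hδ, h.mono fun j hj l hl hls => vmap_single_mem fun b hb b' hb' => ?_⟩
    obtain ⟨a, ha, rfl⟩ := List.mem_map.1 hb
    obtain ⟨a', ha', rfl⟩ := List.mem_map.1 hb'
    exact hj a (hl a ha) a' (hl a' ha') (hls a ha a' ha')
  · simpa [listsLen] using hl

/-- Chains which can be pushed away from `D` have no homology. -/
lemma acy_of_push {f : ℕ → ℕ → E → E} {ν : ℕ → ℕ} {A D : Set E} (h0 : ∀ j x, f j 0 x = x)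
    (hD : ∀ ε > 0, ∃ δ > 0, ∀ᶠ j in scale, ∀ i ≤ ν j, ∀ a ∈ A, a ∈ farFrom D ε →
      f j i a ∈ farFrom D δ)
    (hAB : ∀ j, ∀ i ≤ ν j, ∀ a ∈ A, f j i a ∈ A)
    (hs : ∀ ε > 0, ∃ δ > 0, ∀ᶠ j in scale, ∀ i i', i ≤ i' → i' ≤ i + 1 → i' ≤ ν j →
      ∀ a ∈ A, ∀ b ∈ A, dist a b < δ → dist (f j i a) (f j i' b) < ε)
    {ε : ℝ} (hε : 0 < ε) (hend : ∀ j, ∀ a ∈ A, f j (ν j) a ∈ farFrom D ε) (n : ℕ) :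
    Acy (sbd k E) (null k D) (smallDeg k A) n := by
  intro c hc hdc
  refine ⟨-spush k f ν c, neg_mem (spush_smallDeg hAB hs hc), ?_⟩
  have h1 : spush k f ν (sbd k E c) ∈ null k D :=
    spush_null hD (fun j => bd_mem (hc.1.1 j)) hdc
  have h2 : svmap k (fun j => f j (ν j)) c ∈ null k D := by
    refine ⟨ε, hε, Eventually.of_forall fun j => ?_⟩
    exact vmap_mem (hend j) (hc.1.1 j)
  have h3 := spush_homotopy f ν c
  have h4 : seqMap (fun j => vmap k (f j 0)) c = c := svmap_id h0 c
  rw [h4] at h3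
  have := sub_mem h2 h1
  convert this using 1
  rw [map_neg, sub_neg_eq_add, eq_sub_iff_add_eq, add_assoc, h3]
  show c + (svmap k (fun j => f j (ν j)) c - c) = _
  abel

end VertexMaps

section Euclidean

variable {k : Type*} [Field k] {r : ℕ}

lemma dist_update_le {x y : Fin r → ℝ} {i : Fin r} {s t η : ℝ} (h : |s - t| ≤ dist x y + η)
    (hη : 0 ≤ η) : dist (Function.update x i s) (Function.update y i t) ≤ dist x y + η := by
  refine (dist_pi_le_iff (by positivity)).2 fun l => ?_
  by_cases hl : l = i
  · subst hl; simpa [Real.dist_eq] using h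
  · rw [Function.update_of_ne hl, Function.update_of_ne hl]
    linarith [dist_le_pi_dist x y l]

lemma abs_coord_le (x y : Fin r → ℝ) (i : Fin r) : |x i - y i| ≤ dist x y := by
  rw [← Real.dist_eq]; exact dist_le_pi_dist x y i

/-- Half spaces have no local homology. -/
lemma acy_half {Q : Set (Fin r → ℝ)} {i₀ : Fin r} {s : ℝ} (hs : |s| = 1)
    (hQ : ∀ x ∈ Q, ∀ t, Function.update x i₀ t ∈ Q) (n : ℕ) :
    Acy (sbd k (Fin r → ℝ)) (null k {0}) (smallDeg k {x ∈ Q | 0 ≤ s * x i₀}) n := by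
  have hss : s * s = 1 := by rw [← abs_mul_abs_self, hs]; norm_num
  have hgrow : ∀ x : Fin r → ℝ, 0 ≤ s * x i₀ → ∀ t : ℝ, 0 ≤ t →
      |x i₀| + t ≤ |x i₀ + s * t| := by
    intro x hx t ht
    have h1 : |x i₀| = s * x i₀ := by
      rw [← abs_of_nonneg hx, abs_mul, hs, one_mul]
    have h2 : |x i₀ + s * t| = |s * (x i₀ + s * t)| := by rw [abs_mul, hs, one_mul]
    rw [h2, h1, mul_add, ← mul_assoc, hss, one_mul]
    exact le_abs_self _
  refine acy_of_push (f := fun j i x => Function.update x i₀ (x i₀ + s * (i / (j + 1))))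
    (ν := fun j => j + 1) ?_ ?_ ?_ ?_ one_pos ?_ n
  · intro j x; simp
  · intro ε hε
    refine ⟨ε, hε, Eventually.of_forall fun j i _ a ha hfar => ?_⟩
    rintro _ rfl
    refine (hfar 0 rfl).trans ((dist_pi_le_iff dist_nonneg).2 fun l => ?_)
    refine le_trans ?_ (dist_le_pi_dist _ _ l)
    by_cases hl : l = i₀
    · subst hl
      have := hgrow a ha.2 (i / (j + 1)) (by positivity)
      simp only [Pi.zero_apply, Real.dist_eq, sub_zero, Function.update_self]
      have : (0:ℝ) ≤ i / (j + 1) := by positivity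
      linarith
    · rw [Function.update_of_ne hl]
  · intro j i _ a ha
    refine ⟨hQ a ha.1 _, ?_⟩
    rw [Function.update_self, mul_add, ← mul_assoc, hss, one_mul]
    have := ha.2
    positivity
  · intro ε hε
    refine ⟨ε / 2, by positivity, ?_⟩
    filter_upwards [inv_lt_of_large (ν := fun j => j) scale_ge (by positivity : 0 < ε / 2)]
      with j hj i i' h1 h2 _ a _ b _ hab
    have h3 : |(i : ℝ) / (j + 1) - i' / (j + 1)| ≤ 1 / (j + 1) := by
      rw [← sub_div, abs_div, abs_of_pos (by positivity : (0:ℝ) < j + 1)]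
      refine div_le_div_of_nonneg_right ?_ (by positivity)
      have h4 : (i : ℝ) ≤ i' := by exact_mod_cast h1
      have h5 : (i' : ℝ) ≤ i + 1 := by exact_mod_cast h2
      rw [abs_le]; constructor <;> linarith
    refine lt_of_le_of_lt (dist_update_le (η := 1 / (j + 1)) ?_ (by positivity)) (by linarith)
    have h6 : a i₀ + s * (i / (j + 1)) - (b i₀ + s * (i' / (j + 1))) =
        (a i₀ - b i₀) + s * (i / (j + 1) - i' / (j + 1)) := by ring
    rw [h6]
    refine (abs_add_le _ _).trans (add_le_add (abs_coord_le _ _ _) ?_)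
    rwa [abs_mul, hs, one_mul]
  · intro j a ha
    rintro _ rfl
    refine le_trans ?_ (dist_le_pi_dist _ _ i₀)
    have := hgrow a ha.2 1 zero_le_one
    have h1 : ((j + 1 : ℕ) : ℝ) / (j + 1) = 1 := by
      push_cast; exact div_self (by positivity)
    simp only [Pi.zero_apply, Real.dist_eq, sub_zero, Function.update_self, h1]
    linarith [abs_nonneg (a i₀)]

/-- Moving points close to the hyperplane `x i = 0` into it. -/
noncomputable def flatten (i : Fin r) (η : ℝ) (x : Fin r → ℝ) : Fin r → ℝ :=
  if |x i| < η then Function.update x i 0 else x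

lemma dist_flatten (i : Fin r) {η : ℝ} (hη : 0 ≤ η) (x : Fin r → ℝ) :
    dist (flatten i η x) x ≤ η := by
  unfold flatten
  split_ifs with h
  · have := dist_update_le (x := x) (y := x) (i := i) (s := 0) (t := x i) (η := η)
      (by simpa using h.le) hη
    simpa using this
  · simpa using hη

lemma sphere_suspend [Finite k] {Q : Set (Fin r → ℝ)} {i₀ : Fin r}
    (hQ : ∀ x ∈ Q, ∀ t, Function.update x i₀ t ∈ Q) {n : ℕ}
    (h : Sph (sbd k (Fin r → ℝ)) (null k {0}) (smallDeg k {x ∈ Q | x i₀ = 0}) n) :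
    Sph (sbd k (Fin r → ℝ)) (null k {0}) (smallDeg k Q) (n + 1) := by
  set A := {x ∈ Q | 0 ≤ (1 : ℝ) * x i₀} with hA
  set B := {x ∈ Q | 0 ≤ (-1 : ℝ) * x i₀} with hB
  have hAQ : A ⊆ Q := fun x hx => hx.1
  have hBQ : B ⊆ Q := fun x hx => hx.1
  have hAB : A ∩ B = {x ∈ Q | x i₀ = 0} := by
    ext x
    simp only [hA, hB, Set.mem_inter_iff, Set.mem_ofPred_eq]
    constructor
    · rintro ⟨⟨h1, h2⟩, -, h3⟩; exact ⟨h1, by linarith⟩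
    · rintro ⟨h1, h2⟩; simp [h1, h2]
  have hfl : ∀ (η : ℝ) (i : ℕ) (s : ℝ), ∀ x ∈ {x ∈ Q | 0 ≤ s * x i₀},
      (if i = 0 then x else flatten i₀ η x) ∈ {x ∈ Q | 0 ≤ s * x i₀} := by
    intro η i s x hx
    unfold flatten
    split_ifs
    · exact hx
    · exact ⟨hQ x hx.1 0, by simp⟩
    · exact hx
  have hflQ : ∀ (η : ℝ) (i : ℕ), ∀ x ∈ Q, (if i = 0 then x else flatten i₀ η x) ∈ Q := by
    intro η i x hx
    simpa using (hfl η i 0 x ⟨hx, by simp⟩).1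
  have key : ∀ m, hl (sbd k (Fin r → ℝ)) (null k {0}) (smallDeg k Q) m =
      hl (sbd k (Fin r → ℝ)) (null k {0}) (fun m => smallDeg k A m ⊔ smallDeg k B m) m := by
    refine hl_deform sbd_sbd (fun v => sbd_null) (gr_smallDeg Q)
      (fun m => sup_le (smallDeg_mono hAQ m) (smallDeg_mono hBQ m)) fun m c hc => ?_
    obtain ⟨ν, hν, hν'⟩ := exists_diagonal
      (fun n j => c j ∈ Finsupp.supported k k (smallLists (Fin r → ℝ) (1 / ((n : ℝ) + 1))))
      (fun n => hc.1.2 _ (by positivity))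
    set η : ℕ → ℝ := fun j => 1 / ((ν j : ℝ) + 1) with hη
    have hη0 : ∀ j, 0 ≤ η j := fun j => by rw [hη]; positivity
    set f : ℕ → ℕ → (Fin r → ℝ) → (Fin r → ℝ) :=
      fun j i x => if i = 0 then x else flatten i₀ (η j) x with hf
    have hdist : ∀ j i x, dist (f j i x) x ≤ η j := by
      intro j i x
      simp only [hf]
      split_ifs
      · simpa using hη0 j
      · exact dist_flatten i₀ (hη0 j) x
    have hsm : ∀ Y : Set (Fin r → ℝ), ∀ ε > 0, ∃ δ > 0, ∀ᶠ j in scale, ∀ i i',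
        i ≤ i' → i' ≤ i + 1 → i' ≤ 1 → ∀ a ∈ Y, ∀ b ∈ Y, dist a b < δ →
        dist (f j i a) (f j i' b) < ε := by
      intro Y ε hε
      refine ⟨ε / 2, by positivity, ?_⟩
      filter_upwards [inv_lt_of_large hν' (by positivity : 0 < ε / 4)] with j hj
        i i' _ _ _ a _ b _ hab
      have h1 := hdist j i a
      have h2 := hdist j i' b
      have h3 := dist_triangle4 (f j i a) a b (f j i' b)
      rw [dist_comm b] at h3
      have : η j < ε / 4 := hj
      linarith
    refine ⟨spush k f fun _ => 1, fun m' v hv hv0 => ?_, fun m' g hg => ?_, fun m' w hw => ?_, ?_⟩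
    · refine spush_null (A := Q) (D := {0}) (fun ε hε => ⟨ε / 2, by positivity, ?_⟩) hv.1.1 hv0
      filter_upwards [inv_lt_of_large hν' (by positivity : 0 < ε / 2)] with j hj i _ a _ ha
      rintro _ rfl
      have h1 := ha 0 rfl
      have h2 := hdist j i a
      have h3 := dist_triangle_left a 0 (f j i a)
      have : η j < ε / 2 := hj
      linarith
    · obtain ⟨a, ha, b, hb, rfl⟩ := Submodule.mem_sup.1 hg
      rw [map_add]
      exact add_mem
        (Submodule.mem_sup_left (spush_smallDeg (fun j i _ => hfl _ i 1) (hsm A) ha))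
        (Submodule.mem_sup_right (spush_smallDeg (fun j i _ => hfl _ i (-1)) (hsm B) hb))
    · exact spush_smallDeg (fun j i _ => hflQ _ i) (hsm Q) hw
    · set c' := svmap k (fun j => f j 1) c with hc'
      have hc'Q : c' ∈ smallDeg k Q m := by
        refine svmap_smallDeg (fun j => hflQ _ 1) (fun ε hε => ?_) hc
        obtain ⟨δ, hδ, h⟩ := hsm Q ε hε
        exact ⟨δ, hδ, h.mono fun j hj => hj 1 1 le_rfl (by omega) le_rfl⟩
      have hb : srs k (listsIn B) c' ∈ smallDeg k B m := by
        have := srs_listsIn (A := B) hc'Q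
        rwa [Set.inter_eq_right.2 hBQ] at this
      have ha : srs k (listsIn A) (c' - srs k (listsIn B) c') ∈ smallDeg k A m := by
        have := srs_listsIn (A := A) (sub_mem hc'Q (smallDeg_mono hBQ m hb))
        rwa [Set.inter_eq_right.2 hAQ] at this
      refine ⟨_, add_mem (Submodule.mem_sup_left ha) (Submodule.mem_sup_right hb), ?_⟩
      have h1 := spush_homotopy f (fun _ => 1) c
      have h4 : seqMap (fun j => vmap k (f j 0)) c = c :=
        svmap_id (fun j x => by simp [hf]) c
      rw [h4] at h1
      have h5 : c + sbd k (Fin r → ℝ) (spush k f (fun _ => 1) c) +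
          spush k f (fun _ => 1) (sbd k (Fin r → ℝ) c) = c' := by
        rw [add_assoc, h1]
        show c + (c' - c) = c'
        abel
      rw [h5]
      refine mem_null_of_eventually_zero ?_
      filter_upwards [hν] with j hj
      have h6 : c' j ∈ Finsupp.supported k k (listsIn A ∪ listsIn B) := by
        refine map_supported (f := vmap k (f j 1)) (fun l hl => vmap_single_mem ?_)
          (mem_supported_inter (hc.1.1 j) hj)
        have hval : ∀ x : Fin r → ℝ, (f j 1 x) i₀ ≠ 0 → (f j 1 x) i₀ = x i₀ ∧ η j ≤ |x i₀| := by
          intro x hx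
          simp only [hf, one_ne_zero, if_false] at hx ⊢
          unfold flatten at hx ⊢
          split_ifs at hx ⊢ with h
          · simp at hx
          · exact ⟨rfl, not_lt.1 h⟩
        by_contra hcon
        rw [Set.mem_union, not_or] at hcon
        have hn1 : ¬ ∀ b ∈ l.map (f j 1), b ∈ A := hcon.1
        have hn2 : ¬ ∀ b ∈ l.map (f j 1), b ∈ B := hcon.2
        push Not at hn1 hn2
        obtain ⟨_, hb1, hb1'⟩ := hn1
        obtain ⟨_, hb2, hb2'⟩ := hn2
        obtain ⟨x, hx, rfl⟩ := List.mem_map.1 hb1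
        obtain ⟨y, hy, rfl⟩ := List.mem_map.1 hb2
        have hx1 : f j 1 x i₀ < 0 := by
          by_contra hge
          exact hb1' ⟨hflQ _ 1 x (hl.1 x hx), by linarith⟩
        have hy1 : 0 < f j 1 y i₀ := by
          by_contra hge
          exact hb2' ⟨hflQ _ 1 y (hl.1 y hy), by linarith⟩
        obtain ⟨hx2, hx3⟩ := hval x hx1.ne
        obtain ⟨hy2, hy3⟩ := hval y hy1.ne'
        rw [hx2] at hx1
        rw [hy2] at hy1
        rw [abs_of_neg hx1] at hx3
        rw [abs_of_pos hy1] at hy3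
        have h7 := hl.2 y hy x hx
        have h8 := abs_coord_le y x i₀
        have h9 := le_abs_self (y i₀ - x i₀)
        have : dist y x < η j := h7
        linarith [hη0 j]
      have h7 := sub_rs_mem (listsIn B) _ h6
      have h8 : c' j - rs k (listsIn B) (c' j) ∈ Finsupp.supported k k (listsIn A) :=
        supported_mono (fun l hl => hl.1.resolve_right hl.2) h7
      show c' j - (rs k (listsIn A) (c' j - rs k (listsIn B) (c' j)) + rs k (listsIn B) (c' j)) = 0
      rw [rs_of_mem h8]; abel
  have susp : ∀ m, hl (sbd k (Fin r → ℝ)) (null k {0}) (smallDeg k Q) (m + 1) =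
      hl (sbd k (Fin r → ℝ)) (null k {0}) (smallDeg k {x ∈ Q | x i₀ = 0}) m := by
    intro m
    rw [key (m + 1)]
    refine hl_suspension (e := srs k (listsIn B)) sbd_sbd (fun v => sbd_null) (gr_smallDeg A)
      (gr_smallDeg B) (gr_smallDeg _) (fun v => srs_null _) (acy_half (by simp) hQ)
      (acy_half (by simp) hQ) (fun m a ha => ?_) (fun m b hb => ?_) (fun m => ?_) (fun m => ?_) m
    · rw [← hAB]; exact srs_listsIn ha
    · exact srs_of_forall hb.1.1
    · rw [← hAB]; exact smallDeg_mono Set.inter_subset_left m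
    · rw [← hAB]; exact smallDeg_mono Set.inter_subset_right m
  refine ⟨by rw [susp, h.1], fun m hm => ?_⟩
  rcases m with _ | m
  · rw [hl_eq_zero]
    intro c hc _
    exact ⟨0, zero_mem _, by rw [map_zero, sub_zero]; exact smallDeg_zero_le _ _ hc⟩
  · rw [susp]; exact h.2 m fun h' => hm (by omega)

/-- The local homology of Euclidean space. -/
lemma sph_univ [Finite k] :
    Sph (sbd k (Fin r → ℝ)) (null k {0}) (smallDeg k Set.univ) (r + 1) := by
  have h : ∀ m ≤ r, Sph (sbd k (Fin r → ℝ)) (null k {0})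
      (smallDeg k {x : Fin r → ℝ | ∀ i : Fin r, m ≤ i → x i = 0}) (m + 1) := by
    intro m
    induction m with
    | zero =>
      intro _
      have : {x : Fin r → ℝ | ∀ i : Fin r, 0 ≤ (i : ℕ) → x i = 0} = {0} := by
        ext x; simp [funext_iff]
      rw [this]
      exact sph_point 0
    | succ m ih =>
      intro hm
      refine sphere_suspend (Q := {x : Fin r → ℝ | ∀ i : Fin r, m + 1 ≤ i → x i = 0})
        (i₀ := ⟨m, hm⟩) (fun x hx t i hi => ?_) ?_
      · rw [Function.update_of_ne]
        · exact hx i hi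
        · rintro rfl; simp at hi
      · convert ih (by omega) using 3
        ext x
        simp only [Set.mem_ofPred_eq]
        constructor
        · rintro ⟨h1, h2⟩ i hi
          rcases Nat.lt_or_ge m i with h | h
          · exact h1 i h
          · have : i = ⟨m, hm⟩ := Fin.ext (by simp; omega)
            rw [this]; exact h2
        · intro h
          exact ⟨fun i hi => h i (by omega), h _ le_rfl⟩
  convert h r le_rfl using 2
  ext x
  simp only [Set.mem_univ, Set.mem_ofPred_eq, true_iff]
  intro i hi
  exact absurd i.2 (by omega)

/-- The local homology of a neighbourhood of the origin. -/
lemma sph_nhds [Finite k] {X : Set (Fin r → ℝ)} (hX : X ∈ 𝓝 0) :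
    Sph (sbd k (Fin r → ℝ)) (null k {0}) (smallDeg k X) (r + 1) := by
  have h : ∀ n, hl (sbd k (Fin r → ℝ)) (null k {0}) (smallDeg k Set.univ) n =
      hl (sbd k (Fin r → ℝ)) (null k {0}) (smallDeg k X) n := by
    intro n
    have hmem : ∀ m, ∀ c ∈ smallDeg k (Set.univ : Set (Fin r → ℝ)) m,
        srs k (listsIn X) c ∈ smallDeg k X m := by
      intro m c hc
      have := srs_listsIn (A := X) hc
      rwa [Set.univ_inter] at this
    refine rl_congr LinearMap.id (fun c hc => ⟨smallDeg_mono (Set.subset_univ _) n hc.1, hc.2⟩)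
      (fun c hc => ?_) (fun c hc => ?_)
    · have h1 := sub_srs_null hX hc.1.1
      refine ⟨srs k (listsIn X) c, ⟨hmem n c hc.1, ?_⟩, le_bdr h1⟩
      have := sbd_null h1
      rw [map_sub] at this
      have h2 : sbd k _ c ∈ null k {0} := hc.2
      have := sub_mem h2 this
      rw [sub_sub_cancel] at this
      exact this
    · constructor
      · intro h
        obtain ⟨w, hw, h1⟩ := mem_bdr.1 h
        refine mem_bdr.2 ⟨_, hmem _ w hw, ?_⟩
        have := add_mem h1 (sbd_null (sub_srs_null hX hw.1))
        convert this using 1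
        rw [map_sub, LinearMap.id_apply]; abel
      · intro h
        obtain ⟨w, hw, h1⟩ := mem_bdr.1 h
        exact mem_bdr.2 ⟨w, smallDeg_mono (Set.subset_univ _) _ hw, h1⟩
  refine ⟨by rw [← h]; exact sph_univ.1, fun m hm => by rw [← h]; exact sph_univ.2 m hm⟩

end Euclidean

end

section

section LocalInjectivity

variable {k : Type*} [Field k] {r : ℕ}

/-- The homothety with centre `v` and ratio `1 + s`. -/
noncomputable def expand (v : Fin r → ℝ) (s : ℝ) (x : Fin r → ℝ) : Fin r → ℝ :=
  v + (1 + s) • (x - v)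

lemma expand_far {v : Fin r → ℝ} {a s ε : ℝ} (hs : 0 ≤ s) (hv : v ∈ Metric.closedBall 0 a)
    {x : Fin r → ℝ} (hx : x ∈ farFrom (Metric.closedBall 0 a) ε) :
    expand v s x ∈ farFrom (Metric.closedBall 0 a) ε := by
  intro u hu
  have h1 : (0 : ℝ) < 1 + s := by linarith
  have hconv := convex_closedBall (0 : Fin r → ℝ) a
  have hu' : v + (1 + s)⁻¹ • (u - v) ∈ Metric.closedBall (0 : Fin r → ℝ) a := by
    refine hconv.add_smul_sub_mem hv hu ⟨by positivity, ?_⟩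
    exact inv_le_one_of_one_le₀ (by linarith)
  have h2 := hx _ hu'
  have h3 : expand v s x - u = (1 + s) • (x - (v + (1 + s)⁻¹ • (u - v))) := by
    unfold expand
    rw [← sub_sub, smul_sub _ (x - v), smul_smul, mul_inv_cancel₀ h1.ne', one_smul]
    abel
  rw [dist_eq_norm, h3, norm_smul, Real.norm_of_nonneg h1.le, ← dist_eq_norm]
  nlinarith [dist_nonneg (x := x) (y := v + (1 + s)⁻¹ • (u - v))]

lemma dist_expand_le {v a b : Fin r → ℝ} {s s' Λ : ℝ} (hs : 0 ≤ s) (hs' : s ≤ Λ) :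
    dist (expand v s a) (expand v s' b) ≤ (1 + Λ) * dist a b + |s - s'| * ‖b - v‖ := by
  have h : expand v s a - expand v s' b = (1 + s) • (a - b) + (s - s') • (b - v) := by
    unfold expand
    module
  rw [dist_eq_norm, h]
  refine (norm_add_le _ _).trans (add_le_add ?_ ?_)
  · rw [norm_smul, Real.norm_of_nonneg (by linarith), dist_eq_norm]
    exact mul_le_mul_of_nonneg_right (by linarith) (norm_nonneg _)
  · rw [norm_smul, Real.norm_eq_abs]

/-- A cycle which bounds near some point of a small ball bounds near the whole ball. -/
lemma bounds_of_bounds_at {X : Set (Fin r → ℝ)} (hX : Bornology.IsBounded X) {a : ℝ}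
    {v : Fin r → ℝ} (hv : v ∈ Metric.closedBall 0 a) {n : ℕ} {z w : Seq k (Fin r → ℝ)}
    (hz : z ∈ smallDeg k X n) (hdz : sbd k _ z ∈ null k (Metric.closedBall 0 a))
    (hw : w ∈ smallDeg k Set.univ (n + 1)) (hzw : z - sbd k _ w ∈ null k {v}) :
    ∃ w' ∈ smallDeg k Set.univ (n + 1), z - sbd k _ w' ∈ null k (Metric.closedBall 0 a) := by
  obtain ⟨ε, hε, hfar⟩ := hzw
  obtain ⟨C, hC⟩ := hX.exists_norm_le
  have ha : 0 ≤ a := dist_nonneg.trans hv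
  -- the homothety ratio
  obtain ⟨Λ, hΛ0, hΛ⟩ : ∃ Λ : ℝ, 0 ≤ Λ ∧ 2 * a + 1 ≤ (1 + Λ) * ε :=
    ⟨(2 * a + 1) / ε, by positivity, by rw [add_mul, div_mul_cancel₀ _ hε.ne']; linarith⟩
  set f : ℕ → ℕ → (Fin r → ℝ) → (Fin r → ℝ) :=
    fun j i => expand v ((i / (j + 1) : ℝ) * Λ) with hf
  have hfar' : ∀ j i, ∀ ε, ∀ x ∈ farFrom (Metric.closedBall (0 : Fin r → ℝ) a) ε,
      f j i x ∈ farFrom (Metric.closedBall 0 a) ε :=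
    fun j i ε x hx => expand_far (by positivity) hv hx
  have hs1 : ∀ j i : ℕ, i ≤ j + 1 → (i / (j + 1) : ℝ) * Λ ≤ Λ := by
    intro j i hi
    refine mul_le_of_le_one_left hΛ0 (div_le_one_of_le₀ (by exact_mod_cast hi) (by positivity))
  have hend : ∀ j, f j (j + 1) = expand v Λ := by
    intro j
    have : ((j + 1 : ℕ) / (j + 1) : ℝ) = 1 := by push_cast; exact div_self (by positivity)
    simp only [hf, this, one_mul]
  set P := spush k f fun j => j + 1
  set Φ := svmap k fun j => f j (j + 1) with hΦ
  have hPz : P z ∈ smallDeg k Set.univ (n + 1) := by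
    refine spush_smallDeg (A := X) (B := Set.univ) (fun _ _ _ _ _ => Set.mem_univ _)
      (fun ε hε => ?_) hz
    refine ⟨ε / (2 * (1 + Λ)), by positivity, ?_⟩
    have hC' : (0 : ℝ) < Λ * (|C| + a) + 1 := by positivity
    filter_upwards [inv_lt_of_large (ν := fun j => j) scale_ge
      (by positivity : 0 < ε / (2 * (Λ * (|C| + a) + 1)))] with j hj i i' h1 h2 h3 x hx y hy hxy
    refine lt_of_le_of_lt (dist_expand_le (Λ := Λ) (by positivity) (hs1 j i (by omega))) ?_
    have h4 : |(i / (j + 1) : ℝ) * Λ - (i' / (j + 1) : ℝ) * Λ| ≤ 1 / (j + 1) * Λ := by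
      rw [← sub_mul, ← sub_div, abs_mul, abs_div, abs_of_nonneg hΛ0,
        abs_of_pos (by positivity : (0 : ℝ) < j + 1)]
      refine mul_le_mul_of_nonneg_right (div_le_div_of_nonneg_right ?_ (by positivity)) hΛ0
      have h4 : (i : ℝ) ≤ i' := by exact_mod_cast h1
      have h5 : (i' : ℝ) ≤ i + 1 := by exact_mod_cast h2
      rw [abs_le]; constructor <;> linarith
    have h5 : ‖y - v‖ ≤ |C| + a := by
      refine (norm_sub_le _ _).trans (add_le_add ((hC y hy).trans (le_abs_self C)) ?_)
      simpa using hv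
    have h6 : |(i / (j + 1) : ℝ) * Λ - (i' / (j + 1) : ℝ) * Λ| * ‖y - v‖ ≤
        1 / (j + 1) * (Λ * (|C| + a)) := by
      rw [← mul_assoc]
      exact mul_le_mul h4 h5 (norm_nonneg _) (by positivity)
    have h7 : 1 / ((j : ℝ) + 1) * (Λ * (|C| + a)) < ε / 2 := by
      rw [lt_div_iff₀ (by positivity)] at hj
      have : (0 : ℝ) < 1 / (j + 1) := by positivity
      nlinarith
    have h8 : (1 + Λ) * dist x y < ε / 2 := by
      rw [lt_div_iff₀ (by positivity)] at hxy
      linarith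
    linarith
  have hPd : P (sbd k _ z) ∈ null k (Metric.closedBall 0 a) :=
    spush_null (A := Set.univ) (fun ε hε => ⟨ε, hε, Eventually.of_forall fun j i _ x _ hx =>
      hfar' j i ε x hx⟩) (fun j => supported_mono (s := Set.univ) (t := listsIn Set.univ)
        (fun _ _ a _ => Set.mem_univ a) (mem_supported_univ _)) hdz
  have hΦw : Φ w ∈ smallDeg k Set.univ (n + 1) := by
    refine svmap_smallDeg (A := Set.univ) (B := Set.univ) (fun _ _ _ => Set.mem_univ _)
      (fun ε hε => ?_) hw
    refine ⟨ε / (1 + Λ), by positivity, Eventually.of_forall fun j x _ y _ hxy => ?_⟩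
    simp only [hend]
    refine lt_of_le_of_lt (dist_expand_le hΛ0 le_rfl) ?_
    rw [sub_self, abs_zero, zero_mul, add_zero]
    rw [lt_div_iff₀ (by positivity)] at hxy
    linarith
  have hΦn : Φ (z - sbd k _ w) ∈ null k (Metric.closedBall 0 a) := by
    refine ⟨1, one_pos, hfar.mono fun j hj => vmap_mem (f := f j (j + 1)) (fun x hx => ?_) hj⟩
    intro u hu
    simp only [hend]
    have h1 := hx v rfl
    have h2 : ‖expand v Λ x - v‖ = (1 + Λ) * dist x v := by
      rw [expand, add_sub_cancel_left, norm_smul, Real.norm_of_nonneg (by positivity),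
        dist_eq_norm]
    have h3 : (2 * a + 1) ≤ dist (expand v Λ x) v := by
      rw [dist_eq_norm, h2]
      exact hΛ.trans (mul_le_mul_of_nonneg_left h1 (by positivity))
    have h4 := dist_triangle (expand v Λ x) u v
    have h5 := dist_triangle_right u v 0
    rw [Metric.mem_closedBall] at hu hv
    linarith
  refine ⟨Φ w - P z, sub_mem hΦw hPz, ?_⟩
  have h1 := spush_homotopy f (fun j => j + 1) z
  have h4 : seqMap (fun j => vmap k (f j 0)) z = z :=
    svmap_id (fun j x => by simp [hf, expand]) z
  rw [h4] at h1
  have h2 : sbd k _ (P z) + P (sbd k _ z) = Φ z - z := h1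
  have h3 : sbd k _ (Φ w) = Φ (sbd k _ w) := sbd_svmap _ _
  rw [map_sub] at hΦn
  have := sub_mem hΦn hPd
  convert this using 1
  rw [map_sub, h3, ← sub_eq_zero]
  have h5 : z = Φ z - (sbd k _ (P z) + P (sbd k _ z)) := by rw [h2]; abel
  nth_rewrite 1 [h5]
  abel

/-- Local injectivity: near the origin, a relative cycle which bounds at one point bounds. -/
lemma mem_bdr_of_bounds_at {X : Set (Fin r → ℝ)} (hX : X ∈ 𝓝 0) (hXb : Bornology.IsBounded X)
    {n : ℕ} {z : Seq k (Fin r → ℝ)} (hz : z ∈ smallDeg k X n) (hdz : sbd k _ z ∈ null k {0}) :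
    ∃ a > 0, ∀ v ∈ Metric.closedBall 0 a, ∀ w ∈ smallDeg k X (n + 1),
      z - sbd k _ w ∈ null k {v} → z ∈ bdr (sbd k _) (null k {0}) (smallDeg k X) n := by
  obtain ⟨ε, hε, hd⟩ := hdz
  refine ⟨ε / 2, by positivity, fun v hv w hw hzw => ?_⟩
  have hd' : sbd k _ z ∈ null k (Metric.closedBall (0 : Fin r → ℝ) (ε / 2)) := by
    refine ⟨ε / 2, by positivity, hd.mono fun j hj => supported_mono (listsIn_mono ?_) hj⟩
    intro x hx u hu
    have h1 := hx 0 rfl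
    have h2 := dist_triangle x u 0
    rw [Metric.mem_closedBall] at hu
    linarith
  obtain ⟨w', hw', h⟩ := bounds_of_bounds_at hXb hv hz hd'
    (smallDeg_mono (Set.subset_univ _) _ hw) hzw
  have h0 : z - sbd k _ w' ∈ null k {0} :=
    null_anti (by simpa using (by positivity : 0 ≤ ε / 2)) h
  refine mem_bdr.2 ⟨srs k (listsIn X) w', ?_, ?_⟩
  · have := srs_listsIn (A := X) hw'
    rwa [Set.univ_inter] at this
  · have := add_mem h0 (sbd_null (sub_srs_null hX hw'.1))
    convert this using 1
    rw [map_sub]; abel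

end LocalInjectivity

end

section

section GroupRing

lemma one_sub_pow_pred {p : ℕ} [Fact p.Prime] {A : Type*} [Ring A] [Algebra (ZMod p) A] (x : A) :
    (1 - x) ^ (p - 1) = ∑ i ∈ Finset.range p, x ^ i := by
  have hp : p.Prime := Fact.out
  have h : (1 - Polynomial.X : Polynomial (ZMod p)) ^ (p - 1) =
      ∑ i ∈ Finset.range p, Polynomial.X ^ i := by
    have h0 : (1 - Polynomial.X : Polynomial (ZMod p)) ≠ 0 := by
      rw [← neg_ne_zero, neg_sub, ← Polynomial.C_1]
      exact Polynomial.X_sub_C_ne_zero 1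
    refine mul_right_cancel₀ h0 ?_
    rw [← pow_succ, Nat.sub_add_cancel hp.one_le, geom_sum_mul_neg, sub_pow_expChar, one_pow]
  have := congrArg (Polynomial.aeval x) h
  simpa using this

/-- Sums over a cyclic group of prime order as sums over an interval. -/
lemma sum_zmod_eq_sum_range {p : ℕ} [Fact p.Prime] {A : Type*} [AddCommMonoid A]
    (f : ZMod p → A) : ∑ j, f j = ∑ i ∈ Finset.range p, f i := by
  have hp : p.Prime := Fact.out
  have : NeZero p := ⟨hp.ne_zero⟩
  symm
  refine Finset.sum_bij (fun i _ => (i : ZMod p)) (fun _ _ => Finset.mem_univ _) ?_ ?_ ?_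
  · intro a ha b hb hab
    rw [Finset.mem_range] at ha hb
    have := congrArg ZMod.val hab
    rwa [ZMod.val_cast_of_lt ha, ZMod.val_cast_of_lt hb] at this
  · intro b _
    exact ⟨b.val, Finset.mem_range.2 (ZMod.val_lt b), ZMod.natCast_zmod_val b⟩
  · intros; rfl

end GroupRing

section Orbits

/-- A fundamental domain for the translations by multiples of `b`, invariant under `a`, on the
part of a set where no combination of `a` and `b` involving `b` fixes a point. -/
lemma exists_fundamental_domain {p : ℕ} [Fact p.Prime] {V T : Type*} [AddCommGroup V]
    [Module (ZMod p) V] {α : V → T → T} (h0 : ∀ x, α 0 x = x)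
    (hadd : ∀ u v x, α (u + v) x = α u (α v x)) (a b : V) :
    ∃ D : Set T, (∀ x, α a x ∈ D ↔ x ∈ D) ∧
      (∀ x ∈ D, ∀ i j : ZMod p, α (i • a + j • b) x = x → j = 0) ∧
      ∀ x, (∀ i j : ZMod p, α (i • a + j • b) x = x → j = 0) →
        ∃! j : ZMod p, α (j • b) x ∈ D := by
  let S : Setoid T :=
    { r := fun x y => ∃ i j : ZMod p, y = α (i • a + j • b) x
      iseqv :=
        { refl := fun x => ⟨0, 0, by simp [h0]⟩
          symm := by
            rintro x y ⟨i, j, rfl⟩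
            refine ⟨-i, -j, ?_⟩
            rw [← hadd, show (-i • a + -j • b + (i • a + j • b)) = 0 by module, h0]
          trans := by
            rintro x y z ⟨i, j, rfl⟩ ⟨i', j', rfl⟩
            refine ⟨i' + i, j' + j, ?_⟩
            rw [← hadd]; congr 1; module } }
  let rep : T → T := fun x => (Quotient.mk S x).out
  have hrep : ∀ x, ∃ i j : ZMod p, rep x = α (i • a + j • b) x := fun x =>
    S.symm (Quotient.exact (Quotient.out_eq (Quotient.mk S x)))
  have hrepα : ∀ i j : ZMod p, ∀ x, rep (α (i • a + j • b) x) = rep x := fun i j x =>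
    congrArg Quotient.out (Quotient.sound (S.symm ⟨i, j, rfl⟩))
  have hfree : ∀ i j : ZMod p, ∀ x, (∀ i j : ZMod p, α (i • a + j • b) x = x → j = 0) →
      ∀ i' j' : ZMod p, α (i' • a + j' • b) (α (i • a + j • b) x) = α (i • a + j • b) x →
        j' = 0 := by
    intro i j x hx i' j' h
    refine hx i' j' ?_
    have := congrArg (α (-i • a + -j • b)) h
    rw [← hadd, ← hadd, ← hadd,
      show -i • a + -j • b + (i' • a + j' • b) + (i • a + j • b) = i' • a + j' • b by module,
      show -i • a + -j • b + (i • a + j • b) = 0 by module, h0] at this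
    exact this
  refine ⟨{x | (∀ i j : ZMod p, α (i • a + j • b) x = x → j = 0) ∧
    ∃ i : ZMod p, x = α (i • a) (rep x)}, ?_, fun x hx => hx.1, ?_⟩
  · intro x
    have ha : a = (1 : ZMod p) • a + (0 : ZMod p) • b := by module
    have ha' : ∀ x, x = α ((-1 : ZMod p) • a + (0 : ZMod p) • b) (α a x) := by
      intro x
      rw [← hadd, show ((-1 : ZMod p) • a + (0 : ZMod p) • b + a) = 0 by module, h0]
    have hr : rep (α a x) = rep x := by
      have := hrepα 1 0 x
      rwa [← ha] at this
    constructor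
    · rintro ⟨h1, i, h2⟩
      refine ⟨?_, i - 1, ?_⟩
      · rw [ha' x]; exact hfree _ _ _ h1
      · rw [hr] at h2
        conv_lhs => rw [ha' x, h2, ← hadd]
        congr 1; module
    · rintro ⟨h1, i, h2⟩
      refine ⟨?_, i + 1, ?_⟩
      · have := hfree 1 0 x h1
        rwa [← ha] at this
      · rw [hr]
        conv_lhs => rw [h2, ← hadd]
        congr 1; module
  · intro x hx
    obtain ⟨i, j, hij⟩ := hrep x
    have hb : ∀ j : ZMod p, j • b = (0 : ZMod p) • a + j • b := fun j => by module
    have hr : ∀ j : ZMod p, rep (α (j • b) x) = rep x := fun j => by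
      rw [hb j]; exact hrepα _ _ _
    refine ⟨j, ⟨?_, -i, ?_⟩, ?_⟩
    · rw [hb j]; exact hfree _ _ _ hx
    · rw [hr, hij, ← hadd]; congr 1; module
    · rintro j' ⟨-, i', h⟩
      rw [hr, hij, ← hadd] at h
      have := congrArg (α (-j' • b)) h
      rw [← hadd, ← hadd, show -j' • b + j' • b = 0 by module, h0] at this
      have h2 := hx (i' + i) (-j' + j) (by
        conv_rhs => rw [this]
        congr 1; module)
      rw [neg_add_eq_zero] at h2
      exact h2

end Orbits

section RestrictionMaps

variable {k : Type*} [Field k] {E : Type*}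

lemma rs_vmap {s : Set (List E)} (f : E → E) (c : List E →₀ k) :
    rs k s (vmap k f c) = vmap k f (rs k {l | l.map f ∈ s} c) := by
  refine LinearMap.congr_fun (chain_hom_ext (f := rs k s ∘ₗ vmap k f)
    (g := vmap k f ∘ₗ rs k {l | l.map f ∈ s}) fun l => ?_) c
  rw [LinearMap.comp_apply, LinearMap.comp_apply, vmap_single]
  by_cases h : l.map f ∈ s
  · rw [rs_single_of_mem h, rs_single_of_mem (s := {l | l.map f ∈ s}) h, vmap_single]
  · rw [rs_single_of_notMem h, rs_single_of_notMem (s := {l | l.map f ∈ s}) h, map_zero]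

lemma rs_rs (s t : Set (List E)) (c : List E →₀ k) : rs k s (rs k t c) = rs k (s ∩ t) c := by
  refine LinearMap.congr_fun (chain_hom_ext (f := rs k s ∘ₗ rs k t) (g := rs k (s ∩ t))
    fun l => ?_) c
  rw [LinearMap.comp_apply]
  by_cases ht : l ∈ t
  · rw [rs_single_of_mem ht]
    by_cases hs : l ∈ s
    · rw [rs_single_of_mem hs, rs_single_of_mem (s := s ∩ t) ⟨hs, ht⟩]
    · rw [rs_single_of_notMem hs, rs_single_of_notMem (s := s ∩ t) fun h => hs h.1]
  · rw [rs_single_of_notMem ht, rs_single_of_notMem (s := s ∩ t) fun h => ht h.2, map_zero]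

lemma rs_comm (s t : Set (List E)) (c : List E →₀ k) :
    rs k s (rs k t c) = rs k t (rs k s c) := by
  rw [rs_rs, rs_rs, Set.inter_comm]

end RestrictionMaps

end

section

section RelNull

variable {k : Type*} [Field k] {E : Type*} [PseudoMetricSpace E]

/-- Sequences of chains which are null up to simplices in `Λ`. -/
noncomputable def relNull (k : Type*) [Field k] {E : Type*} [PseudoMetricSpace E] (D : Set E)
    (Λ : Set (List E)) : Submodule k (Seq k E) :=
  (null k D).comap (LinearMap.id - srs k Λ)

lemma mem_relNull {D : Set E} {Λ : Set (List E)} {c : Seq k E} :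
    c ∈ relNull k D Λ ↔ c - srs k Λ c ∈ null k D := Iff.rfl

lemma null_le_relNull (D : Set E) (Λ : Set (List E)) : null k D ≤ relNull k D Λ :=
  fun _ hc => sub_mem hc (srs_null _ hc)

lemma relNull_empty (D : Set E) : relNull k D ∅ = null k D := by
  ext c
  have : srs k ∅ c = 0 := by
    funext j
    exact rs_eq_zero (s := ∅) (t := Set.univ) (Set.disjoint_empty _) (mem_supported_univ _)
  rw [mem_relNull, this, sub_zero]

lemma mem_relNull_of_supported {D : Set E} {Λ : Set (List E)} {c : Seq k E}
    (h : ∀ j, c j ∈ Finsupp.supported k k Λ) : c ∈ relNull k D Λ := by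
  rw [mem_relNull, srs_of_forall h, sub_self]; exact zero_mem _

lemma srs_supported {E : Type*} (Λ : Set (List E)) (c : Seq k E) (j : ℕ) :
    srs k Λ c j ∈ Finsupp.supported k k Λ :=
  supported_mono Set.inter_subset_right (rs_mem_inter Λ Set.univ (mem_supported_univ (c j)))

lemma srs_relNull {D : Set E} {Λ : Set (List E)} (s : Set (List E)) {c : Seq k E}
    (hc : c ∈ relNull k D Λ) : srs k s c ∈ relNull k D Λ := by
  have := srs_null s hc
  rw [mem_relNull]
  convert this using 1
  rw [LinearMap.sub_apply, LinearMap.id_apply, map_sub]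
  congr 1
  exact funext fun j => rs_comm _ _ _

/-- An operator preserving null chains and chains on `Λ` preserves relatively null chains. -/
lemma map_relNull {D : Set E} {Λ : Set (List E)} {T : ℕ → (List E →₀ k) →ₗ[k] (List E →₀ k)}
    (hΛ : ∀ j, ∀ l ∈ Λ, T j (Finsupp.single l 1) ∈ Finsupp.supported k k Λ) {c : Seq k E}
    (hc : c ∈ relNull k D Λ) (h : c - srs k Λ c ∈ null k D → seqMap T (c - srs k Λ c) ∈ null k D) :
    seqMap T c ∈ relNull k D Λ := by
  have h1 := null_le_relNull D Λ (h hc)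
  have h2 : seqMap T (srs k Λ c) ∈ relNull k D Λ :=
    mem_relNull_of_supported fun j => map_supported (hΛ j) (srs_supported Λ c j)
  have := add_mem h1 h2
  rwa [← map_add, sub_add_cancel] at this

lemma sbd_relNull {D : Set E} {Λ : Set (List E)}
    (hΛ : ∀ l ∈ Λ, bd k E (Finsupp.single l 1) ∈ Finsupp.supported k k Λ) {c : Seq k E}
    (hc : c ∈ relNull k D Λ) : sbd k E c ∈ relNull k D Λ :=
  map_relNull (fun _ => hΛ) hc sbd_null

end RelNull

/-- An action of `V` on a compact neighbourhood of the origin of `ℝ^r`, fixing the origin. -/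
structure LocalModel (r : ℕ) (V : Type) [AddCommGroup V] where
  /-- the neighbourhood -/
  X : Set (Fin r → ℝ)
  /-- the action, extended by the identity -/
  ρ : V → (Fin r → ℝ) → (Fin r → ℝ)
  compact : IsCompact X
  nhds : X ∈ 𝓝 0
  zero : ∀ x, ρ 0 x = x
  add : ∀ u v x, ρ (u + v) x = ρ u (ρ v x)
  maps : ∀ v, ∀ x ∈ X, ρ v x ∈ X
  cont : ∀ v, ContinuousOn (ρ v) X
  fix0 : ∀ v, ρ v 0 = 0

namespace LocalModel

variable {p r : ℕ} [Fact p.Prime] {V : Type} [AddCommGroup V] (L : LocalModel r V)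

/-- The points of the model fixed by a set of group elements. -/
def fix (S : Set V) : Set (Fin r → ℝ) := {x | x ∈ L.X ∧ ∀ h ∈ S, L.ρ h x = x}

lemma fix_subset (S : Set V) : L.fix S ⊆ L.X := fun _ hx => hx.1

lemma fix_anti {S T : Set V} (h : S ⊆ T) : L.fix T ⊆ L.fix S :=
  fun _ hx => ⟨hx.1, fun s hs => hx.2 s (h hs)⟩

lemma fix_empty : L.fix ∅ = L.X := by
  ext x; simp [fix]

lemma zero_mem_fix (S : Set V) : (0 : Fin r → ℝ) ∈ L.fix S :=
  ⟨mem_of_mem_nhds L.nhds, fun _ _ => L.fix0 _⟩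

lemma ρ_comm (u v : V) (x : Fin r → ℝ) : L.ρ u (L.ρ v x) = L.ρ v (L.ρ u x) := by
  rw [← L.add, ← L.add, add_comm]

lemma ρ_neg (v : V) (x : Fin r → ℝ) : L.ρ (-v) (L.ρ v x) = x := by
  rw [← L.add, neg_add_cancel, L.zero]

lemma ρ_injective (v : V) : Function.Injective (L.ρ v) := fun x y h => by
  rw [← L.ρ_neg v x, h, L.ρ_neg]

lemma maps_iff (v : V) (x : Fin r → ℝ) : L.ρ v x ∈ L.X ↔ x ∈ L.X :=
  ⟨fun h => by simpa [L.ρ_neg] using L.maps (-v) _ h, L.maps v x⟩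

lemma fix_maps (S : Set V) (v : V) (x : Fin r → ℝ) : L.ρ v x ∈ L.fix S ↔ x ∈ L.fix S := by
  unfold fix
  simp only [Set.mem_ofPred_eq, L.maps_iff]
  refine and_congr_right fun _ => forall₂_congr fun h _ => ?_
  rw [L.ρ_comm, (L.ρ_injective v).eq_iff]

lemma isClosed_fix (S : Set V) : IsClosed (L.fix S) := by
  have h : L.fix S = L.X ∩ ⋂ h ∈ S, {x | x ∈ L.X ∧ L.ρ h x = x} := by
    ext x
    simp only [fix, Set.mem_ofPred_eq, Set.mem_inter_iff, Set.mem_iInter]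
    exact ⟨fun hx => ⟨hx.1, fun s hs => ⟨hx.1, hx.2 s hs⟩⟩,
    fun hx => ⟨hx.1, fun s hs => (hx.2 s hs).2⟩⟩
  rw [h]
  refine L.compact.isClosed.inter (isClosed_biInter fun s _ => ?_)
  have := ContinuousOn.preimage_isClosed_of_isClosed (((L.cont s).prodMk continuousOn_id))
    L.compact.isClosed isClosed_diagonal
  exact this

lemma ρ_far (v : V) {ε : ℝ} (hε : 0 < ε) :
    ∃ δ > 0, ∀ x ∈ farFrom ({0} : Set (Fin r → ℝ)) ε, L.ρ v x ∈ farFrom {0} δ := by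
  have h := (L.cont (-v)).continuousAt L.nhds
  obtain ⟨δ, hδ, hb⟩ := Metric.continuousAt_iff.1 h ε hε
  refine ⟨δ, hδ, fun x hx y hy => ?_⟩
  rw [Set.mem_singleton_iff.1 hy]
  by_contra! hlt
  have := hb hlt
  rw [L.fix0, L.ρ_neg] at this
  exact absurd (hx 0 rfl) (not_le.2 this)

lemma uniform (v : V) {ε : ℝ} (hε : 0 < ε) :
    ∃ δ > 0, ∀ a ∈ L.X, ∀ b ∈ L.X, dist a b < δ → dist (L.ρ v a) (L.ρ v b) < ε :=
  Metric.uniformContinuousOn_iff.1 (L.compact.uniformContinuousOn_of_continuous (L.cont v)) ε hε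

variable (p)

/-- Sequences of chains in the ambient space. -/
abbrev Chains (r p : ℕ) [Fact p.Prime] : Type := Seq (ZMod p) (Fin r → ℝ)

/-- The induced action on sequences of chains. -/
noncomputable def act (v : V) : Module.End (ZMod p) (Chains r p) :=
  svmap (ZMod p) fun _ => L.ρ v

/-- Chains on the fixed point set of `S`. -/
noncomputable abbrev W (S : Set V) (n : ℕ) : Submodule (ZMod p) (Chains r p) :=
  smallDeg (ZMod p) (L.fix S) n

variable {p}

lemma act_apply (v : V) (c : Chains r p) (j : ℕ) :
    L.act p v c j = vmap (ZMod p) (L.ρ v) (c j) := rfl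

lemma act_zero (c : Chains r p) : L.act p 0 c = c := svmap_id (fun _ => L.zero) c

lemma act_add (u v : V) (c : Chains r p) : L.act p (u + v) c = L.act p u (L.act p v c) := by
  funext j
  rw [act_apply, act_apply, act_apply, vmap_vmap]
  congr 2
  funext x; exact L.add u v x

lemma act_sbd (v : V) (c : Chains r p) :
    L.act p v (sbd _ _ c) = sbd _ _ (L.act p v c) := (sbd_svmap _ _).symm

lemma act_null (v : V) {c : Chains r p} (hc : c ∈ null (ZMod p) {0}) :
    L.act p v c ∈ null (ZMod p) {0} := by
  refine svmap_null (A := Set.univ) (D := {0}) (fun ε hε => ?_) (fun j => ?_) hc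
  · obtain ⟨δ, hδ, h⟩ := L.ρ_far v hε
    exact ⟨δ, hδ, Eventually.of_forall fun _ a _ ha => h a ha⟩
  · exact supported_mono (s := Set.univ) (t := listsIn Set.univ)
      (fun _ _ a _ => Set.mem_univ a) (mem_supported_univ _)

lemma act_W (v : V) (S : Set V) (n : ℕ) {c : Chains r p} (hc : c ∈ L.W p S n) :
    L.act p v c ∈ L.W p S n := by
  refine svmap_smallDeg (A := L.fix S) (B := L.fix S) (fun _ a ha => (L.fix_maps S v a).2 ha)
    (fun ε hε => ?_) hc
  obtain ⟨δ, hδ, h⟩ := L.uniform v hε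
  exact ⟨δ, hδ, Eventually.of_forall fun _ a ha b hb => h a ha.1 b hb.1⟩

lemma map_eq_self {v : V} {l : List (Fin r → ℝ)} (h : ∀ a ∈ l, L.ρ v a = a) :
    l.map (L.ρ v) = l := by
  conv_rhs => rw [← List.map_id l]
  exact List.map_congr_left fun a ha => by rw [h a ha]; rfl

lemma map_eq_self_iff {v : V} {l : List (Fin r → ℝ)} :
    l.map (L.ρ v) = l ↔ ∀ a ∈ l, L.ρ v a = a := by
  refine ⟨fun h => ?_, L.map_eq_self⟩
  have := (List.map_inj_left (f := L.ρ v) (g := id)).1 (by rwa [List.map_id])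
  exact this

lemma act_of_fixed {v : V} {c : Chains r p}
    (hc : ∀ j, c j ∈ Finsupp.supported (ZMod p) (ZMod p) {l | l.map (L.ρ v) = l}) :
    L.act p v c = c := by
  funext j
  refine eq_on_supported (f := vmap (ZMod p) (L.ρ v)) (g := LinearMap.id) (fun l hl => ?_) (hc j)
  rw [vmap_single, show l.map (L.ρ v) = l from hl]; rfl

lemma act_fix {v : V} {S : Set V} (hv : v ∈ S) {n : ℕ} {c : Chains r p} (hc : c ∈ L.W p S n) :
    L.act p v c = c :=
  L.act_of_fixed fun j => supported_mono
    (fun _ hl => L.map_eq_self fun a ha => (hl a ha).2 v hv) (hc.1.1 j)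

lemma srs_act {s : Set (List (Fin r → ℝ))} {v : V} (hs : ∀ l, l.map (L.ρ v) ∈ s ↔ l ∈ s)
    (c : Chains r p) : srs _ s (L.act p v c) = L.act p v (srs _ s c) := by
  funext j
  show rs _ s (vmap _ _ (c j)) = vmap _ _ (rs _ s (c j))
  rw [rs_vmap, show {l : List (Fin r → ℝ) | l.map (L.ρ v) ∈ s} = s from Set.ext hs]

lemma act_relNull (v : V) {Λ : Set (List (Fin r → ℝ))}
    (hΛ : ∀ l ∈ Λ, l.map (L.ρ v) ∈ Λ) {c : Chains r p}
    (hc : c ∈ relNull (ZMod p) {0} Λ) : L.act p v c ∈ relNull (ZMod p) {0} Λ :=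
  map_relNull (fun _ l hl => vmap_single_mem (hΛ l hl)) hc (L.act_null v)

lemma sph (p) [Fact p.Prime] (L : LocalModel r V) :
    Sph (sbd (ZMod p) (Fin r → ℝ)) (null _ {0}) (L.W p ∅) (r + 1) := by
  unfold W
  rw [fix_empty]; exact sph_nhds L.nhds

end LocalModel

end

section

namespace LocalModel

variable {p r : ℕ} [Fact p.Prime] {V : Type} [AddCommGroup V] (L : LocalModel r V)

/-- The difference operator of `b`. -/
noncomputable def sig (p : ℕ) [Fact p.Prime] {V : Type} [AddCommGroup V]
    (L : LocalModel r V) (b : V) : Module.End (ZMod p) (Chains r p) := 1 - L.act p b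

lemma sig_apply (b : V) (c : Chains r p) : L.sig p b c = c - L.act p b c := rfl

lemma act_commute (u v : V) (c : Chains r p) :
    L.act p u (L.act p v c) = L.act p v (L.act p u c) := by
  rw [← L.act_add, ← L.act_add, add_comm]

/-- A submodule stable under the action is stable under the difference operators. -/
lemma sig_mem {Y : Submodule (ZMod p) (Chains r p)} (hY : ∀ v, ∀ y ∈ Y, L.act p v y ∈ Y) (b : V)
    {y : Chains r p} (hy : y ∈ Y) : L.sig p b y ∈ Y := sub_mem hy (hY b y hy)

variable [Module (ZMod p) V]

/-- The norm operator of `b`. -/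
noncomputable def nrm (p : ℕ) [Fact p.Prime] {V : Type} [AddCommGroup V]
    [Module (ZMod p) V] (L : LocalModel r V) (b : V) : Module.End (ZMod p) (Chains r p) :=
  ∑ j : ZMod p, L.act p (j • b)

lemma nrm_apply (b : V) (c : Chains r p) : L.nrm p b c = ∑ j : ZMod p, L.act p (j • b) c := by
  rw [nrm, LinearMap.sum_apply]

lemma act_pow (b : V) (i : ℕ) : L.act p ((i : ZMod p) • b) = L.act p b ^ i := by
  induction i with
  | zero => refine LinearMap.ext fun c => ?_; simp [L.act_zero]
  | succ i ih =>
    refine LinearMap.ext fun c => ?_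
    rw [pow_succ', Module.End.mul_apply, ← ih, ← L.act_add]
    congr 2; push_cast; module

lemma sig_pow_pred (b : V) : L.sig p b ^ (p - 1) = L.nrm p b := by
  refine (one_sub_pow_pred (p := p) (L.act p b)).trans ?_
  rw [nrm, sum_zmod_eq_sum_range]
  exact Finset.sum_congr rfl fun i _ => (L.act_pow b i).symm

lemma sig_nrm (b : V) (c : Chains r p) : L.sig p b (L.nrm p b c) = 0 := by
  rw [sig_apply, nrm_apply, map_sum, sub_eq_zero]
  symm
  refine Fintype.sum_equiv (Equiv.addRight 1) _ _ fun j => ?_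
  rw [← L.act_add]
  congr 2
  simp only [Equiv.coe_addRight]; module

lemma nrm_act (b v : V) (c : Chains r p) :
    L.nrm p b (L.act p v c) = L.act p v (L.nrm p b c) := by
  rw [nrm_apply, nrm_apply, map_sum]
  exact Finset.sum_congr rfl fun _ _ => L.act_commute _ _ _

lemma sig_nrm_comm (a b : V) (c : Chains r p) :
    L.sig p a (L.nrm p b c) = L.nrm p b (L.sig p a c) := by
  rw [sig_apply, sig_apply, map_sub, nrm_act]

lemma nrm_nrm (a b : V) (c : Chains r p) :
    L.nrm p a (L.nrm p b c) = L.nrm p b (L.nrm p a c) := by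
  rw [L.nrm_apply b, L.nrm_apply b, map_sum]
  exact Finset.sum_congr rfl fun _ _ => L.nrm_act _ _ _

lemma sig_pow (b : V) (c : Chains r p) : (L.sig p b ^ p) c = 0 := by
  have hp : p.Prime := Fact.out
  have h : L.sig p b ^ p = L.sig p b * L.nrm p b := by
    rw [← sig_pow_pred, ← pow_succ', Nat.sub_add_cancel hp.one_le]
  rw [h, Module.End.mul_apply, sig_nrm]

lemma nrm_sig (b : V) (c : Chains r p) : L.nrm p b (L.sig p b c) = 0 := by
  rw [← sig_nrm_comm, sig_nrm]

lemma nrm_mem {Y : Submodule (ZMod p) (Chains r p)} (hY : ∀ v, ∀ y ∈ Y, L.act p v y ∈ Y) (b : V)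
    {y : Chains r p} (hy : y ∈ Y) : L.nrm p b y ∈ Y := by
  rw [nrm_apply]; exact sum_mem fun j _ => hY _ y hy

/-- Simplices fixed by some combination of `a` and `b` involving `b`. -/
def bad (a b : V) : Set (List (Fin r → ℝ)) :=
  {l | ∃ i j : ZMod p, j ≠ 0 ∧ l.map (L.ρ (i • a + j • b)) = l}

lemma exists_domain (a b : V) : ∃ D : Set (List (Fin r → ℝ)),
    (∀ c, srs _ D (L.act p a c) = L.act p a (srs _ D c)) ∧
    ∀ c : Chains r p, c = srs _ (L.bad (p := p) a b) c +
      ∑ j : ZMod p, L.act p (j • b) (srs _ D (L.act p (-(j • b)) c)) := by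
  have hmap : ∀ u v : V, ∀ l : List (Fin r → ℝ),
      l.map (L.ρ (u + v)) = (l.map (L.ρ v)).map (L.ρ u) := by
    intro u v l
    rw [List.map_map]
    exact List.map_congr_left fun x _ => L.add u v x
  have hmap0 : ∀ l : List (Fin r → ℝ), l.map (L.ρ 0) = l := fun l =>
    L.map_eq_self fun x _ => L.zero x
  obtain ⟨D, hD1, hD2, hD3⟩ := exists_fundamental_domain (p := p)
    (α := fun v (l : List (Fin r → ℝ)) => l.map (L.ρ v)) hmap0 hmap a b
  refine ⟨D, fun c => L.srs_act hD1 c, fun c => ?_⟩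
  funext i
  rw [Pi.add_apply, Finset.sum_apply]
  let R : (List (Fin r → ℝ) →₀ ZMod p) →ₗ[ZMod p] (List (Fin r → ℝ) →₀ ZMod p) :=
    rs _ (L.bad (p := p) a b) +
      ∑ j : ZMod p, vmap _ (L.ρ (j • b)) ∘ₗ rs _ D ∘ₗ vmap _ (L.ρ (-(j • b)))
  have hR : LinearMap.id = R := by
    refine chain_hom_ext fun l => ?_
    have hterm : ∀ j : ZMod p, (vmap (ZMod p) (L.ρ (j • b)) ∘ₗ rs _ D ∘ₗ
        vmap _ (L.ρ (-(j • b)))) (Finsupp.single l 1) =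
        rs _ {l | l.map (L.ρ (-(j • b))) ∈ D} (Finsupp.single l 1) := by
      intro j
      rw [LinearMap.comp_apply, LinearMap.comp_apply, rs_vmap, vmap_vmap]
      have : L.ρ (j • b) ∘ L.ρ (-(j • b)) = fun x => x := by
        funext x
        rw [Function.comp_apply, ← L.add, add_neg_cancel, L.zero]
      rw [this, vmap_id]
    simp only [R, LinearMap.add_apply, LinearMap.sum_apply, LinearMap.id_apply]
    rw [Finset.sum_congr rfl fun j _ => hterm j]
    by_cases hl : l ∈ L.bad (p := p) a b
    · rw [rs_single_of_mem hl, Finset.sum_eq_zero, add_zero]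
      intro j _
      refine rs_single_of_notMem fun h => ?_
      obtain ⟨i', j', hj', hfix⟩ := hl
      refine hj' (hD2 _ h i' j' ?_)
      show (l.map _).map _ = l.map _
      rw [← hmap, add_comm, hmap, hfix]
    · have hfree : ∀ i j : ZMod p, l.map (L.ρ (i • a + j • b)) = l → j = 0 := by
        intro i j h
        by_contra hj
        exact hl ⟨i, j, hj, h⟩
      obtain ⟨j, hj, hu⟩ := hD3 l hfree
      rw [rs_single_of_notMem hl, zero_add, Finset.sum_eq_single (-j)]
      · rw [rs_single_of_mem]
        show l.map (L.ρ (-(-j • b))) ∈ D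
        rw [neg_smul, neg_neg]; exact hj
      · intro j' _ hj'
        refine rs_single_of_notMem fun h => hj' ?_
        have := hu (-j') (by
          show l.map (L.ρ (-j' • b)) ∈ D
          rw [neg_smul]; exact h)
        rw [← this, neg_neg]
      · intro h; exact absurd (Finset.mem_univ _) h
  have := LinearMap.congr_fun hR (c i)
  simp only [R, LinearMap.add_apply, LinearMap.sum_apply, LinearMap.comp_apply,
    LinearMap.id_apply] at this
  exact this

variable {L} {U : Submodule (ZMod p) (Chains r p)} {D : Set (List (Fin r → ℝ))} {b : V}
  {c f : Chains r p}

lemma ker_sig (hU : ∀ v, ∀ y ∈ U, L.act p v y ∈ U) (hUs : ∀ y ∈ U, srs _ D y ∈ U)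
    (hc : c = f + ∑ j : ZMod p, L.act p (j • b) (srs _ D (L.act p (-(j • b)) c)))
    (h : L.sig p b c ∈ U) : c - (L.nrm p b (srs _ D c) + f) ∈ U := by
  have key : ∀ i : ℕ, c - L.act p ((i : ZMod p) • b) c ∈ U := by
    intro i
    induction i with
    | zero => simp [L.act_zero]
    | succ i ih =>
      have h1 := hU ((i : ZMod p) • b) _ h
      rw [sig_apply, map_sub, ← L.act_add] at h1
      have := add_mem ih h1
      rw [sub_add_sub_cancel] at this
      convert this using 4
      push_cast; module
  have key' : ∀ j : ZMod p, c - L.act p (-(j • b)) c ∈ U := by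
    intro j
    have := key (-j).val
    have hp : NeZero p := ⟨(Fact.out : p.Prime).ne_zero⟩
    rwa [ZMod.natCast_zmod_val, neg_smul] at this
  have e : c - (L.nrm p b (srs _ D c) + f) =
      -∑ j : ZMod p, L.act p (j • b) (srs _ D (c - L.act p (-(j • b)) c)) := by
    simp only [map_sub, Finset.sum_sub_distrib]
    rw [← nrm_apply]
    nth_rewrite 1 [hc]
    abel
  rw [e]
  exact neg_mem (sum_mem fun j _ => hU _ _ (hUs _ (key' j)))

lemma ker_nrm (hUs : ∀ y ∈ U, srs _ D y ∈ U) {Y : Submodule (ZMod p) (Chains r p)}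
    (hY : ∀ v, ∀ y ∈ Y, L.act p v y ∈ Y) (hYs : ∀ y ∈ Y, srs _ D y ∈ Y) (hcY : c ∈ Y)
    (hc : c = f + ∑ j : ZMod p, L.act p (j • b) (srs _ D (L.act p (-(j • b)) c)))
    (h : L.nrm p b c ∈ U) : ∃ w ∈ Y, c - (L.sig p b w + f) ∈ U := by
  have key : ∀ i : ℕ, ∀ y ∈ Y, ∃ w ∈ Y, L.act p ((i : ZMod p) • b) y = y + L.sig p b w := by
    intro i y hy
    induction i with
    | zero => exact ⟨0, zero_mem _, by simp [L.act_zero]⟩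
    | succ i ih =>
      obtain ⟨w, hw, h1⟩ := ih
      refine ⟨w - L.act p ((i : ZMod p) • b) y, sub_mem hw (hY _ _ hy), ?_⟩
      rw [map_sub, L.sig_apply b (L.act p _ y), ← L.act_add]
      rw [show b + (i : ZMod p) • b = ((i + 1 : ℕ) : ZMod p) • b by push_cast; module, h1]
      abel
  have key' : ∀ j : ZMod p, ∃ w ∈ Y, L.act p (j • b) (srs _ D (L.act p (-(j • b)) c)) =
      srs _ D (L.act p (-(j • b)) c) + L.sig p b w := by
    intro j
    have hp : NeZero p := ⟨(Fact.out : p.Prime).ne_zero⟩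
    have := key j.val _ (hYs _ (hY (-(j • b)) _ hcY))
    rwa [ZMod.natCast_zmod_val] at this
  choose w hw hw' using key'
  refine ⟨∑ j, w j, sum_mem fun j _ => hw j, ?_⟩
  have e : c - (L.sig p b (∑ j, w j) + f) = srs _ D (L.nrm p b c) := by
    have h1 : L.nrm p b c = ∑ j : ZMod p, L.act p (-(j • b)) c := by
      rw [nrm_apply]
      refine Fintype.sum_equiv (Equiv.neg _) _ _ fun j => ?_
      simp
    have h2 : c = f + ∑ j : ZMod p, (srs _ D (L.act p (-(j • b)) c) + L.sig p b (w j)) := by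
      rw [← Finset.sum_congr rfl fun j _ => hw' j]; exact hc
    rw [Finset.sum_add_distrib, ← map_sum, ← map_sum, ← h1] at h2
    nth_rewrite 1 [h2]
    abel
  rw [e]
  exact hUs _ h

end LocalModel

end

section

section Sorting

variable {k : Type*} [Field k] {I : Type*} (col : I → ℕ)

/-- Insertion of a vertex in a simplex sorted by colour. -/
noncomputable def insList (k : Type*) [Field k] {I : Type*} (col : I → ℕ) (x : I) :
    List I → (List I →₀ k)
  | [] => Finsupp.single [x] 1
  | y :: t => if col x < col y then Finsupp.single (x :: y :: t) 1 else
      if col x = col y then 0 else -cone k y (insList k col x t)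

/-- Insertion of a vertex in a chain of sorted simplices. -/
noncomputable def ins (k : Type*) [Field k] {I : Type*} (col : I → ℕ) (x : I) :
    (List I →₀ k) →ₗ[k] (List I →₀ k) :=
  Finsupp.linearCombination k (insList k col x)

/-- Sorting of a simplex by colour. -/
noncomputable def sortList (k : Type*) [Field k] {I : Type*} (col : I → ℕ) :
    List I → (List I →₀ k)
  | [] => Finsupp.single [] 1
  | x :: l => ins k col x (sortList k col l)

/-- Sorting of chains by colour. -/
noncomputable def sort (k : Type*) [Field k] {I : Type*} (col : I → ℕ) :
    (List I →₀ k) →ₗ[k] (List I →₀ k) :=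
  Finsupp.linearCombination k (sortList k col)

/-- Simplices with increasing colours. -/
def sorted (col : I → ℕ) : Set (List I) := {l | l.Pairwise fun a b => col a < col b}

/-- Simplices whose colours are greater than `n`. -/
def above (n : ℕ) : Set (List I) := listsIn {a | n < col a}

variable {col}

lemma ins_single (x : I) (l : List I) : ins k col x (Finsupp.single l 1) = insList k col x l := by
  simp [ins]

lemma sort_single (l : List I) : sort k col (Finsupp.single l 1) = sortList k col l := by
  simp [sort]

lemma sort_cone (x : I) (w : List I →₀ k) :
    sort k col (cone k x w) = ins k col x (sort k col w) := by
  refine LinearMap.congr_fun (chain_hom_ext (f := sort k col ∘ₗ cone k x)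
    (g := ins k col x ∘ₗ sort k col) fun l => ?_) w
  rw [LinearMap.comp_apply, LinearMap.comp_apply, cone_single, sort_single, sort_single]
  rfl

lemma ins_eq_cone {x : I} {w : List I →₀ k}
    (hw : w ∈ Finsupp.supported k k (above col (col x))) : ins k col x w = cone k x w := by
  refine eq_on_supported (fun l hl => ?_) hw
  rw [ins_single, cone_single]
  rcases l with _ | ⟨y, t⟩
  · rfl
  · have h : col x < col y := hl y (by simp)
    rw [insList, if_pos h]

lemma ins_cone_self {x : I} (w : List I →₀ k) : ins k col x (cone k x w) = 0 := by
  refine LinearMap.congr_fun (chain_hom_ext (f := ins k col x ∘ₗ cone k x) (g := 0) fun l => ?_) w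
  rw [LinearMap.comp_apply, cone_single, ins_single, insList, if_neg (lt_irrefl _), if_pos rfl]
  rfl

lemma ins_cone_of_lt {x y : I} (h : col y < col x) (w : List I →₀ k) :
    ins k col x (cone k y w) = -cone k y (ins k col x w) := by
  refine LinearMap.congr_fun (chain_hom_ext (f := ins k col x ∘ₗ cone k y)
    (g := -(cone k y ∘ₗ ins k col x)) fun l => ?_) w
  rw [LinearMap.comp_apply, cone_single, ins_single, insList, if_neg (by omega), if_neg (by omega),
    LinearMap.neg_apply, LinearMap.comp_apply, ins_single]

lemma bd_ins_single {A : Set I} (hA : Set.InjOn col A) {x : I} (hx : x ∈ A) {l : List I}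
    (hl : l ∈ listsIn A) (hs : l ∈ sorted col) :
    bd k I (ins k col x (Finsupp.single l 1)) =
      Finsupp.single l 1 - ins k col x (bd k I (Finsupp.single l 1)) := by
  induction l with
  | nil =>
    rw [ins_single, insList, bd_single_cons, bd_single_nil, map_zero, map_zero]
  | cons y t ih =>
    obtain ⟨h1, h2⟩ := List.pairwise_cons.1 hs
    have hyt : Finsupp.single t (1 : k) ∈ Finsupp.supported k k (above col (col y)) :=
      single_mem_supported fun a ha => h1 a ha
    rcases lt_trichotomy (col x) (col y) with h | h | h
    · have h3 : Finsupp.single (y :: t) (1 : k) ∈ Finsupp.supported k k (above col (col x)) := by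
        refine single_mem_supported fun a ha => ?_
        rcases List.mem_cons.1 ha with rfl | ha
        · exact h
        · exact h.trans (h1 a ha)
      rw [ins_eq_cone h3, ins_eq_cone (bd_mem h3), bd_cone]
    · obtain rfl : x = y := hA hx (hl y (by simp)) h
      rw [bd_single_cons, map_sub, ins_cone_self, sub_zero, ins_eq_cone hyt, ← cone_single,
        ins_cone_self, map_zero, sub_self]
    · have ih := ih (fun a ha => hl a (List.mem_cons_of_mem _ ha)) h2
      rw [← cone_single, ins_cone_of_lt h, map_neg, bd_cone, ih, bd_cone]
      simp only [map_sub, ins_cone_of_lt h]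
      abel

lemma ins_supported {A : Set I} {x : I} (hx : x ∈ A) {w : List I →₀ k}
    (hw : w ∈ Finsupp.supported k k (listsIn A)) :
    ins k col x w ∈ Finsupp.supported k k (listsIn A) := by
  refine map_supported (fun l hl => ?_) hw
  rw [ins_single]
  induction l with
  | nil => exact single_mem_supported fun a ha => by rwa [List.mem_singleton.1 ha]
  | cons y t ih =>
    rw [insList]
    split_ifs
    · refine single_mem_supported fun a ha => ?_
      rcases List.mem_cons.1 ha with rfl | ha
      · exact hx
      · exact hl a ha
    · exact zero_mem _
    · exact neg_mem (cone_mem (hl y (by simp)) (ih fun a ha => hl a (List.mem_cons_of_mem _ ha)))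

lemma ins_sorted {x : I} {w : List I →₀ k} (hw : w ∈ Finsupp.supported k k (sorted col)) :
    ins k col x w ∈ Finsupp.supported k k (sorted col) := by
  refine map_supported (fun l hl => ?_) hw
  induction l with
  | nil =>
    rw [ins_single]; exact single_mem_supported (List.pairwise_singleton _ _)
  | cons y t ih =>
    obtain ⟨h1, h2⟩ := List.pairwise_cons.1 hl
    have ih := ih h2
    rw [ins_single] at ih ⊢
    rw [insList]
    split_ifs with h h'
    · refine single_mem_supported (List.pairwise_cons.2 ⟨fun a ha => ?_, hl⟩)
      rcases List.mem_cons.1 ha with rfl | ha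
      · exact h
      · exact h.trans (h1 a ha)
    · exact zero_mem _
    · have h3 : insList k col x t ∈ Finsupp.supported k k (above col (col y)) := by
        rw [← ins_single]
        refine ins_supported (A := {a | col y < col a}) (show col y < col x by omega) ?_
        exact single_mem_supported fun a ha => h1 a ha
      refine neg_mem (map_supported (s := sorted col ∩ above col (col y)) (fun l hl => ?_)
        (mem_supported_inter ih h3))
      rw [cone_single]
      exact single_mem_supported (List.pairwise_cons.2 ⟨fun a ha => hl.2 a ha, hl.1⟩)

lemma ins_len {x : I} {n : ℕ} {w : List I →₀ k} (hw : w ∈ Finsupp.supported k k (listsLen I n)) :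
    ins k col x w ∈ Finsupp.supported k k (listsLen I (n + 1)) := by
  refine map_supported (fun l hl => ?_) hw
  rw [ins_single]
  clear hw
  induction l generalizing n with
  | nil =>
    refine single_mem_supported ?_
    obtain rfl : 0 = n := hl
    rfl
  | cons y t ih =>
    obtain rfl : t.length + 1 = n := hl
    rw [insList]
    split_ifs
    · exact single_mem_supported rfl
    · exact zero_mem _
    · exact neg_mem (cone_len (ih rfl))

lemma sort_supported {A : Set I} {w : List I →₀ k} (hw : w ∈ Finsupp.supported k k (listsIn A)) :
    sort k col w ∈ Finsupp.supported k k (listsIn A) := by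
  refine map_supported (fun l hl => ?_) hw
  rw [sort_single]
  induction l with
  | nil => exact single_mem_supported hl
  | cons y t ih =>
    exact ins_supported (hl y (by simp)) (ih fun a ha => hl a (List.mem_cons_of_mem _ ha))

lemma sort_sorted (w : List I →₀ k) : sort k col w ∈ Finsupp.supported k k (sorted col) := by
  refine map_supported (s := Set.univ) (fun l _ => ?_) (mem_supported_univ w)
  rw [sort_single]
  induction l with
  | nil => exact single_mem_supported List.Pairwise.nil
  | cons y t ih => exact ins_sorted (ih (Set.mem_univ _))

lemma sort_len {n : ℕ} {w : List I →₀ k} (hw : w ∈ Finsupp.supported k k (listsLen I n)) :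
    sort k col w ∈ Finsupp.supported k k (listsLen I n) := by
  refine map_supported (fun l hl => ?_) hw
  rw [sort_single]
  clear hw
  induction l generalizing n with
  | nil => exact single_mem_supported hl
  | cons y t ih =>
    obtain rfl : t.length + 1 = n := hl
    exact ins_len (ih rfl)

lemma bd_sort {A : Set I} (hA : Set.InjOn col A) {w : List I →₀ k}
    (hw : w ∈ Finsupp.supported k k (listsIn A)) :
    bd k I (sort k col w) = sort k col (bd k I w) := by
  refine eq_on_supported (f := bd k I ∘ₗ sort k col) (g := sort k col ∘ₗ bd k I)
    (fun l hl => ?_) hw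
  rw [LinearMap.comp_apply, LinearMap.comp_apply]
  induction l with
  | nil => rw [bd_single_nil, map_zero, sort_single, sortList, bd_single_nil]
  | cons y t ih =>
    have ht : t ∈ listsIn A := fun a ha => hl a (List.mem_cons_of_mem _ ha)
    have ih := ih ht
    have h1 := sort_supported (col := col) (single_mem_supported (R := k) ht)
    have h2 := sort_sorted (col := col) (Finsupp.single t (1 : k))
    have h3 : bd k I (ins k col y (sort k col (Finsupp.single t 1))) =
        sort k col (Finsupp.single t 1) -
          ins k col y (bd k I (sort k col (Finsupp.single t 1))) :=
      eq_on_supported (f := bd k I ∘ₗ ins k col y)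
        (g := LinearMap.id - ins k col y ∘ₗ bd k I)
        (fun l hl' => bd_ins_single hA (hl y (by simp)) hl'.1 hl'.2) (mem_supported_inter h1 h2)
    rw [← cone_single, sort_cone, h3, bd_cone, map_sub, sort_cone, ih]

lemma sort_vmap {h : I → I} (hh : ∀ i, col (h i) = col i) (w : List I →₀ k) :
    sort k col (vmap k h w) = vmap k h (sort k col w) := by
  have hins : ∀ x, ∀ w : List I →₀ k,
      ins k col (h x) (vmap k h w) = vmap k h (ins k col x w) := by
    intro x w
    refine LinearMap.congr_fun (chain_hom_ext (f := ins k col (h x) ∘ₗ vmap k h)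
      (g := vmap k h ∘ₗ ins k col x) fun l => ?_) w
    rw [LinearMap.comp_apply, LinearMap.comp_apply, vmap_single, ins_single, ins_single]
    induction l with
    | nil => rw [insList, vmap_single]; rfl
    | cons y t ih =>
      rw [List.map_cons, insList, insList, hh, hh]
      split_ifs
      · rw [vmap_single]; rfl
      · rw [map_zero]
      · rw [ih, map_neg, vmap_cone]
  refine LinearMap.congr_fun (chain_hom_ext (f := sort k col ∘ₗ vmap k h)
      (g := vmap k h ∘ₗ sort k col) fun l => ?_) w
  rw [LinearMap.comp_apply, LinearMap.comp_apply, vmap_single, sort_single, sort_single]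
  induction l with
  | nil => rw [List.map_nil, sortList, vmap_single]; rfl
  | cons y t ih => rw [List.map_cons, sortList, sortList, ih, hins]

/-- Chains of large degree with few colours are killed by sorting. -/
lemma sort_eq_zero {A : Set I} {N n : ℕ} (hA : ∀ a ∈ A, col a < N) (hn : N < n) {w : List I →₀ k}
    (hw : w ∈ Finsupp.supported k k (listsIn A)) (hw' : w ∈ Finsupp.supported k k (listsLen I n)) :
    sort k col w = 0 := by
  have h := mem_supported_inter (mem_supported_inter (sort_supported (col := col) hw)
    (sort_len (col := col) hw')) (sort_sorted (col := col) w)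
  have he : listsIn A ∩ listsLen I n ∩ sorted col = ∅ := by
    ext l
    simp only [Set.mem_inter_iff, Set.mem_empty_iff_false, iff_false]
    rintro ⟨⟨h1, h2⟩, h3⟩
    have h4 : (l.map col).Nodup := by
      refine List.Pairwise.map _ (fun a b hab => ?_) h3
      exact hab.ne
    have h5 : (l.map col).toFinset ⊆ Finset.range N := by
      intro m hm
      obtain ⟨a, ha, rfl⟩ := List.mem_map.1 (List.mem_toFinset.1 hm)
      exact Finset.mem_range.2 (hA a (h1 a ha))
    have h6 := Finset.card_le_card h5
    rw [List.toFinset_card_of_nodup h4, List.length_map, Finset.card_range] at h6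
    have h7 : l.length = n := h2
    omega
  rw [he] at h
  simpa using h

end Sorting

end

section

lemma exists_shift {J : Type*} [Fintype J] {N : ℕ} (hN : Fintype.card J ≤ N) (t : J → ℝ) :
    ∃ θ ≤ N, ∀ j, ∀ m : ℤ, 1 / (2 * ((N : ℝ) + 1)) ≤ |t j + θ / ((N : ℝ) + 1) - m| := by
  by_contra! h
  have h' : ∀ θ : Fin (N + 1), ∃ j, ∃ m : ℤ,
      |t j + (θ : ℕ) / ((N : ℝ) + 1) - m| < 1 / (2 * ((N : ℝ) + 1)) :=
    fun θ => h θ (Nat.lt_succ_iff.1 θ.2)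
  choose f m hm using h'
  have hinj : Function.Injective f := by
    intro a b hab
    have ha := hm a
    have hb := hm b
    rw [hab] at ha
    have hN0 : (0 : ℝ) < (N : ℝ) + 1 := by positivity
    have h1 : |((a : ℕ) : ℝ) / ((N : ℝ) + 1) - (b : ℕ) / ((N : ℝ) + 1) - (m a - m b)| <
        1 / ((N : ℝ) + 1) := by
      have e : ((a : ℕ) : ℝ) / ((N : ℝ) + 1) - (b : ℕ) / ((N : ℝ) + 1) - (m a - m b) =
          (t (f b) + (a : ℕ) / ((N : ℝ) + 1) - m a) - (t (f b) + (b : ℕ) / ((N : ℝ) + 1) - m b) := by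
        ring
      have e2 : 1 / ((N : ℝ) + 1) = 1 / (2 * ((N : ℝ) + 1)) + 1 / (2 * ((N : ℝ) + 1)) := by
        field_simp; norm_num
      rw [e, e2]
      exact (abs_sub _ _).trans_lt (add_lt_add ha hb)
    have h2 : |(((a : ℕ) : ℤ) - ((b : ℕ) : ℤ) - ((N : ℤ) + 1) * (m a - m b) : ℤ)| < 1 := by
      have h3 := mul_lt_mul_of_pos_right h1 hN0
      rw [one_div, inv_mul_cancel₀ hN0.ne', ← abs_of_pos hN0, ← abs_mul, abs_of_pos hN0] at h3
      have e : (((a : ℕ) : ℝ) / ((N : ℝ) + 1) - (b : ℕ) / ((N : ℝ) + 1) - (m a - m b)) *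
          ((N : ℝ) + 1) =
          ((((a : ℕ) : ℤ) - ((b : ℕ) : ℤ) - ((N : ℤ) + 1) * (m a - m b) : ℤ) : ℝ) := by
        push_cast; field_simp
      rw [e] at h3
      exact_mod_cast h3
    rw [Int.abs_lt_one_iff] at h2
    have h4 : ((N : ℤ) + 1) ∣ ((a : ℕ) : ℤ) - ((b : ℕ) : ℤ) := ⟨m a - m b, by linarith⟩
    have h5 := Int.eq_zero_of_abs_lt_dvd h4 (by
      rw [abs_lt]; have := a.2; have := b.2; omega)
    ext; omega
  have := Fintype.card_le_of_injective f hinj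
  rw [Fintype.card_fin] at this
  omega

/-- Index set of the cells of equivariant coverings. -/
abbrev Idx (V : Type) (r : ℕ) : Type := ℕ × (V → Fin r → ℤ)

/-- Translation of indices. -/
def shift {V : Type} [AddCommGroup V] {r : ℕ} (v : V) (i : Idx V r) : Idx V r :=
  (i.1, fun u => i.2 (u + v))

lemma shift_add {V : Type} [AddCommGroup V] {r : ℕ} (u v : V) (i : Idx V r) :
    shift (u + v) i = shift u (shift v i) := by
  refine Prod.ext rfl (funext fun w => ?_)
  show i.2 _ = i.2 _
  rw [add_assoc]

lemma shift_zero {V : Type} [AddCommGroup V] {r : ℕ} (i : Idx V r) : shift 0 i = i :=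
  Prod.ext rfl (funext fun w => by show i.2 _ = i.2 _; rw [add_zero])

/-- Extension of a map by equivariance. -/
lemma exists_equivariant {V I E : Type*} [AddCommGroup V] {α : V → I → I} {ρ : V → E → E}
    (hα0 : ∀ i, α 0 i = i) (hα : ∀ u v i, α (u + v) i = α u (α v i))
    (hρ : ∀ u v x, ρ (u + v) x = ρ u (ρ v x)) (y₀ : I → E)
    (hy : ∀ q h, α h q = q → ρ h (y₀ q) = y₀ q) :
    ∃ y : I → E, ∃ q : I → I, ∃ g : I → V, (∀ i, α (g i) (q i) = i) ∧
      (∀ i, y i = ρ (g i) (y₀ (q i))) ∧ ∀ v i, y (α v i) = ρ v (y i) := by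
  let s : Setoid I := ⟨fun i j => ∃ v, α v i = j, fun i => ⟨0, hα0 i⟩,
    fun {i j} ⟨v, hv⟩ => ⟨-v, by rw [← hv, ← hα, neg_add_cancel, hα0]⟩,
    fun {i j l} ⟨v, hv⟩ ⟨u, hu⟩ => ⟨u + v, by rw [hα, hv, hu]⟩⟩
  let q : I → I := fun i => (Quotient.mk s i).out
  have hq : ∀ i, ∃ v, α v (q i) = i := fun i => Quotient.mk_out (s := s) i
  choose g hg using hq
  refine ⟨fun i => ρ (g i) (y₀ (q i)), q, g, hg, fun _ => rfl, fun v i => ?_⟩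
  have e : q (α v i) = q i := by
    show (Quotient.mk s _).out = (Quotient.mk s _).out
    congr 1
    exact Quotient.sound (s := s) ⟨-v, by rw [← hα, neg_add_cancel, hα0]⟩
  show ρ (g (α v i)) (y₀ (q (α v i))) = ρ v (ρ (g i) (y₀ (q i)))
  have h1 : α (-(v + g i) + g (α v i)) (q i) = q i := by
    have := hg (α v i)
    rw [e] at this
    have h2 : α v i = α (v + g i) (q i) := by rw [hα, hg]
    rw [hα, this, h2, ← hα, neg_add_cancel, hα0]
  have h2 := hy _ _ h1
  rw [e, ← hρ]
  nth_rewrite 2 [← h2]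
  rw [← hρ, add_neg_cancel_left]

namespace LocalModel

variable {r : ℕ} {V : Type} [AddCommGroup V] (L : LocalModel r V)

lemma exists_near_fix_aux [Finite V] (S : Set V) {κ : ℝ} (hκ : 0 < κ) :
    ∀ᶠ ε in 𝓝[>] (0 : ℝ), ∀ x ∈ L.X, (∀ h ∈ S, dist (L.ρ h x) x < ε) →
      ∃ y ∈ L.fix S, dist x y < κ := by
  classical
  have := Fintype.ofFinite V
  let K : Set (Fin r → ℝ) := L.X ∩ ⋂ y ∈ L.fix S, {x | κ ≤ dist x y}
  have hK : IsCompact K := L.compact.inter_right (isClosed_biInter fun y _ =>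
    isClosed_le continuous_const (continuous_id.dist continuous_const))
  let f : (Fin r → ℝ) → ℝ := fun x => ∑ h : V, if h ∈ S then dist (L.ρ h x) x else 0
  have hf : ContinuousOn f K := by
    refine continuousOn_finsetSum _ fun h _ => ?_
    split_ifs
    · exact continuous_dist.comp_continuousOn
        (((L.cont h).mono Set.inter_subset_left).prodMk continuousOn_id)
    · exact continuousOn_const
  have hout : ∀ x ∈ L.X, x ∉ K → ∃ y ∈ L.fix S, dist x y < κ := by
    intro x hx hxK
    by_contra! h
    exact hxK ⟨hx, Set.mem_iInter₂.2 h⟩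
  rcases K.eq_empty_or_nonempty with hKe | hKn
  · exact Eventually.of_forall fun ε x hx _ => hout x hx (by rw [hKe]; exact Set.notMem_empty x)
  obtain ⟨x₀, hx₀, hmin⟩ := hK.exists_isMinOn hKn hf
  have hnn : ∀ x, ∀ h ∈ (Finset.univ : Finset V), 0 ≤ if h ∈ S then dist (L.ρ h x) x else 0 := by
    intro x h _
    split_ifs
    · exact dist_nonneg
    · exact le_rfl
  have hpos : 0 < f x₀ := by
    refine lt_of_le_of_ne (Finset.sum_nonneg (hnn x₀)) fun h0 => ?_
    have h1 := (Finset.sum_eq_zero_iff_of_nonneg (hnn x₀)).1 h0.symm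
    have h2 : x₀ ∈ L.fix S := ⟨hx₀.1, fun h hh => by
      have := h1 h (Finset.mem_univ h)
      rw [if_pos hh] at this
      exact dist_eq_zero.1 this⟩
    have h3 : κ ≤ dist x₀ x₀ := Set.mem_iInter₂.1 hx₀.2 x₀ h2
    rw [dist_self] at h3
    linarith
  have hc : (0 : ℝ) < Fintype.card V := by
    have : 0 < Fintype.card V := Fintype.card_pos
    exact_mod_cast this
  filter_upwards [Ioo_mem_nhdsGT (div_pos hpos hc)] with ε hε x hx hxS
  refine hout x hx fun hxK => ?_
  have h1 : f x₀ ≤ f x := hmin hxK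
  have h2 : f x ≤ ∑ _h : V, ε := by
    refine Finset.sum_le_sum fun h _ => ?_
    split_ifs with hh
    · exact (hxS h hh).le
    · exact hε.1.le
  rw [Finset.sum_const, Finset.card_univ, nsmul_eq_mul] at h2
  have h3 := (lt_div_iff₀ hc).1 hε.2
  linarith

lemma exists_near_fix [Finite V] {κ : ℝ} (hκ : 0 < κ) :
    ∃ ε₀ > 0, ∀ ε ≤ ε₀, ∀ S : Set V, ∀ x ∈ L.X, (∀ h ∈ S, dist (L.ρ h x) x < ε) →
      ∃ y ∈ L.fix S, dist x y < κ := by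
  have h := eventually_all.2 fun S : Set V => L.exists_near_fix_aux S hκ
  obtain ⟨ε, h1, h2⟩ := (h.and self_mem_nhdsWithin).exists
  exact ⟨ε, h2, fun ε' hε' S x hx hxS => h1 S x hx fun s hs => (hxS s hs).trans_le hε'⟩

lemma uniform_all [Finite V] {ε : ℝ} (hε : 0 < ε) :
    ∃ δ > 0, ∀ v, ∀ a ∈ L.X, ∀ b ∈ L.X, dist a b < δ → dist (L.ρ v a) (L.ρ v b) < ε := by
  have h : ∀ v : V, ∀ᶠ δ in 𝓝[>] (0 : ℝ), ∀ a ∈ L.X, ∀ b ∈ L.X, dist a b < δ →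
      dist (L.ρ v a) (L.ρ v b) < ε := by
    intro v
    obtain ⟨δ, hδ, h⟩ := L.uniform v hε
    filter_upwards [Ioo_mem_nhdsGT hδ] with δ' hδ' a ha b hb hab
    exact h a ha b hb (hab.trans hδ'.2)
  obtain ⟨δ, h1, h2⟩ := ((eventually_all.2 h).and self_mem_nhdsWithin).exists
  exact ⟨δ, h2, h1⟩

/-- Fine equivariant coverings with a bounded number of colours. -/
lemma exists_cover [Finite V] : ∃ N : ℕ, ∀ κ > 0, ∃ ι : (Fin r → ℝ) → Idx V r,
    ∃ y : Idx V r → (Fin r → ℝ),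
      (∀ v x, ι (L.ρ v x) = shift v (ι x)) ∧ (∀ v i, y (shift v i) = L.ρ v (y i)) ∧
      (∀ x ∈ L.X, y (ι x) ∈ L.X ∧ dist x (y (ι x)) < κ) ∧
      (∃ δ > 0, ∀ x ∈ L.X, ∀ x' ∈ L.X, dist x x' < δ → (ι x).1 = (ι x').1 → ι x = ι x') ∧
      ∀ x, (ι x).1 < N := by
  classical
  have := Fintype.ofFinite V
  obtain ⟨N, hN⟩ : ∃ N, Fintype.card (V × Fin r) ≤ N := ⟨_, le_rfl⟩
  refine ⟨N + 1, fun κ hκ => ?_⟩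
  obtain ⟨κ', hκ', hunif⟩ := L.uniform_all (half_pos hκ)
  obtain ⟨ε₀, hε₀, hnear⟩ := L.exists_near_fix hκ'
  set ε := min ε₀ (κ / 2) with hεdef
  have hε : 0 < ε := lt_min hε₀ (half_pos hκ)
  set η : ℝ := 1 / (2 * ((N : ℝ) + 1)) with hη
  have hη0 : 0 < η := by positivity
  let P : (Fin r → ℝ) → ℕ → Prop := fun x θ => θ ≤ N ∧ ∀ j : V × Fin r, ∀ m : ℤ,
    η ≤ |L.ρ j.1 x j.2 / ε + θ / ((N : ℝ) + 1) - m|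
  have hP : ∀ x, ∃ θ, P x θ := fun x => exists_shift hN fun j : V × Fin r => L.ρ j.1 x j.2 / ε
  have hPinv : ∀ v x θ, P (L.ρ v x) θ → P x θ := by
    rintro v x θ ⟨h1, h2⟩
    refine ⟨h1, fun j m => ?_⟩
    have := h2 (j.1 - v, j.2) m
    rwa [← L.add, sub_add_cancel] at this
  let θ : (Fin r → ℝ) → ℕ := fun x => Nat.find (hP x)
  have hθ : ∀ x, P x (θ x) := fun x => Nat.find_spec (hP x)
  have hθinv : ∀ v x, θ (L.ρ v x) = θ x := by
    intro v x
    refine le_antisymm (Nat.find_min' _ ?_) (Nat.find_min' _ (hPinv v x _ (hθ _)))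
    refine hPinv (-v) _ _ ?_
    rw [L.ρ_neg]; exact hθ x
  let ι : (Fin r → ℝ) → Idx V r := fun x =>
    (θ x, fun u i => ⌊L.ρ u x i / ε + θ x / ((N : ℝ) + 1)⌋)
  have hι : ∀ v x, ι (L.ρ v x) = shift v (ι x) := by
    intro v x
    refine Prod.ext (hθinv v x) (funext fun u => funext fun i => ?_)
    show ⌊_⌋ = ⌊_⌋
    rw [hθinv, ← L.add]
  have hclose : ∀ x x', ι x = ι x' → ∀ u, dist (L.ρ u x) (L.ρ u x') < ε := by
    intro x x' h u
    rw [dist_pi_lt_iff hε]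
    intro i
    have h1 : θ x = θ x' := congrArg Prod.fst h
    have h2 : ⌊L.ρ u x i / ε + θ x / ((N : ℝ) + 1)⌋ = ⌊L.ρ u x' i / ε + θ x' / ((N : ℝ) + 1)⌋ :=
      congrFun (congrFun (congrArg Prod.snd h) u) i
    have h3 := Int.abs_sub_lt_one_of_floor_eq_floor h2
    rw [h1, add_sub_add_right_eq_sub, ← sub_div, abs_div, abs_of_pos hε, div_lt_one hε] at h3
    exact h3
  have hy₀ : ∀ q : Idx V r, ∃ y, y ∈ L.fix {h | shift h q = q} ∧
      ((∃ x ∈ L.X, ι x = q) → ∃ x ∈ L.X, ι x = q ∧ dist x y < κ') := by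
    intro q
    by_cases h : ∃ x ∈ L.X, ι x = q
    · obtain ⟨x, hx, hxq⟩ := h
      obtain ⟨y, hy, hd⟩ := hnear ε (min_le_left _ _) {h | shift h q = q} x hx fun h hh => by
        have := hclose (L.ρ h x) x (by rw [hι, hxq]; exact hh) 0
        rwa [L.zero, L.zero] at this
      exact ⟨y, hy, fun _ => ⟨x, hx, hxq, hd⟩⟩
    · exact ⟨0, L.zero_mem_fix _, fun h' => absurd h' h⟩
  choose y₀ hy1 hy2 using hy₀
  obtain ⟨y, q, g, hq, hyq, hyeq⟩ := exists_equivariant (α := shift) (ρ := L.ρ) shift_zero shift_add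
    L.add y₀ fun q h hh => (hy1 q).2 h hh
  refine ⟨ι, y, hι, hyeq, fun x hx => ?_, ?_, fun x => Nat.lt_succ_of_le (hθ x).1⟩
  · have hm : y₀ (q (ι x)) ∈ L.X := (hy1 _).1
    refine ⟨by rw [hyq]; exact L.maps _ _ hm, ?_⟩
    obtain ⟨x₁, hx₁, hq₁, hd⟩ := hy2 (q (ι x)) ⟨L.ρ (-g (ι x)) x, L.maps _ _ hx, by
      rw [hι]
      nth_rewrite 2 [← hq (ι x)]
      rw [← shift_add, neg_add_cancel, shift_zero]⟩
    have h1 := hclose x (L.ρ (g (ι x)) x₁) (by rw [hι, hq₁, hq]) 0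
    rw [L.zero, L.zero] at h1
    have h2 := hunif (g (ι x)) x₁ hx₁ _ hm hd
    rw [hyq]
    calc dist x _ ≤ dist x (L.ρ (g (ι x)) x₁) + dist (L.ρ (g (ι x)) x₁) _ := dist_triangle _ _ _
      _ < κ / 2 + κ / 2 := add_lt_add (h1.trans_le (min_le_right _ _)) h2
      _ = κ := add_halves κ
  · obtain ⟨δ, hδ, hu⟩ := L.uniform_all (mul_pos hε hη0)
    refine ⟨δ, hδ, fun x hx x' hx' hd h => Prod.ext h (funext fun u => funext fun i => ?_)⟩
    have h1 : θ x = θ x' := h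
    have h2 := (dist_pi_lt_iff (mul_pos hε hη0)).1 (hu u x hx x' hx' hd) i
    show ⌊_⌋ = ⌊_⌋
    have ha := (hθ x).2 (u, i)
    have hb := (hθ x').2 (u, i)
    rw [← h1] at hb
    rw [← h1]
    set s := L.ρ u x i / ε + θ x / ((N : ℝ) + 1)
    set s' := L.ρ u x' i / ε + θ x / ((N : ℝ) + 1)
    have h3 : |s - s'| < η := by
      rw [show s - s' = (L.ρ u x i - L.ρ u x' i) / ε by simp only [s, s']; ring, abs_div,
        abs_of_pos hε, div_lt_iff₀ hε, mul_comm]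
      exact h2
    have key : ∀ a b : ℝ, (∀ m : ℤ, η ≤ |b - m|) → |a - b| < η → ⌊a⌋ ≤ ⌊b⌋ := by
      intro a b hb hab
      by_contra! hlt
      have h4 : b < ⌊a⌋ := Int.floor_lt.1 hlt
      have h5 := hb ⌊a⌋
      have h6 := Int.floor_le a
      rw [abs_of_neg (by linarith)] at h5
      have := (abs_lt.1 hab).2
      linarith
    exact le_antisymm (key s s' hb h3) (key s' s ha (by rwa [abs_sub_comm]))

end LocalModel

end

section

namespace LocalModel

variable {p r : ℕ} [Fact p.Prime] {V : Type}

/-- The chain map of an equivariant covering. -/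
noncomputable def snap (p : ℕ) [Fact p.Prime] {r : ℕ} {V : Type} (ι : (Fin r → ℝ) → Idx V r)
    (y : Idx V r → (Fin r → ℝ)) :
    (List (Fin r → ℝ) →₀ ZMod p) →ₗ[ZMod p] (List (Fin r → ℝ) →₀ ZMod p) :=
  vmap _ y ∘ₗ sort _ Prod.fst ∘ₗ vmap _ ι

lemma snap_apply (ι : (Fin r → ℝ) → Idx V r) (y : Idx V r → (Fin r → ℝ))
    (w : List (Fin r → ℝ) →₀ ZMod p) :
    snap p ι y w = vmap _ y (sort _ Prod.fst (vmap _ ι w)) := rfl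

variable {ι : (Fin r → ℝ) → Idx V r} {y : Idx V r → (Fin r → ℝ)}

lemma snap_mem {A B : Set (Fin r → ℝ)} (h : ∀ x ∈ A, y (ι x) ∈ B)
    {w : List (Fin r → ℝ) →₀ ZMod p} (hw : w ∈ Finsupp.supported (ZMod p) (ZMod p) (listsIn A)) :
    snap p ι y w ∈ Finsupp.supported (ZMod p) (ZMod p) (listsIn B) := by
  refine vmap_mem (A := ι '' A) ?_ (sort_supported (vmap_mem (A := A)
    (fun a ha => Set.mem_image_of_mem ι ha) hw))
  rintro _ ⟨x, hx, rfl⟩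
  exact h x hx

lemma snap_len {n : ℕ} {w : List (Fin r → ℝ) →₀ ZMod p}
    (hw : w ∈ Finsupp.supported (ZMod p) (ZMod p) (listsLen _ n)) :
    snap p ι y w ∈ Finsupp.supported (ZMod p) (ZMod p) (listsLen _ n) :=
  vmap_len (sort_len (vmap_len hw))

lemma snap_eq_zero {N n : ℕ} (h : ∀ x, (ι x).1 < N) (hn : N < n)
    {w : List (Fin r → ℝ) →₀ ZMod p}
    (hw : w ∈ Finsupp.supported (ZMod p) (ZMod p) (listsLen _ n)) : snap p ι y w = 0 := by
  have h0 : sort (ZMod p) Prod.fst (vmap (ZMod p) ι w) = 0 := by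
    have hlen : vmap (ZMod p) ι w ∈ Finsupp.supported (ZMod p) (ZMod p) (listsLen (Idx V r) n) :=
      vmap_len hw
    have hmem : vmap (ZMod p) ι w ∈
        Finsupp.supported (ZMod p) (ZMod p) (listsIn {i : Idx V r | i.1 < N}) :=
    vmap_mem (A := Set.univ) (fun a _ => h a) (supported_mono (s := Set.univ)
    (t := listsIn Set.univ) (fun _ _ a _ => Set.mem_univ a) (mem_supported_univ _))
    exact sort_eq_zero (A := {i : Idx V r | i.1 < N}) (fun _ ha => ha) hn hmem hlen
  rw [snap_apply, h0, map_zero]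

lemma bd_snap {A : Set (Fin r → ℝ)} (h : ∀ x ∈ A, ∀ x' ∈ A, (ι x).1 = (ι x').1 → ι x = ι x')
    {w : List (Fin r → ℝ) →₀ ZMod p} (hw : w ∈ Finsupp.supported (ZMod p) (ZMod p) (listsIn A)) :
    bd _ _ (snap p ι y w) = snap p ι y (bd _ _ w) := by
  rw [snap_apply, bd_vmap, bd_sort (A := ι '' A), bd_vmap, snap_apply]
  · rintro _ ⟨x, hx, rfl⟩ _ ⟨x', hx', rfl⟩ hxx
    exact h x hx x' hx' hxx
  · exact vmap_mem (fun a ha => Set.mem_image_of_mem ι ha) hw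

lemma prism_snap_mem {A B : Set (Fin r → ℝ)} (hAB : A ⊆ B) (h : ∀ x ∈ A, y (ι x) ∈ B)
    {w : List (Fin r → ℝ) →₀ ZMod p} (hw : w ∈ Finsupp.supported (ZMod p) (ZMod p) (listsIn A)) :
    prism (fun x => x) (snap p ι y) w ∈ Finsupp.supported (ZMod p) (ZMod p) (listsIn B) :=
  prism_mem (fun _ ha => hAB ha) (fun _ hl => snap_mem h (single_mem_supported hl)) hw

lemma prism_snap_homotopy {l : List (Fin r → ℝ)} {N : ℕ} (hN : ∀ x, (ι x).1 < N)
    (hl : N < l.length)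
    (h : ∀ x ∈ l, ∀ x' ∈ l, (ι x).1 = (ι x').1 → ι x = ι x') :
    Finsupp.single l (1 : ZMod p) + (bd (ZMod p) _ (prism (fun x => x) (snap p ι y) (Finsupp.single l 1)) +
      prism (fun x => x) (snap p ι y) (bd (ZMod p) (Fin r → ℝ) (Finsupp.single l 1))) = 0 := by
  have e := prism_homotopy_single (R := ZMod p) (fun x => x) (snap p ι y) (A := {a | a ∈ l})
    (by rw [snap_apply, vmap_single, sort_single]; exact vmap_single _ _ _)
    (fun _ hm => bd_snap (A := {a | a ∈ l}) h (single_mem_supported hm)) (l := l) fun a ha => ha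
  rw [e, snap_eq_zero hN hl (single_mem_supported rfl), vmap_id]
  abel

variable [AddCommGroup V] {L : LocalModel r V}

lemma snap_comm (h1 : ∀ v x, ι (L.ρ v x) = shift v (ι x))
    (h2 : ∀ v i, y (shift v i) = L.ρ v (y i)) (v : V) (w : List (Fin r → ℝ) →₀ ZMod p) :
    snap p ι y (vmap _ (L.ρ v) w) = vmap _ (L.ρ v) (snap p ι y w) := by
  have e1 : ι ∘ L.ρ v = shift v ∘ ι := funext (h1 v)
  have e2 : y ∘ shift v = L.ρ v ∘ y := funext (h2 v)
  rw [snap_apply, vmap_vmap, e1, ← vmap_vmap, sort_vmap (h := shift v) (fun _ => rfl), vmap_vmap,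
    e2, ← vmap_vmap, snap_apply]

variable (p L)

lemma exists_contraction [Finite V] : ∃ M : ℕ, ∀ n > M, ∀ c ∈ smallDeg (ZMod p) L.X n,
    ∃ T : ℕ → (List (Fin r → ℝ) →₀ ZMod p) →ₗ[ZMod p] (List (Fin r → ℝ) →₀ ZMod p),
      (∀ j v w, T j (vmap _ (L.ρ v) w) = vmap _ (L.ρ v) (T j w)) ∧
      (∀ S j, ∀ l ∈ listsIn (L.fix S), T j (Finsupp.single l 1) ∈
        Finsupp.supported (ZMod p) (ZMod p) (listsIn (L.fix S))) ∧
      (∀ m, ∀ x ∈ smallDeg (ZMod p) L.X m, seqMap T x ∈ smallDeg (ZMod p) L.X (m + 1)) ∧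
      (∀ x ∈ small (ZMod p) L.X, x ∈ null (ZMod p) {0} → seqMap T x ∈ null (ZMod p) {0}) ∧
      c + (sbd _ _ (seqMap T c) + seqMap T (sbd _ _ c)) ∈ null (ZMod p) {0} := by
  obtain ⟨N, hcov⟩ := L.exists_cover
  have hκ : ∀ m : ℕ, (0 : ℝ) < 1 / ((m : ℝ) + 1) := fun m => by positivity
  choose ι y h1 h2 h3 h4 h5 using fun m : ℕ => hcov _ (hκ m)
  choose δ hδ h4 using h4
  refine ⟨N, fun n hn c hc => ?_⟩
  obtain ⟨ν, hν1, hν2⟩ := exists_diagonal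
    (fun m j => c j ∈ Finsupp.supported (ZMod p) (ZMod p) (smallLists _ (δ m)))
    fun m => hc.1.2 _ (hδ m)
  obtain ⟨T, hT⟩ : ∃ T : ℕ → (List (Fin r → ℝ) →₀ ZMod p) →ₗ[ZMod p] (List (Fin r → ℝ) →₀ ZMod p),
      ∀ j, T j = prism (fun x => x) (snap p (ι (ν j)) (y (ν j))) := ⟨_, fun _ => rfl⟩
  refine ⟨T, ?_, ?_, ?_, ?_, ?_⟩
  · intro j v w
    rw [hT]; exact prism_comm (h := L.ρ v) (h' := L.ρ v) (f := fun x => x) (fun _ => rfl)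
      (snap_comm (h1 (ν j)) (h2 (ν j)) v) w
  · intro S j l hl
    rw [hT]
    refine prism_snap_mem (A := L.fix S) (B := L.fix S) subset_rfl
      (fun x hx => ⟨(h3 (ν j) x hx.1).1, fun v hv => ?_⟩) (single_mem_supported hl)
    rw [← h2, ← h1, hx.2 v hv]
  · refine fun m x hx => Submodule.mem_inf.2 ⟨?_, seqMap_deg (fun j l hl => hT j ▸ prism_len
      (fun l' => snap_len (single_mem_supported rfl)) (single_mem_supported hl)) hx.2⟩
    refine seqMap_small (A := L.X) (fun j l hl => ?_) (fun ε hε => ?_) hx.1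
    · rw [hT]; exact prism_snap_mem subset_rfl (fun x hx => (h3 _ x hx).1) (single_mem_supported hl)
    · refine ⟨ε / 3, by positivity, ?_⟩
      filter_upwards [inv_lt_of_large hν2 (show 0 < ε / 3 by positivity)] with j hj l hl hls
      have hB := prism_snap_mem (p := p) (ι := ι (ν j)) (y := y (ν j)) (A := {a | a ∈ l})
        (B := {b | ∃ a ∈ l, dist a b < ε / 3})
        (fun a ha => ⟨a, ha, by rw [dist_self]; positivity⟩)
        (fun a ha => ⟨a, ha, ((h3 (ν j) a (hl a ha)).2).trans hj⟩)
        (single_mem_supported (R := ZMod p) (l := l) fun a ha => ha)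
      rw [hT]
      refine supported_mono ?_ hB
      intro l' hl' b hb b' hb'
      obtain ⟨a, ha, hab⟩ := hl' b hb
      obtain ⟨a', ha', hab'⟩ := hl' b' hb'
      have := hls a ha a' ha'
      calc dist b b' ≤ dist b a + dist a a' + dist a' b' := dist_triangle4 _ _ _ _
        _ < ε / 3 + ε / 3 + ε / 3 := by rw [dist_comm b a]; linarith
        _ = ε := by ring
  · intro x hx hx0
    refine seqMap_null (A := L.X) (D := {0}) (fun ε hε => ⟨ε / 2, by positivity, ?_⟩) hx.1 hx0
    filter_upwards [inv_lt_of_large hν2 (show 0 < ε / 2 by positivity)] with j hj l hl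
    rw [hT]
    refine prism_snap_mem (A := L.X ∩ farFrom {0} ε) (fun a ha => farFrom_anti (by linarith) ha.2)
      (fun a ha => ?_) (single_mem_supported hl)
    intro z hz
    have := ha.2 z hz
    have h6 := ((h3 (ν j) a ha.1).2).trans hj
    have := dist_triangle a (y (ν j) (ι (ν j) a)) z
    linarith
  · refine mem_null_of_eventually_zero ?_
    filter_upwards [hν1] with j hj
    have hm := mem_supported_inter (mem_supported_inter (hc.1.1 j) (hc.2 j)) hj
    refine eq_on_supported (f := LinearMap.id + (bd _ _ ∘ₗ T j + T j ∘ₗ bd _ _)) (g := 0)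
      (fun l hl => ?_) hm
    rw [hT]
    refine prism_snap_homotopy (h5 (ν j)) (by rw [show l.length = n from hl.1.2]; exact hn)
      fun x hx x' hx' => h4 (ν j) x (hl.1.1 x hx) x' (hl.1.1 x' hx') (hl.2 x hx x' hx')

end LocalModel

end

section

namespace LocalModel

variable {p r : ℕ} [Fact p.Prime] {V : Type} [AddCommGroup V] {L : LocalModel r V}

/-- Operators which commute with everything equivariant. -/
structure Natural (L : LocalModel r V) (ϖ : Module.End (ZMod p) (Chains r p)) : Prop where
  comm : ∀ T : Module.End (ZMod p) (Chains r p), (∀ v c, T (L.act p v c) = L.act p v (T c)) →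
    ∀ c, T (ϖ c) = ϖ (T c)
  stab : ∀ Y : Submodule (ZMod p) (Chains r p), (∀ v, ∀ y ∈ Y, L.act p v y ∈ Y) →
    ∀ y ∈ Y, ϖ y ∈ Y

lemma Natural.one : Natural (p := p) L 1 := ⟨fun _ _ _ => rfl, fun _ _ _ hy => hy⟩

lemma Natural.mul {ϖ ϖ' : Module.End (ZMod p) (Chains r p)} (h : Natural L ϖ)
    (h' : Natural L ϖ') : Natural L (ϖ * ϖ') :=
  ⟨fun T hT c => by
    rw [Module.End.mul_apply, Module.End.mul_apply, h.comm T hT, h'.comm T hT],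
    fun Y hY y hy => h.stab Y hY _ (h'.stab Y hY y hy)⟩

lemma Natural.pow {ϖ : Module.End (ZMod p) (Chains r p)} (h : Natural L ϖ) (j : ℕ) :
    Natural L (ϖ ^ j) := by
  induction j with
  | zero => exact Natural.one
  | succ j ih => rw [pow_succ]; exact ih.mul h

lemma Natural.sig (b : V) : Natural L (L.sig p b) :=
  ⟨fun T hT c => by rw [sig_apply, sig_apply, map_sub, hT], fun _ hY _ hy => L.sig_mem hY b hy⟩

lemma Natural.nrm [Module (ZMod p) V] (b : V) : Natural L (L.nrm p b) :=
  ⟨fun T hT c => by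
    rw [nrm_apply, nrm_apply, map_sum]; exact Finset.sum_congr rfl fun _ _ => hT _ _,
    fun _ hY _ hy => L.nrm_mem hY b hy⟩

lemma Natural.sbd {ϖ : Module.End (ZMod p) (Chains r p)} (h : Natural L ϖ) (c : Chains r p) :
    ϖ (sbd _ _ c) = SmithBound.sbd _ _ (ϖ c) :=
  (h.comm (SmithBound.sbd _ _) (fun v c => (L.act_sbd v c).symm) c).symm

lemma Natural.W_mem {ϖ : Module.End (ZMod p) (Chains r p)} (h : Natural L ϖ) {S : Set V} {n : ℕ}
    {c : Chains r p} (hc : c ∈ L.W p S n) : ϖ c ∈ L.W p S n :=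
  h.stab _ (fun v _ hy => L.act_W v S n hy) _ hc

lemma Natural.null_mem {ϖ : Module.End (ZMod p) (Chains r p)} (h : Natural L ϖ)
    {c : Chains r p} (hc : c ∈ null (ZMod p) {0}) : ϖ c ∈ null (ZMod p) {0} :=
  h.stab _ (fun v _ hy => L.act_null v hy) _ hc

/-- Simplices lying in one of the given fixed point sets. -/
def faceSimplices (L : LocalModel r V) (C : Set (Set V)) : Set (List (Fin r → ℝ)) :=
  {l | ∃ S ∈ C, l ∈ listsIn (L.fix S)}

lemma acy_high (p : ℕ) [Fact p.Prime] [Finite V] (L : LocalModel r V) :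
    ∃ M, ∀ n > M, ∀ (S : Set V) (C : Set (Set V)) (ϖ : Module.End (ZMod p) (Chains r p)),
      Natural L ϖ → Acy (sbd _ _) (relNull _ {0} (L.faceSimplices C)) (im ϖ (L.W p S)) n := by
  obtain ⟨M, hM⟩ := L.exists_contraction p
  refine ⟨M, fun n hn S C ϖ hϖ => ?_⟩
  rintro _ ⟨w, hw, rfl⟩ hd
  have hwX : w ∈ smallDeg (ZMod p) L.X n := smallDeg_mono (L.fix_subset S) n hw
  obtain ⟨T, ha, hb, hc, hnull, hT⟩ := hM n hn w hwX
  have hTact : ∀ v c, seqMap T (L.act p v c) = L.act p v (seqMap T c) := fun v c =>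
    funext fun j => ha j v (c j)
  have hTϖ := hϖ.comm (seqMap T) hTact
  have hTw : seqMap T w ∈ L.W p S (n + 1) := by
    have h1 := hc n w hwX
    exact ⟨⟨fun j => map_supported (hb S j) (hw.1.1 j), h1.1.2⟩, h1.2⟩
  refine ⟨-ϖ (seqMap T w), neg_mem (im_mem hTw), ?_⟩
  have h2 := hϖ.null_mem hT
  rw [map_add, map_add, ← hTϖ, hϖ.sbd, hϖ.sbd] at h2
  have hTd : seqMap T (sbd _ _ (ϖ w)) ∈ relNull (ZMod p) {0} (L.faceSimplices C) := by
    refine map_relNull (fun j l hl => ?_) hd fun h => hnull _ ?_ h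
    · obtain ⟨S', hS', hl⟩ := hl
      exact supported_mono (s := listsIn (L.fix S')) (t := L.faceSimplices C) (fun _ h => ⟨S', hS', h⟩)
        (hb S' j l hl)
    · obtain ⟨m, rfl⟩ : ∃ m, n = m + 1 := ⟨n - 1, by omega⟩
      have h3 := (gr_smallDeg (k := ZMod p) L.X).succ _ _
        (smallDeg_mono (L.fix_subset S) (m + 1) (hϖ.W_mem hw))
      exact (Submodule.mem_inf.1 (sub_mem h3 (srs_smallDeg _ h3))).1
  have h4 := sub_mem (null_le_relNull _ (L.faceSimplices C) h2) hTd
  convert h4 using 1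
  rw [map_neg]
  abel

lemma im_one (W : ℕ → Submodule (ZMod p) (Chains r p)) :
    im (1 : Module.End (ZMod p) (Chains r p)) W = W :=
  funext fun n => Submodule.map_id (W n)

lemma faceSimplices_empty (L : LocalModel r V) : L.faceSimplices ∅ = ∅ := by
  ext l; simp [faceSimplices]

lemma acy_high_null (p : ℕ) [Fact p.Prime] [Finite V] (L : LocalModel r V) :
    ∃ M, ∀ n > M, ∀ (S : Set V) (ϖ : Module.End (ZMod p) (Chains r p)),
      Natural L ϖ → Acy (sbd _ _) (null _ {0}) (im ϖ (L.W p S)) n := by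
  obtain ⟨M, hM⟩ := L.acy_high p
  refine ⟨M, fun n hn S ϖ hϖ => ?_⟩
  have := hM n hn S ∅ ϖ hϖ
  rwa [faceSimplices_empty, relNull_empty] at this

variable [Module (ZMod p) V]

lemma ρ_smul (L : LocalModel r V) {v : V} {x : Fin r → ℝ} (h : L.ρ v x = x) (j : ZMod p) :
    L.ρ (j • v) x = x := by
  have hp : NeZero p := ⟨(Fact.out : p.Prime).ne_zero⟩
  have key : ∀ i : ℕ, L.ρ ((i : ZMod p) • v) x = x := by
    intro i
    induction i with
    | zero => simp [L.zero]
    | succ i ih =>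
      rw [Nat.cast_succ, add_smul, one_smul, L.add, h, ih]
  have := key j.val
  rwa [ZMod.natCast_zmod_val] at this

lemma mem_bad {L : LocalModel r V} {a b : V} {l : List (Fin r → ℝ)} (h : l ∈ L.bad (p := p) a b) :
    ∃ t : ZMod p, ∀ x ∈ l, L.ρ (t • a + b) x = x := by
  obtain ⟨i, j, hj, hl⟩ := h
  refine ⟨j⁻¹ * i, fun x hx => ?_⟩
  have := L.ρ_smul (L.map_eq_self_iff.1 hl x hx) j⁻¹
  rwa [smul_add, smul_smul, smul_smul, inv_mul_cancel₀ hj, one_smul] at this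

lemma smithData (p : ℕ) [Fact p.Prime] {V : Type} [AddCommGroup V] [Module (ZMod p) V] [Finite V]
    (L : LocalModel r V) (S : Set V) (g : V) :
    SmithData p (sbd _ _) (null _ {0}) (L.sig p g) (L.W p S) (L.W p (insert g S)) := by
  obtain ⟨D, -, hD⟩ := L.exists_domain (p := p) 0 g
  have hbad : ∀ n, ∀ c ∈ L.W p S n,
      srs (ZMod p) (L.bad (p := p) 0 g) c ∈ L.W p (insert g S) n := by
    intro n c hc
    have h1 := srs_smallDeg (L.bad (p := p) 0 g) hc
    refine ⟨⟨fun j => ?_, h1.1.2⟩, h1.2⟩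
    refine supported_mono (t := listsIn (L.fix (insert g S))) ?_
      (rs_mem_inter (L.bad (p := p) 0 g) _ (hc.1.1 j))
    rintro l ⟨hl, hl'⟩ x hx
    obtain ⟨t, ht⟩ := mem_bad hl'
    refine ⟨(hl x hx).1, ?_⟩
    rintro h (rfl | hh)
    · simpa using ht x hx
    · exact (hl x hx).2 h hh
  have hle : ∀ n, L.W p (insert g S) n ≤ L.W p S n := fun n =>
    smallDeg_mono (L.fix_anti (Set.subset_insert g S)) n
  refine
    { dd := sbd_sbd
      dV := fun v hv => sbd_null hv
      grW := gr_smallDeg _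
      grF := gr_smallDeg _
      F_le := hle
      comm := (Natural.sig g).sbd
      σV := fun v hv => (Natural.sig g).null_mem hv
      σW := fun n w hw => (Natural.sig g).W_mem hw
      σF := fun n f hf => by
        rw [sig_apply, L.act_fix (Set.mem_insert g S) hf, sub_self]
      pow := L.sig_pow g
      kerσ := ?_
      kerτ := ?_
      indep := ?_
      vanish := ?_ }
  · intro n c hc h
    rw [sig_pow_pred]
    exact ⟨_, srs_smallDeg D hc, _, hbad n c hc,
      ker_sig (fun v _ hy => L.act_null v hy) (fun _ hy => srs_null D hy) (hD c) h⟩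
  · intro n c hc h
    rw [sig_pow_pred] at h
    obtain ⟨w, hw, hw'⟩ := ker_nrm (fun _ hy => srs_null D hy)
      (fun v _ hy => L.act_W v S n hy) (fun _ hy => srs_smallDeg D hy) hc (hD c) h
    exact ⟨w, hw, _, hbad n c hc, hw'⟩
  · intro n w _ f hf h
    have h1 := srs_null {l | l.map (L.ρ g) = l} h
    have h2 : srs (ZMod p) {l | l.map (L.ρ g) = l} f = f := srs_of_forall fun j =>
      supported_mono (s := listsIn (L.fix (insert g S))) (fun l hl => L.map_eq_self fun x hx =>
        (hl x hx).2 g (Set.mem_insert g S)) (hf.1.1 j)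
    have h3 : srs (ZMod p) {l | l.map (L.ρ g) = l} (L.act p g w) =
        srs (ZMod p) {l | l.map (L.ρ g) = l} w := by
      rw [L.srs_act (fun l => (List.map_injective_iff.2 (L.ρ_injective g)).eq_iff)]
      exact L.act_of_fixed fun j => srs_supported _ w j
    rwa [map_add, sig_apply, map_sub, h2, h3, sub_self, zero_add] at h1
  · obtain ⟨M, hM⟩ := L.acy_high_null p
    refine ⟨M, fun n hn => ⟨?_, fun j => hM n hn S _ ((Natural.sig g).pow j)⟩⟩
    have := hM n hn (insert g S) 1 Natural.one
    rwa [im_one] at this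

end LocalModel

end

section

lemma null_of_far {k E : Type*} [Field k] [PseudoMetricSpace E] {x : E} {ε : ℝ} (hε : 0 < ε)
    {c : Seq k E} (h : ∀ᶠ j in scale, c j ∈ Finsupp.supported k k (listsIn (farFrom {x} ε))) :
    c ∈ null k {x} := ⟨ε, hε, h⟩

lemma null_nearby {k E : Type*} [Field k] [PseudoMetricSpace E] {x : E} {c : Seq k E}
    (h : c ∈ null k {x}) : ∃ ε > 0, ∀ y, dist y x < ε → c ∈ null k {y} := by
  obtain ⟨ε, hε, h⟩ := h
  refine ⟨ε / 2, by positivity, fun y hy => null_of_far (show 0 < ε / 2 by positivity) ?_⟩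
  refine h.mono fun j hj => supported_mono (listsIn_mono fun a ha => ?_) hj
  intro y' hy'
  rw [Set.mem_singleton_iff.1 hy']
  have := ha x rfl
  have := dist_triangle a y x
  linarith

lemma null_of_closed {k E : Type*} [Field k] [PseudoMetricSpace E] {x : E} {F : Set E}
    (hF : IsClosed F) (hx : x ∉ F) {n : ℕ} {c : Seq k E} (hc : c ∈ smallDeg k F n) :
    c ∈ null k {x} := by
  obtain ⟨ε, hε, h⟩ := Metric.isOpen_iff.1 hF.isOpen_compl x hx
  refine null_of_far hε (Eventually.of_forall fun j => ?_)
  refine supported_mono (s := listsIn F) (listsIn_mono fun a ha => ?_) (hc.1.1 j)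
  rintro _ rfl
  by_contra! hlt
  exact h (Metric.mem_ball.2 hlt) ha

namespace LocalModel

variable {p r : ℕ} [Fact p.Prime] {V : Type} [AddCommGroup V] [Module (ZMod p) V] [Finite V]
  {L : LocalModel r V}

lemma smithData_singleton (p : ℕ) [Fact p.Prime] {V : Type} [AddCommGroup V] [Module (ZMod p) V]
    [Finite V] (L : LocalModel r V) (v : V) :
    SmithData p (sbd _ _) (null _ {0}) (L.sig p v) (L.W p ∅) (L.W p {v}) := by
  have := L.smithData p ∅ v
  rwa [insert_empty_eq] at this

lemma fix_nhds_of_sph (hodd : Odd p) {v : V}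
    (h : Sph (sbd _ _) (null _ {0}) (L.W p {v}) (r + 1)) : L.fix {v} ∈ 𝓝 0 := by
  have hp : 1 < p := (Fact.out : p.Prime).one_lt
  obtain ⟨z, hz, hzb, -⟩ := hl_eq_one.1 h.1
  have hzF : z ∈ L.W p {v} (r + 1) := (Submodule.mem_inf.1 hz).1
  have hdz : sbd _ _ z ∈ null (ZMod p) {0} := hz.2
  have hzX : z ∈ L.W p ∅ (r + 1) := smallDeg_mono (L.fix_anti (Set.empty_subset _)) _ hzF
  by_contra hF
  refine hzb ((L.smithData_singleton p v).fixed_boundary hodd hp (L.sph p) hzF ?_)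
  unfold W at hzX ⊢
  rw [fix_empty] at hzX ⊢
  obtain ⟨a, ha, hPJ⟩ := mem_bdr_of_bounds_at L.nhds L.compact.isBounded hzX hdz
  obtain ⟨x, hx, hxF⟩ : ∃ x ∈ Metric.closedBall (0 : Fin r → ℝ) a, x ∉ L.fix {v} := by
    by_contra! hall
    exact hF (mem_of_superset (Metric.closedBall_mem_nhds 0 ha) hall)
  refine hPJ x hx 0 (zero_mem _) ?_
  rw [map_zero, sub_zero]
  exact null_of_closed (L.isClosed_fix _) hxF hzF

lemma sph_of_mem_closure (hodd : Odd p) {v : V}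
    (h : (0 : Fin r → ℝ) ∈ closure (interior (L.fix {v}))) :
    Sph (sbd _ _) (null _ {0}) (L.W p {v}) (r + 1) := by
  have hp : 1 < p := (Fact.out : p.Prime).one_lt
  obtain ⟨-, n, hn, -, hS⟩ := (L.smithData_singleton p v).smith hodd hp (L.sph p)
  by_cases hnr : n = r + 1
  · rwa [hnr] at hS
  exfalso
  obtain ⟨z, hz, hzb, -⟩ := hl_eq_one.1 (L.sph p).1
  have hzX : z ∈ L.W p ∅ (r + 1) := (Submodule.mem_inf.1 hz).1
  have hdz : sbd _ _ z ∈ null (ZMod p) {0} := hz.2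
  obtain ⟨w, hw, s, hs, hν⟩ := (L.smithData_singleton p v).cycle_decomp hodd hp (L.sph p)
    (hS.acy (Ne.symm hnr)) hzX hdz
  apply hzb
  unfold W at hzX hw hs ⊢
  rw [fix_empty] at hzX hw hs ⊢
  obtain ⟨a, ha, hPJ⟩ := mem_bdr_of_bounds_at L.nhds L.compact.isBounded hzX hdz
  obtain ⟨ε, hε, hνx⟩ := null_nearby hν
  obtain ⟨x, hx, hxd⟩ := Metric.mem_closure_iff.1 h (min a ε) (by positivity)
  rw [dist_comm] at hxd
  have hxF : L.fix {v} ∈ 𝓝 x := mem_interior_iff_mem_nhds.1 hx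
  refine hPJ x (Metric.mem_closedBall.2 (hxd.le.trans (min_le_left _ _))) w hw ?_
  have h1 := hνx x (hxd.trans_le (min_le_right _ _))
  have hσs : L.sig p v s ∈ null (ZMod p) {x} := by
    have hsX : L.sig p v s ∈ smallDeg (ZMod p) L.X (r + 1) := by
      have := (Natural.sig (p := p) (L := L) v).W_mem (S := ∅) (n := r + 1) (c := s)
        (by unfold W; rwa [fix_empty])
      unfold W at this; rwa [fix_empty] at this
    have h2 := sub_srs_null hxF (Submodule.mem_inf.1 hsX).1
    have h3 : srs (ZMod p) (listsIn (L.fix {v})) (L.sig p v s) = 0 := by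
      rw [sig_apply, map_sub, L.srs_act, L.act_of_fixed, sub_self]
      · intro j
        exact supported_mono (s := listsIn (L.fix {v})) (fun l hl => L.map_eq_self fun y hy =>
          (hl y hy).2 v rfl) (srs_supported _ s j)
      · intro l
        simp only [listsIn, Set.mem_ofPred_eq, List.forall_mem_map, L.fix_maps]
    rwa [h3, sub_zero] at h2
  have := add_mem h1 hσs
  convert this using 1
  abel

lemma fix_nhds_of_mem_closure (hodd : Odd p) {v : V}
    (h : (0 : Fin r → ℝ) ∈ closure (interior (L.fix {v}))) : L.fix {v} ∈ 𝓝 0 :=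
  fix_nhds_of_sph hodd (sph_of_mem_closure hodd h)

end LocalModel

end

section

/-- Sequences of chains on the simplices in `Λ`. -/
def supp (k : Type*) [Field k] {E : Type*} (Λ : Set (List E)) : Submodule k (Seq k E) where
  carrier := {c | ∀ j, c j ∈ Finsupp.supported k k Λ}
  add_mem' ha hb j := add_mem (ha j) (hb j)
  zero_mem' _ := zero_mem _
  smul_mem' t _ ha j := Submodule.smul_mem _ t (ha j)

lemma smallDeg_of_supported {k E : Type*} [Field k] [PseudoMetricSpace E] {A B : Set E} {n : ℕ}
    {c : Seq k E} (hc : c ∈ smallDeg k A n)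
    (h : ∀ j, c j ∈ Finsupp.supported k k (listsIn B)) : c ∈ smallDeg k B n :=
  ⟨⟨h, hc.1.2⟩, hc.2⟩

namespace LocalModel

variable {p r : ℕ} [Fact p.Prime] {V : Type} [AddCommGroup V]
  {L : LocalModel r V}

lemma map_mem_faceSimplices {C : Set (Set V)} (v : V) {l : List (Fin r → ℝ)}
    (hl : l ∈ L.faceSimplices C) :
    l.map (L.ρ v) ∈ L.faceSimplices C := by
  obtain ⟨S, hS, hl⟩ := hl
  refine ⟨S, hS, fun x hx => ?_⟩
  obtain ⟨y, hy, rfl⟩ := List.mem_map.1 hx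
  exact (L.fix_maps S v y).2 (hl y hy)

lemma bd_mem_supported_faceSimplices {C : Set (Set V)}
    {l : List (Fin r → ℝ)} (hl : l ∈ L.faceSimplices C) :
    bd (ZMod p) _ (Finsupp.single l 1) ∈
      Finsupp.supported (ZMod p) (ZMod p) (L.faceSimplices C) := by
  obtain ⟨S, hS, hl⟩ := hl
  exact supported_mono (s := listsIn (L.fix S)) (t := L.faceSimplices C) (fun _ h => ⟨S, hS, h⟩)
    (bd_single_mem hl)

lemma Natural.rel_mem {ϖ : Module.End (ZMod p) (Chains r p)} (h : Natural L ϖ) {C : Set (Set V)}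
    {c : Chains r p} (hc : c ∈ relNull (ZMod p) {0} (L.faceSimplices C)) :
    ϖ c ∈ relNull (ZMod p) {0} (L.faceSimplices C) :=
  h.stab _ (fun v _ hy => L.act_relNull v (fun _ hl => map_mem_faceSimplices v hl) hy) _ hc

variable [Module (ZMod p) V]

lemma nrm_pow (b : V) (c : Chains r p) : (L.nrm p b ^ p) c = 0 := by
  have hp : p.Prime := Fact.out
  have h0 : L.sig p b ^ p = 0 := LinearMap.ext fun x => L.sig_pow b x
  rw [← sig_pow_pred, ← pow_mul, mul_comm, pow_mul, h0, zero_pow (by have := hp.two_le; omega)]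
  rfl

lemma exPair {C : Set (Set V)} {Y : ℕ → Submodule (ZMod p) (Chains r p)}
    {D B : Set (List (Fin r → ℝ))} {b : V} (gr : Gr (sbd _ _) Y)
    (hY : ∀ n v, ∀ y ∈ Y n, L.act p v y ∈ Y n) (hYs : ∀ n, ∀ y ∈ Y n, srs _ D y ∈ Y n)
    (hB : ∀ n, ∀ y ∈ Y n, srs _ B y ∈ relNull (ZMod p) {0} (L.faceSimplices C))
    (hD : ∀ c : Chains r p, c = srs _ B c +
      ∑ j : ZMod p, L.act p (j • b) (srs _ D (L.act p (-(j • b)) c))) :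
    ExPair (sbd _ _) (relNull _ {0} (L.faceSimplices C)) Y (L.sig p b) (L.nrm p b) where
  dd := sbd_sbd
  dV _ hv := sbd_relNull (fun _ hl => bd_mem_supported_faceSimplices hl) hv
  gr := gr
  commμ := (Natural.sig b).sbd
  commν := (Natural.nrm b).sbd
  Vμ _ hv := (Natural.sig b).rel_mem hv
  Vν _ hv := (Natural.nrm b).rel_mem hv
  Wμ n w hw := L.sig_mem (hY n) b hw
  Wν n w hw := L.nrm_mem (hY n) b hw
  μν := L.sig_nrm b
  νμ := L.nrm_sig b
  kerμ n c hc h := by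
    have h1 := ker_sig (fun v _ hy => L.act_relNull v (fun _ hl => map_mem_faceSimplices v hl) hy)
      (fun _ hy => srs_relNull D hy) (hD c) h
    refine ⟨_, hYs n c hc, ?_⟩
    have := add_mem h1 (hB n c hc)
    rwa [← sub_sub, sub_add_cancel] at this
  kerν n c hc h := by
    obtain ⟨w, hw, h1⟩ := ker_nrm (fun _ hy => srs_relNull D hy) (hY n) (hYs n) hc (hD c) h
    refine ⟨w, hw, ?_⟩
    have := add_mem h1 (hB n c hc)
    rwa [← sub_sub, sub_add_cancel] at this

/-- Representatives of the lines of the plane spanned by `a` and `b`. -/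
def line (p : ℕ) {V : Type} [AddCommGroup V] [Module (ZMod p) V] (a b : V) :
    Option (ZMod p) → V
  | none => a
  | some t => t • a + b

lemma fixed_of_lines {a b : V} {c c' : Option (ZMod p)} (hc : c ≠ c') {x : Fin r → ℝ}
    (h : L.ρ (line p a b c) x = x) (h' : L.ρ (line p a b c') x = x) :
    L.ρ a x = x ∧ L.ρ b x = x := by
  have hb : ∀ t : ZMod p, L.ρ a x = x → L.ρ (t • a + b) x = x → L.ρ b x = x := by
    intro t h1 h2
    rwa [add_comm, L.add, L.ρ_smul h1] at h2
  rcases c with _ | t <;> rcases c' with _ | t'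
  · exact absurd rfl hc
  · exact ⟨h, hb t' h h'⟩
  · exact ⟨h', hb t h' h⟩
  · have ht : t - t' ≠ 0 := fun h0 => hc (by rw [sub_eq_zero.1 h0])
    have h1 : L.ρ ((t - t') • a) x = x := by
      have e : t • a + b = (t - t') • a + (t' • a + b) := by module
      have h2 : L.ρ ((t - t') • a + (t' • a + b)) x = x := by rw [← e]; exact h
      rwa [L.add, show L.ρ (t' • a + b) x = x from h'] at h2
    have h2 := L.ρ_smul h1 (t - t')⁻¹
    rw [smul_smul, inv_mul_cancel₀ ht, one_smul] at h2
    exact ⟨h2, hb t h2 h⟩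

lemma fixed_line {a b : V} {x : Fin r → ℝ} (ha : L.ρ a x = x) (hb : L.ρ b x = x)
    (c : Option (ZMod p)) : L.ρ (line p a b c) x = x := by
  rcases c with _ | t
  · exact ha
  · show L.ρ (t • a + b) x = x
    rw [L.add, hb, L.ρ_smul ha]

lemma fix_plane_le (D : Set V) (a b : V) (c : Option (ZMod p)) :
    L.fix (insert a (insert b D)) ⊆ L.fix (insert (line p a b c) D) := by
  rintro x ⟨hx, h⟩
  refine ⟨hx, ?_⟩
  rintro v (rfl | hv)
  · exact fixed_line (h a (by simp)) (h b (by simp)) c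
  · exact h v (by simp [hv])

lemma fix_plane_eq (D : Set V) (a b : V) (c : Option (ZMod p)) :
    ∃ g : V, L.fix (insert g (insert (line p a b c) D)) = L.fix (insert a (insert b D)) := by
  rcases c with _ | t
  · exact ⟨b, by rw [show line p a b none = a from rfl, Set.insert_comm]⟩
  · refine ⟨a, Set.Subset.antisymm ?_ ?_⟩
    · rintro x ⟨hx, h⟩
      have h1 := fixed_of_lines (L := L) (p := p) (a := a) (b := b) (c := none) (c' := some t)
        (by simp) (h a (by simp)) (h _ (by simp)) (x := x)
      refine ⟨hx, ?_⟩
      rintro v (rfl | rfl | hv)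
      exacts [h1.1, h1.2, h v (by simp [hv])]
    · rintro x hx
      refine ⟨hx.1, ?_⟩
      rintro v (rfl | hv)
      · exact hx.2 _ (by simp)
      · exact (fix_plane_le D a b (some t) hx).2 v hv

variable [Finite V]

lemma pairAcy_line (hodd : Odd p) {D : Set V} {a b : V} {n : ℕ} (c : Option (ZMod p))
    (hC : Sph (sbd _ _) (null _ {0}) (L.W p (insert (line p a b c) D)) n)
    (hF : Sph (sbd _ _) (null _ {0}) (L.W p (insert a (insert b D))) n) (i : ℕ) :
    PairAcy (sbd _ _) (null _ {0}) (L.W p (insert (line p a b c) D))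
      (L.W p (insert a (insert b D))) i := by
  obtain ⟨g, hg⟩ := fix_plane_eq (L := L) D a b c
  have S := L.smithData p (insert (line p a b c) D) g
  have e : L.W p (insert g (insert (line p a b c) D)) = L.W p (insert a (insert b D)) := by
    unfold W; rw [hg]
  rw [e] at S
  exact pairAcy_of_sph S.dd S.dV S.grW S.F_le hC hF
    (fun f hf hb => S.fixed_boundary hodd (Fact.out : p.Prime).one_lt hC hf hb) i

end LocalModel

end

section

namespace LocalModel

variable {p r : ℕ} [Fact p.Prime] {V : Type} [AddCommGroup V]
  {L : LocalModel r V}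

variable [Module (ZMod p) V]

/-- Simplices fixed by `D` and some line of the plane spanned by `a` and `b`. -/
def lineSimp (p : ℕ) {V : Type} [AddCommGroup V] [Module (ZMod p) V] (L : LocalModel r V)
    (D : Set V) (a b : V) : Set (List (Fin r → ℝ)) :=
  L.faceSimplices (Set.range fun c => insert (line p a b c) D)

lemma mem_lineSimp {D : Set V} {a b : V} {l : List (Fin r → ℝ)} :
    l ∈ lineSimp p L D a b ↔ ∃ c, l ∈ listsIn (L.fix (insert (line p a b c) D)) :=
  ⟨fun ⟨_, ⟨c, hc⟩, hl⟩ => ⟨c, by rw [← hc] at hl; exact hl⟩, fun ⟨c, hl⟩ => ⟨_, ⟨c, rfl⟩, hl⟩⟩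

lemma lineSimp_unique {D : Set V} {a b : V} {c c' : Option (ZMod p)} (hc : c ≠ c')
    {l : List (Fin r → ℝ)} (h : l ∈ listsIn (L.fix (insert (line p a b c) D)))
    (h' : l ∈ listsIn (L.fix (insert (line p a b c') D))) :
    l ∈ listsIn (L.fix (insert a (insert b D))) := by
  intro x hx
  have h1 := fixed_of_lines (a := a) (b := b) hc ((h x hx).2 _ (Set.mem_insert _ _))
    ((h' x hx).2 _ (Set.mem_insert _ _))
  refine ⟨(h x hx).1, ?_⟩
  rintro v (rfl | rfl | hv)
  exacts [h1.1, h1.2, (h x hx).2 v (by simp [hv])]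

variable [Finite V]

lemma sph_lines (hodd : Odd p) {D : Set V} {a b : V} {n : ℕ}
    (hC : ∀ c, Sph (sbd _ _) (null _ {0}) (L.W p (insert (line p a b c) D)) n)
    (hF : Sph (sbd _ _) (null _ {0}) (L.W p (insert a (insert b D))) n) :
    Sph (sbd _ _) (null _ {0})
      (fun n => L.W p D n ⊓ supp (ZMod p) (lineSimp p L D a b)) n := by
  have hp : NeZero p := ⟨(Fact.out : p.Prime).ne_zero⟩
  set A : Set (List (Fin r → ℝ)) := listsIn (L.fix (insert a (insert b D))) with hA
  let B : Option (ZMod p) → Set (List (Fin r → ℝ)) := fun c =>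
    listsIn (L.fix (insert (line p a b c) D))
  have hAB : ∀ c, A ⊆ B c := fun c => listsIn_mono (fix_plane_le D a b c)
  have key := hl_union (d := sbd (ZMod p) (Fin r → ℝ)) (V := null (ZMod p) {0})
    (G := fun n => L.W p D n ⊓ supp (ZMod p) (lineSimp p L D a b))
    (F := L.W p (insert a (insert b D)))
    (WC := fun c => L.W p (insert (line p a b c) D))
    (e := fun c => srs (ZMod p) (B c \ A))
    sbd_sbd (fun v hv => sbd_null hv) (gr_smallDeg _) (fun c => gr_smallDeg _)
    (fun c v hv => srs_null _ hv)
    (fun n f hf => ⟨smallDeg_mono (L.fix_anti fun v hv => by simp [hv]) n hf, fun j =>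
      supported_mono (fun l hl => mem_lineSimp.2 ⟨none, hAB none hl⟩) (hf.1.1 j)⟩)
    (fun c n f hf => ⟨smallDeg_mono (L.fix_anti fun v hv => by simp [hv]) n hf, fun j =>
      supported_mono (fun l hl => mem_lineSimp.2 ⟨c, hl⟩) (hf.1.1 j)⟩)
    ?_ ?_ ?_ ?_ ?_ (fun c i => pairAcy_line hodd c (hC c) hF i)
  · exact ⟨(key n).trans hF.1, fun m hm => (key m).trans (hF.2 m hm)⟩
  · intro n g hg
    have e : g - ∑ c, srs (ZMod p) (B c \ A) g = srs (ZMod p) A g := by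
      rw [sub_eq_iff_eq_add]
      funext j
      rw [Pi.add_apply, Finset.sum_apply]
      have := eq_on_supported (f := LinearMap.id)
        (g := rs (ZMod p) A + ∑ c, rs (ZMod p) (B c \ A)) (fun l hl => ?_) (hg.2 j)
      · rw [LinearMap.add_apply, LinearMap.sum_apply] at this
        exact this
      · rw [LinearMap.add_apply, LinearMap.sum_apply, LinearMap.id_apply]
        by_cases hlA : l ∈ A
        · rw [rs_single_of_mem hlA, Finset.sum_eq_zero, add_zero]
          exact fun c _ => rs_single_of_notMem fun h => h.2 hlA
        · obtain ⟨c, hc⟩ := mem_lineSimp.1 hl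
          rw [rs_single_of_notMem hlA, zero_add, Finset.sum_eq_single c,
            rs_single_of_mem (s := B c \ A) ⟨hc, hlA⟩]
          · exact fun c' _ hcc => rs_single_of_notMem fun h => hlA (lineSimp_unique hcc h.1 hc)
          · exact fun h => absurd (Finset.mem_univ c) h
    rw [e]
    exact smallDeg_of_supported (srs_smallDeg A hg.1) (srs_supported A g)
  · intro c n g hg
    exact smallDeg_of_supported (srs_smallDeg _ hg.1) fun j =>
      supported_mono (s := B c \ A) Set.sdiff_subset (srs_supported _ g j)
  · intro c n f hf
    exact funext fun j => rs_eq_zero (Set.disjoint_sdiff_right) (hf.1.1 j)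
  · intro c n y hy
    refine smallDeg_of_supported (sub_mem hy (srs_smallDeg _ hy)) fun j => ?_
    refine supported_mono (t := A) ?_ (sub_rs_mem (B c \ A) (B c) (hy.1.1 j))
    rintro l ⟨h1, h2⟩
    by_contra h
    exact h2 ⟨h1, h⟩
  · intro c c' hcc n y hy
    refine funext fun j => rs_eq_zero (t := B c) ?_ (hy.1.1 j)
    exact Set.disjoint_left.2 fun l hl hl₂ => hl₂.2 (lineSimp_unique hcc hl hl₂.1)

/-- Two commuting independent symmetries cannot have all their fixed point spheres of the
same smaller dimension. -/
theorem rank_two (hodd : Odd p) {D : Set V} {a b : V} {n s : ℕ}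
    (hW : Sph (sbd _ _) (null _ {0}) (L.W p D) s)
    (hC : ∀ c, Sph (sbd _ _) (null _ {0}) (L.W p (insert (line p a b c) D)) n)
    (hF : Sph (sbd _ _) (null _ {0}) (L.W p (insert a (insert b D))) n) (hns : n + 2 ≤ s) :
    False := by
  have hG := sph_lines hodd hC hF
  obtain ⟨h1, h2, h3⟩ := relative_homology (d := sbd (ZMod p) (Fin r → ℝ))
    (V' := relNull (ZMod p) {0} (lineSimp p L D a b)) sbd_sbd (fun v hv => sbd_null hv)
    (gr_smallDeg _) (fun _ => inf_le_left) hW hG hns (null_le_relNull _ _)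
    (fun n g hg => mem_relNull_of_supported hg.2)
    (fun i c hc h => ⟨srs _ (lineSimp p L D a b) c,
      ⟨srs_smallDeg _ hc, srs_supported _ c⟩, h⟩)
  obtain ⟨M, hM⟩ := L.acy_high p
  have hMim : ∀ {ϖ : Module.End (ZMod p) (Chains r p)}, Natural L ϖ → ∀ n > M,
      Acy (sbd _ _) (relNull _ {0} (lineSimp p L D a b)) (im ϖ (L.W p D)) n :=
    fun hϖ n hn => hM n hn D _ _ hϖ
  have him : ∀ ϖ ϖ' : Module.End (ZMod p) (Chains r p),
      im ϖ (im ϖ' (L.W p D)) = im (ϖ * ϖ') (L.W p D) := fun ϖ ϖ' =>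
    funext fun n => (Submodule.map_comp ϖ' ϖ (L.W p D n)).symm
  have hbad : ∀ (a' b' : V), (∀ t : ZMod p, ∃ c, t • a' + b' = line p a b c) → ∀ n,
      ∀ y ∈ L.W p D n, srs _ (L.bad (p := p) a' b') y ∈
        relNull (ZMod p) {0} (lineSimp p L D a b) := by
    intro a' b' hab n y hy
    refine mem_relNull_of_supported fun j =>
      supported_mono ?_ (rs_mem_inter (L.bad (p := p) a' b') _ (hy.1.1 j))
    rintro l ⟨h1, h2⟩
    obtain ⟨t, ht⟩ := mem_bad h2
    obtain ⟨c, hc⟩ := hab t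
    refine mem_lineSimp.2 ⟨c, fun x hx => ⟨(h1 x hx).1, ?_⟩⟩
    rintro v (rfl | hv)
    · rw [← hc]; exact ht x hx
    · exact (h1 x hx).2 v hv
  have hbad_a := hbad 0 a fun t => ⟨none, by simp [line]⟩
  have hbad_b := hbad a b fun t => ⟨some t, rfl⟩
  obtain ⟨D₁, -, hD₁⟩ := L.exists_domain (p := p) 0 a
  obtain ⟨D₂, hD₂a, hD₂⟩ := L.exists_domain (p := p) a b
  have E : ExPair (sbd _ _) (relNull _ {0} (lineSimp p L D a b)) (L.W p D)
      (L.sig p a) (L.nrm p a) :=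
    exPair (gr_smallDeg _) (fun n v y hy => L.act_W v D n hy)
      (fun n y hy => srs_smallDeg _ hy) hbad_a hD₁
  have E' : ∀ ϖ : Module.End (ZMod p) (Chains r p), Natural L ϖ →
      (∀ c, srs _ D₂ (ϖ c) = ϖ (srs _ D₂ c)) →
      ExPair (sbd _ _) (relNull _ {0} (lineSimp p L D a b)) (im ϖ (L.W p D))
        (L.sig p b) (L.nrm p b) := by
    intro ϖ hϖ hcomm
    refine exPair (D := D₂) ⟨?_, ?_⟩ ?_ ?_ ?_ hD₂
    · rintro n _ ⟨w, hw, rfl⟩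
      exact ⟨_, (gr_smallDeg (L.fix D)).succ n w hw, hϖ.sbd w⟩
    · rintro _ ⟨w, hw, rfl⟩
      rw [← hϖ.sbd, (gr_smallDeg (L.fix D)).zero w hw, map_zero]
    · rintro n v _ ⟨w, hw, rfl⟩
      exact ⟨_, L.act_W v D n hw,
        (hϖ.comm (L.act p v) (fun u c => L.act_commute v u c) w).symm⟩
    · rintro n _ ⟨w, hw, rfl⟩
      exact ⟨_, srs_smallDeg D₂ hw, (hcomm w).symm⟩
    · rintro n _ ⟨w, hw, rfl⟩
      exact hbad_b n _ (hϖ.W_mem hw)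
  have hsigc : ∀ c, srs _ D₂ (L.sig p a c) = L.sig p a (srs _ D₂ c) := fun c => by
    rw [sig_apply, sig_apply, map_sub, hD₂a]
  have hnrmc : ∀ c, srs _ D₂ (L.nrm p a c) = L.nrm p a (srs _ D₂ c) := by
    have h : Commute (srs (ZMod p) D₂ : Module.End (ZMod p) (Chains r p)) (L.sig p a) :=
      LinearMap.ext hsigc
    have h' := h.pow_right (p - 1)
    rw [sig_pow_pred] at h'
    exact fun c => LinearMap.congr_fun h' c
  refine rank_two_core (s := n + 1) (r := s) (M := M) E
    (E' _ (Natural.sig a) hsigc) (E' _ (Natural.nrm a) hnrmc) (fun x => L.sig_nrm_comm b a x)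
    (fun x => (L.sig_nrm_comm a b x).symm) (fun x => L.nrm_nrm b a x)
    (fun n w hw => (Natural.nrm b).W_mem hw) (by omega) h3 ?_ ?_
    (fun n hn => ⟨hMim (Natural.sig a) n hn, hMim (Natural.nrm a) n hn⟩) ?_ ?_
  · intro i hi z hz hdz
    have h1i : hl (sbd (ZMod p) (Fin r → ℝ)) (relNull (ZMod p) {0} (lineSimp p L D a b))
        (L.W p D) i = 1 := by
      rcases hi with rfl | rfl
      exacts [h1, h2]
    have key : ∀ {ϖ : Module.End (ZMod p) (Chains r p)}, Natural L ϖ → (∀ x, (ϖ ^ p) x = 0) →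
        ϖ z ∈ bdr (sbd _ _) (relNull _ {0} (lineSimp p L D a b)) (L.W p D) i :=
      fun hϖ hq => nilpotent_mem_bdr h1i hϖ.sbd (fun v hv => hϖ.rel_mem hv)
        (fun n w hw => hϖ.W_mem hw) hq hz hdz
    exact ⟨key (Natural.sig a) (L.sig_pow a), key (Natural.nrm a) (nrm_pow a),
      key (Natural.sig b) (L.sig_pow b), key (Natural.nrm b) (nrm_pow b)⟩
  · intro h
    rw [hl_eq_zero.2 h] at h1
    exact zero_ne_one h1
  · intro n hn
    rw [him, him]
    exact ⟨hMim ((Natural.sig b).mul (Natural.sig a)) n hn,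
      hMim ((Natural.nrm b).mul (Natural.sig a)) n hn⟩
  · intro n hn
    rw [him, him]
    exact ⟨hMim ((Natural.sig b).mul (Natural.nrm a)) n hn,
      hMim ((Natural.nrm b).mul (Natural.nrm a)) n hn⟩

end LocalModel

end

section

namespace LocalModel

lemma rank_bound {p : ℕ} [Fact p.Prime] {V : Type} [AddCommGroup V] [Module (ZMod p) V] [Finite V]
    (N : Submodule (ZMod p) V → ℕ)
    (hmono : ∀ D a, N (D ⊔ Submodule.span _ {a}) ≤ N D)
    (hpar : ∀ D a, N (D ⊔ Submodule.span _ {a}) % 2 = N D % 2)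
    (hlines : ∀ D a b n, (∀ c, N (D ⊔ Submodule.span _ {line p a b c}) = n) →
      N (D ⊔ Submodule.span _ {a} ⊔ Submodule.span _ {b}) = n → ¬ n + 2 ≤ N D)
    (heff : ∀ v, v ≠ 0 → N (⊥ ⊔ Submodule.span _ {v}) < N ⊥) (H : Submodule (ZMod p) V) :
    N H + 2 * Module.finrank (ZMod p) H ≤ N ⊥ := by
  induction H using WellFoundedLT.induction with
  | ind H ih =>
  by_cases hH : H = ⊥
  · subst hH; simp
  by_cases hex : ∃ (D : Submodule (ZMod p) V) (a : V), a ∉ D ∧ D ⊔ Submodule.span _ {a} = H ∧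
      N H < N D
  · obtain ⟨D, a, ha, rfl, hlt⟩ := hex
    have h1 := ih D (lt_of_le_of_ne le_sup_left fun h =>
      ha (h ▸ (le_sup_right : _ ≤ D ⊔ _) (Submodule.mem_span_singleton_self a)))
    have h2 := hpar D a
    have h3 := Submodule.finrank_add_le_finrank_add_finrank D (Submodule.span (ZMod p) {a})
    have h4 := finrank_span_singleton (K := ZMod p) (v := a) fun h => ha (h ▸ zero_mem D)
    omega
  · exfalso
    have key : ∀ D : Submodule (ZMod p) V, D ≤ H → N D = N H := by
      intro D
      induction D using WellFoundedGT.induction with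
      | ind D ihD =>
      intro hD
      by_cases hDH : D = H
      · rw [hDH]
      obtain ⟨a, haH, haD⟩ := SetLike.exists_of_lt (lt_of_le_of_ne hD hDH)
      have hstep : ∀ v ∈ H, v ∉ D → N (D ⊔ Submodule.span _ {v}) = N H := fun v hv hvD =>
        ihD _ (lt_of_le_of_ne le_sup_left fun h =>
          hvD (h ▸ (le_sup_right : _ ≤ D ⊔ _) (Submodule.mem_span_singleton_self v)))
          (sup_le hD ((Submodule.span_singleton_le_iff_mem _ _).2 hv))
      have ha := hstep a haH haD
      have hm := hmono D a
      by_cases htop : D ⊔ Submodule.span _ {a} = H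
      · have : ¬ N H < N D := fun h => hex ⟨D, a, haD, htop, h⟩
        omega
      have hle : D ⊔ Submodule.span _ {a} ≤ H :=
        sup_le hD ((Submodule.span_singleton_le_iff_mem _ _).2 haH)
      obtain ⟨b, hbH, hbD⟩ := SetLike.exists_of_lt (lt_of_le_of_ne hle htop)
      have hpl : N (D ⊔ Submodule.span _ {a} ⊔ Submodule.span _ {b}) = N H := by
        refine ihD _ (lt_of_le_of_ne (le_sup_left.trans le_sup_left) fun h => ?_)
          (sup_le hle ((Submodule.span_singleton_le_iff_mem _ _).2 hbH))
        refine haD (h ▸ ?_)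
        exact (le_sup_right.trans le_sup_left : _ ≤ D ⊔ Submodule.span _ {a} ⊔ _)
          (Submodule.mem_span_singleton_self a)
      have hl := hlines D a b (N H) (fun c => ?_) hpl
      · have := hpar D a
        omega
      · rcases c with _ | t
        · exact ha
        · refine hstep (t • a + b) (add_mem (H.smul_mem t haH) hbH) fun h => hbD ?_
          have h1 : t • a ∈ D ⊔ Submodule.span (ZMod p) {a} := Submodule.smul_mem _ t
            ((le_sup_right : _ ≤ D ⊔ _) (Submodule.mem_span_singleton_self a))
          have h2 := sub_mem ((le_sup_left : D ≤ D ⊔ Submodule.span (ZMod p) {a}) h) h1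
          simpa using h2
    obtain ⟨v, hv, hv0⟩ := Submodule.exists_mem_ne_zero_of_ne_bot hH
    have h1 := heff v hv0
    rw [key ⊥ bot_le, key _ (sup_le bot_le ((Submodule.span_singleton_le_iff_mem _ _).2 hv))] at h1
    exact lt_irrefl _ h1

variable {p r : ℕ} [Fact p.Prime] {V : Type} [AddCommGroup V] [Module (ZMod p) V]
  {L : LocalModel r V}

lemma fix_sup (L : LocalModel r V) (D : Submodule (ZMod p) V) (a : V) :
    L.fix ((D ⊔ Submodule.span (ZMod p) {a} : Submodule (ZMod p) V) : Set V) =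
      L.fix (insert a (D : Set V)) := by
  refine Set.Subset.antisymm (L.fix_anti ?_) ?_
  · rintro v (rfl | hv)
    · exact (le_sup_right : _ ≤ D ⊔ _) (Submodule.mem_span_singleton_self _)
    · exact (le_sup_left : D ≤ D ⊔ _) hv
  · rintro x ⟨hx, h⟩
    refine ⟨hx, fun v hv => ?_⟩
    obtain ⟨d, hd, y, hy, rfl⟩ := Submodule.mem_sup.1 hv
    obtain ⟨t, rfl⟩ := Submodule.mem_span_singleton.1 hy
    rw [L.add, L.ρ_smul (h a (Set.mem_insert _ _)), h d (Set.mem_insert_of_mem _ hd)]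

variable [Finite V]

lemma exists_sph (hodd : Odd p) (L : LocalModel r V) (S : Set V) :
    ∃ n, Sph (sbd _ _) (null _ {0}) (L.W p S) n := by
  induction S, S.toFinite using Set.Finite.induction_on with
  | empty => exact ⟨_, L.sph p⟩
  | insert _ _ ih =>
    obtain ⟨n, hn⟩ := ih
    obtain ⟨-, m, -, -, hm⟩ := (L.smithData p _ _).smith hodd (Fact.out : p.Prime).one_lt hn
    exact ⟨m, hm⟩

/-- An action on a local model none of whose nontrivial elements is locally trivial has small
rank. -/
theorem two_mul_finrank_le (hodd : Odd p) (L : LocalModel r V)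
    (heff : ∀ v, v ≠ 0 → L.fix {v} ∉ 𝓝 0) : 2 * Module.finrank (ZMod p) V ≤ r := by
  have hp : 1 < p := (Fact.out : p.Prime).one_lt
  choose N hN using fun D : Submodule (ZMod p) V => L.exists_sph hodd (D : Set V)
  have e : ∀ (D : Submodule (ZMod p) V) a,
      L.W p ((D ⊔ Submodule.span (ZMod p) {a} : Submodule (ZMod p) V) : Set V) =
        L.W p (insert a (D : Set V)) := by
    intro D a; unfold W; rw [fix_sup]
  have e0 : L.W p ((⊥ : Submodule (ZMod p) V) : Set V) = L.W p ∅ := by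
    unfold W
    have : L.fix ((⊥ : Submodule (ZMod p) V) : Set V) = L.fix ∅ :=
      Set.Subset.antisymm (L.fix_anti (Set.empty_subset _)) fun x hx => ⟨hx.1, fun v hv => by
        rw [show v = 0 from hv, L.zero]⟩
    rw [this]
  have hbot : N ⊥ = r + 1 := by
    have := hN ⊥
    rw [e0] at this
    exact this.unique (L.sph p)
  have hstep : ∀ (D : Submodule (ZMod p) V) a, N (D ⊔ Submodule.span _ {a}) ≤ N D ∧
      N (D ⊔ Submodule.span _ {a}) % 2 = N D % 2 := by
    intro D a
    obtain ⟨-, m, h1, h2, h3⟩ := (L.smithData p D a).smith hodd hp (hN D)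
    have h4 := hN (D ⊔ Submodule.span _ {a})
    rw [e] at h4
    rw [h4.unique h3]
    exact ⟨h1, h2⟩
  have key := rank_bound N (fun D a => (hstep D a).1) (fun D a => (hstep D a).2) ?_ ?_ ⊤
  · have h1 : N ⊤ ≠ 0 := by
      intro h
      have h2 := (hN ⊤).1
      have h3 : Acy (sbd (ZMod p) (Fin r → ℝ)) (null _ {0}) (L.W p (⊤ : Submodule (ZMod p) V)) 0 :=
        fun c hc _ => ⟨0, zero_mem _, by
          rw [map_zero, sub_zero]; exact smallDeg_zero_le _ _ hc⟩
      rw [h, hl_eq_zero.2 h3] at h2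
      exact zero_ne_one h2
    rw [hbot, finrank_top] at key
    omega
  · intro D a b n hl hF hle
    refine rank_two (L := L) (D := (D : Set V)) (a := a) (b := b) hodd (hN D) (n := n)
      (fun c => ?_) ?_ hle
    · rw [← e, ← hl c]; exact hN _
    · have h1 := hN (D ⊔ Submodule.span _ {a} ⊔ Submodule.span _ {b})
      rw [hF, sup_right_comm, e] at h1
      have e2 : L.fix (insert a ((D ⊔ Submodule.span _ {b} : Submodule (ZMod p) V) : Set V)) =
          L.fix (insert a (insert b (D : Set V))) := by
        have : ∀ T : Set V, L.fix (insert a T) = {x | x ∈ L.fix T ∧ L.ρ a x = x} := by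
          intro T
          ext x
          simp only [fix, Set.mem_ofPred_eq, Set.forall_mem_insert]
          tauto
        rw [this, this, fix_sup]
      unfold W at h1 ⊢
      rwa [e2] at h1
  · intro v hv
    have h1 := hN (⊥ ⊔ Submodule.span _ {v})
    have h2 := (hstep ⊥ v).1
    refine lt_of_le_of_ne h2 fun h => heff v hv (fix_nhds_of_sph (p := p) hodd ?_)
    have e1 : L.W p ((⊥ ⊔ Submodule.span (ZMod p) {v} : Submodule (ZMod p) V) : Set V) =
        L.W p {v} := by
      have : L.fix (insert v ((⊥ : Submodule (ZMod p) V) : Set V)) = L.fix {v} := by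
        refine Set.Subset.antisymm (L.fix_anti
          (Set.singleton_subset_iff.2 (Set.mem_insert _ _))) fun x hx => ⟨hx.1, ?_⟩
        rintro w (rfl | hw)
        · exact hx.2 _ rfl
        · rw [show w = 0 from hw, L.zero]
      unfold W
      rw [fix_sup, this]
    rwa [e1, h, hbot] at h1

end LocalModel

end

section

/-- A centred chart of a manifold with values in `ℝ^r`. -/
lemma exists_centred_chart {r : ℕ} {M : Type*} [TopologicalSpace M]
    [ChartedSpace (EuclideanSpace ℝ (Fin r)) M] (y : M) :
    ∃ e : OpenPartialHomeomorph M (Fin r → ℝ), y ∈ e.source ∧ e y = 0 := by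
  let e₀ := (chartAt (EuclideanSpace ℝ (Fin r)) y).transHomeomorph
    (EuclideanSpace.equiv (Fin r) ℝ).toHomeomorph
  refine ⟨e₀.transHomeomorph (Homeomorph.addRight (-(e₀ y))), mem_chart_source _ y, ?_⟩
  simp

/-- A finite group acting on a manifold with a fixed point acts on a local model around it. -/
lemma exists_localModel {r : ℕ} {M : Type*} [TopologicalSpace M] [T2Space M]
    [ChartedSpace (EuclideanSpace ℝ (Fin r)) M] {V : Type} [AddCommGroup V] [Finite V]
    (ψ : V → M → M) (hc : ∀ v, Continuous (ψ v)) (h0 : ∀ m, ψ 0 m = m)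
    (hadd : ∀ u v m, ψ (u + v) m = ψ u (ψ v m)) {y : M} (hy : ∀ v, ψ v y = y) :
    ∃ (L : LocalModel r V) (e : OpenPartialHomeomorph M (Fin r → ℝ)), y ∈ e.source ∧ e y = 0 ∧
      ∀ v, ∀ m ∈ e.source, e m ∈ L.X → (L.ρ v (e m) = e m ↔ ψ v m = m) := by
  classical
  obtain ⟨e, hye, hey⟩ := exists_centred_chart (r := r) y
  obtain ⟨R, hR, hRt⟩ := Metric.nhds_basis_closedBall.mem_iff.1
    (e.open_target.mem_nhds (hey ▸ e.map_source hye))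
  set B : Set M := e.symm '' Metric.closedBall 0 R with hB
  have hBs : B ⊆ e.source := by
    rintro _ ⟨x, hx, rfl⟩; exact e.map_target (hRt hx)
  have hBc : IsCompact B :=
    (isCompact_closedBall 0 R).image_of_continuousOn (e.continuousOn_symm.mono hRt)
  have hBy : B ∈ 𝓝 y := by
    have h1 : e ⁻¹' Metric.closedBall 0 R ∈ 𝓝 y :=
      (e.continuousAt hye).preimage_mem_nhds (by rw [hey]; exact Metric.closedBall_mem_nhds 0 hR)
    filter_upwards [h1, e.open_source.mem_nhds hye] with m h2 h3
    exact ⟨e m, h2, e.left_inv h3⟩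
  set Y : Set M := {m | ∀ v, ψ v m ∈ B} with hY
  have hYB : Y ⊆ B := fun m hm => by simpa [h0] using hm 0
  have hYs : Y ⊆ e.source := hYB.trans hBs
  have hYcl : IsClosed Y := by
    have : Y = ⋂ v, ψ v ⁻¹' B := by ext m; simp [hY]
    rw [this]
    exact isClosed_iInter fun v => hBc.isClosed.preimage (hc v)
  have hYc : IsCompact Y := hBc.of_isClosed_subset hYcl hYB
  have hYy : Y ∈ 𝓝 y := by
    have : Y = ⋂ v, ψ v ⁻¹' B := by ext m; simp [hY]
    rw [this]
    exact iInter_mem.2 fun v => (hc v).continuousAt.preimage_mem_nhds (by rw [hy]; exact hBy)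
  have hYψ : ∀ v, ∀ m ∈ Y, ψ v m ∈ Y := fun v m hm u => by rw [← hadd]; exact hm _
  have hmem : ∀ x, x ∈ e '' Y → e.symm x ∈ Y ∧ x ∈ e.target := by
    rintro _ ⟨m, hm, rfl⟩
    rw [e.left_inv (hYs hm)]
    exact ⟨hm, e.map_source (hYs hm)⟩
  let ρ : V → (Fin r → ℝ) → (Fin r → ℝ) := fun v x =>
    if x ∈ e '' Y then e (ψ v (e.symm x)) else x
  have hρ : ∀ v, ∀ m ∈ Y, ρ v (e m) = e (ψ v m) := fun v m hm => by
    simp only [ρ]; rw [if_pos ⟨m, hm, rfl⟩, e.left_inv (hYs hm)]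
  have hρ' : ∀ v x, x ∉ e '' Y → ρ v x = x := fun v x hx => if_neg hx
  refine ⟨⟨e '' Y, ρ, hYc.image_of_continuousOn (e.continuousOn.mono hYs), ?_, ?_, ?_, ?_, ?_, ?_⟩,
    e, hye, hey, ?_⟩
  · rw [← hey, ← e.map_nhds_eq hye]; exact image_mem_map hYy
  · intro x
    by_cases hx : x ∈ e '' Y
    · obtain ⟨m, hm, rfl⟩ := hx
      rw [hρ _ _ hm, h0]
    · exact hρ' _ _ hx
  · intro u v x
    by_cases hx : x ∈ e '' Y
    · obtain ⟨m, hm, rfl⟩ := hx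
      rw [hρ _ _ hm, hρ _ _ hm, hρ _ _ (hYψ v m hm), hadd]
    · rw [hρ' _ _ hx, hρ' _ _ hx, hρ' _ _ hx]
  · rintro v _ ⟨m, hm, rfl⟩
    rw [hρ _ _ hm]; exact ⟨_, hYψ v m hm, rfl⟩
  · intro v
    have h1 : ContinuousOn (fun x => e (ψ v (e.symm x))) (e '' Y) := by
      refine e.continuousOn.comp ((hc v).comp_continuousOn
        (e.continuousOn_symm.mono fun x hx => (hmem x hx).2)) fun x hx => ?_
      exact hYs (hYψ v _ (hmem x hx).1)
    exact h1.congr fun x hx => if_pos hx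
  · intro v
    rw [← hey, hρ _ _ (mem_of_mem_nhds hYy), hy]
  · rintro v m hm ⟨m', hm', he⟩
    obtain rfl : m' = m := e.injOn (hYs hm') hm he
    change ρ v (e m') = e m' ↔ ψ v m' = m'
    rw [hρ _ _ hm', e.injOn.eq_iff (hYs (hYψ v _ hm')) hm]

section

variable {p : ℕ} [Fact p.Prime] {M : Type*} [TopologicalSpace M] [T2Space M]
  {V : Type} [AddCommGroup V] [Module (ZMod p) V] {ψ : V → M → M}

/-- The interior of the fixed point set of a symmetry of odd prime order is closed. -/
lemma isClosed_interior_fixed (r : ℕ) [ChartedSpace (EuclideanSpace ℝ (Fin r)) M]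
    (hodd : Odd p) (hc : ∀ v, Continuous (ψ v)) (h0 : ∀ m, ψ 0 m = m)
    (hadd : ∀ u v m, ψ (u + v) m = ψ u (ψ v m)) (v : V) :
    IsClosed (interior {m | ψ v m = m}) := by
  have hp : NeZero p := ⟨(Fact.out : p.Prime).ne_zero⟩
  refine isClosed_of_closure_subset fun y hy => ?_
  have hyv : ψ v y = y :=
    closure_minimal interior_subset (isClosed_eq (hc v) continuous_id) hy
  have hy' : ∀ t : ZMod p, ψ (t • v) y = y := by
    have key : ∀ i : ℕ, ψ ((i : ZMod p) • v) y = y := by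
      intro i
      induction i with
      | zero => simp [h0]
      | succ i ih => rw [Nat.cast_succ, add_smul, one_smul, hadd, hyv, ih]
    intro t
    have := key t.val
    rwa [ZMod.natCast_zmod_val] at this
  obtain ⟨L, e, hye, hey, hL⟩ := exists_localModel (r := r) (fun t : ZMod p => ψ (t • v))
    (fun t => hc _) (fun m => by rw [zero_smul, h0])
    (fun s t m => by rw [add_smul, hadd]) hy'
  have hfix : ∀ m ∈ e.source, e m ∈ L.X → (e m ∈ L.fix {1} ↔ ψ v m = m) := by
    intro m hm hmX
    have := hL 1 m hm hmX
    rw [one_smul] at this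
    rw [← this]
    exact ⟨fun h => h.2 1 rfl, fun h => ⟨hmX, fun u hu => by rw [Set.mem_singleton_iff.1 hu, h]⟩⟩
  have hcl : (0 : Fin r → ℝ) ∈ closure (interior (L.fix {1})) := by
    rw [mem_closure_iff_nhds]
    intro U hU
    have h1 : e ⁻¹' (U ∩ interior L.X) ∈ 𝓝 y := (e.continuousAt hye).preimage_mem_nhds
      (by rw [hey]; exact inter_mem hU (interior_mem_nhds.2 L.nhds))
    obtain ⟨m, ⟨hm1, hm2⟩, hm3⟩ := mem_closure_iff_nhds.1 hy _
      (inter_mem h1 (e.open_source.mem_nhds hye))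
    refine ⟨e m, hm1.1, mem_interior_iff_mem_nhds.2 ?_⟩
    rw [← e.map_nhds_eq hm2]
    have h2 : e ⁻¹' L.X ∈ 𝓝 m :=
      (e.continuousAt hm2).preimage_mem_nhds (mem_interior_iff_mem_nhds.1 hm1.2)
    refine mem_map.2 ?_
    filter_upwards [h2, e.open_source.mem_nhds hm2, mem_interior_iff_mem_nhds.1 hm3] with m' a b c
    exact (hfix m' b a).2 c
  have hn := LocalModel.fix_nhds_of_mem_closure hodd hcl
  refine mem_interior_iff_mem_nhds.2 ?_
  have h1 : e ⁻¹' L.fix {1} ∈ 𝓝 y := (e.continuousAt hye).preimage_mem_nhds (by rwa [hey])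
  filter_upwards [h1, e.open_source.mem_nhds hye] with m a b
  exact (hfix m b a.1).1 a

/-- An effective action of an elementary abelian group of odd order on a connected manifold
with a fixed point has rank at most half the dimension. -/
theorem two_mul_finrank_le {r : ℕ} [ChartedSpace (EuclideanSpace ℝ (Fin r)) M]
    [ConnectedSpace M] [Finite V] (hodd : Odd p) (hc : ∀ v, Continuous (ψ v))
    (h0 : ∀ m, ψ 0 m = m) (hadd : ∀ u v m, ψ (u + v) m = ψ u (ψ v m))
    (heff : ∀ v, (∀ m, ψ v m = m) → v = 0) {x : M} (hx : ∀ v, ψ v x = x) :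
    2 * Module.finrank (ZMod p) V ≤ r := by
  obtain ⟨L, e, hxe, hex, hL⟩ := exists_localModel (r := r) ψ hc h0 hadd hx
  refine LocalModel.two_mul_finrank_le hodd L fun v hv hn => hv (heff v fun m => ?_)
  have hclopen : IsClopen (interior {m | ψ v m = m}) :=
    ⟨isClosed_interior_fixed r hodd hc h0 hadd v, isOpen_interior⟩
  have hxi : x ∈ interior {m | ψ v m = m} := by
    refine mem_interior_iff_mem_nhds.2 ?_
    have h1 : e ⁻¹' L.fix {v} ∈ 𝓝 x := (e.continuousAt hxe).preimage_mem_nhds (by rwa [hex])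
    filter_upwards [h1, e.open_source.mem_nhds hxe] with m a b
    exact (hL v m b a.1).1 (a.2 v rfl)
  have huniv := hclopen.eq_univ ⟨x, hxi⟩
  have hm : m ∈ interior {m | ψ v m = m} := by rw [huniv]; exact Set.mem_univ m
  have hm' := interior_subset hm
  exact hm'

end

end

end SmithBound

/-- Mann–Su: an elementary abelian `p`-group (`p` an odd prime) acting faithfully
with nonempty fixed point set on a connected topological `r`-manifold has rank at
most `r/2`, i.e. `2k ≤ r`. -/
theorem statement13 (p r k : ℕ) (hp : p.Prime) (hodd : Odd p)
    (M : Type*) [TopologicalSpace M] [T2Space M] [SecondCountableTopology M]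
    [ConnectedSpace M] [ChartedSpace (EuclideanSpace ℝ (Fin r)) M]
    (φ : (Fin k → Multiplicative (ZMod p)) →* (M ≃ₜ M))
    (hinj : Function.Injective φ)
    (hfix : ∃ x : M, ∀ g, φ g x = x) :
    2 * k ≤ r := by
  have : Fact p.Prime := ⟨hp⟩
  obtain ⟨x, hx⟩ := hfix
  suffices h : 2 * Module.finrank (ZMod p) (Fin k → ZMod p) ≤ r by
    rwa [Module.finrank_fin_fun] at h
  refine SmithBound.two_mul_finrank_le (r := r) (V := Fin k → ZMod p)
    (ψ := fun v => φ fun i => Multiplicative.ofAdd (v i)) hodd (fun v => (φ _).continuous)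
    (fun m => ?_) (fun u v m => ?_) (fun v hv => ?_) (fun v => hx _)
  · exact (DFunLike.congr_fun (map_one φ) m).trans (homeo_one_apply m)
  · exact DFunLike.congr_fun (map_mul φ (fun i => Multiplicative.ofAdd (u i))
      fun i => Multiplicative.ofAdd (v i)) m
  · have h1 : (fun i => Multiplicative.ofAdd (v i)) = (1 : Fin k → Multiplicative (ZMod p)) :=
      hinj ((Homeomorph.ext hv).trans (map_one φ).symm)
    funext i
    exact congr_fun h1 i
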